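/- Let Γ↷X and Λ↷Y be free ergodic pmp actions with Γ icc, and assume Θ: L∞(X)⋊Γ → L∞(Y)⋊Λ is a *-isomorphism such that Θ(L∞(X)) = L∞(Y) and there exists a unitary u ∈ L∞(Y)⋊Λ with Θ(L(Γ)) = u L(Λ) u*. Then one can find a unitary x normalizing L∞(Y) in L∞(Y)⋊Λ, a character η: Γ → 𝕋, and a group isomorphism δ: Γ → Λ such that xu ∈ U(L(Λ)) and Θ(a u_γ) = η(γ) Θ(a) x* v_{δ(γ)} x for all a ∈ L∞(X) and γ ∈ Γ. In particular, Γ↷X is conjugate to Λ↷Y. -/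

import Mathlib

/-!
Common framework: we model tracial von Neumann algebras concretely, as von Neumann
algebras `M ⊆ B(H)` (Mathlib's `VonNeumannAlgebra H`, i.e. star-subalgebras equal to
their double commutant) equipped with a faithful tracial state, and we model the
crossed product `A ⋊ Γ` of a trace-preserving action axiomatically: `M` contains a
copy of `A` and a group `(u γ)` of unitaries normalizing `A`, such that the canonical
trace-preserving conditional expectation `E_A` kills `u γ` for `γ ≠ 1`, and such that
an element of `M` all of whose Fourier coefficients `E_A (x (u γ)*)` vanish is `0`.
Probability-measure-preserving actions `Γ ↷ (X, μ)` are modelled via the associated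
trace-preserving action on the abelian von Neumann algebra `A = L^∞(X)`.
-/

noncomputable section

open scoped Classical

namespace CD

/-- A group has infinite conjugacy classes (icc) if every nontrivial conjugacy
class is infinite. -/
def IsICC (Γ : Type) [Group Γ] : Prop :=
  ∀ γ : Γ, γ ≠ 1 → {g : Γ | ∃ h : Γ, g = h * γ * h⁻¹}.Infinite

/-- A faithful tracial state on (the elements of) a set `M ⊆ B(H)` (in applications,
a von Neumann algebra), given as a globally defined linear functional whose
axioms are imposed on `M`. -/
structure TraceOn (H : Type) [NormedAddCommGroup H] [InnerProductSpace ℂ H] [CompleteSpace H]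
    (M : Set (H →L[ℂ] H)) : Type where
  τ : (H →L[ℂ] H) →ₗ[ℂ] ℂ
  unital : τ 1 = 1
  tracial : ∀ x ∈ M, ∀ y ∈ M, τ (x * y) = τ (y * x)
  star_eq : ∀ x ∈ M, τ (star x) = starRingEnd ℂ (τ x)
  nonneg : ∀ x ∈ M, 0 ≤ (τ (star x * x)).re ∧ (τ (star x * x)).im = 0
  faithful : ∀ x ∈ M, τ (star x * x) = 0 → x = 0

variable {H : Type} [NormedAddCommGroup H] [InnerProductSpace ℂ H] [CompleteSpace H]

/-- The 2-norm `‖x‖₂ = τ(x* x)^{1/2}` associated with a trace. -/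
def TraceOn.norm2 {M : Set (H →L[ℂ] H)} (tr : TraceOn H M) (x : H →L[ℂ] H) : ℝ :=
  Real.sqrt (tr.τ (star x * x)).re

/-- The (unique) trace-preserving conditional expectation from `M` onto a
von Neumann subalgebra `N ⊆ M`. -/
structure CondExpOn (H : Type) [NormedAddCommGroup H] [InnerProductSpace ℂ H] [CompleteSpace H]
    (M N : Set (H →L[ℂ] H)) (tr : TraceOn H M) : Type where
  E : (H →L[ℂ] H) →ₗ[ℂ] (H →L[ℂ] H)
  mem : ∀ x ∈ M, E x ∈ N
  fix : ∀ x ∈ N, E x = x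
  bimod : ∀ a ∈ N, ∀ b ∈ N, ∀ x ∈ M, E (a * x * b) = a * E x * b
  star_map : ∀ x ∈ M, E (star x) = star (E x)
  trace_eq : ∀ x ∈ M, tr.τ (E x) = tr.τ x
  contractive : ∀ x ∈ M, tr.norm2 (E x) ≤ tr.norm2 x

/-- The double commutant of a subset of `B(H)`: the von Neumann algebra
generated by `S` (for `S` a star-closed unital set). -/
def vnGen (S : Set (H →L[ℂ] H)) : Set (H →L[ℂ] H) :=
  Set.centralizer (Set.centralizer S)

/-- Model of the crossed product von Neumann algebra `M = A ⋊ Γ` of a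
trace-preserving action `Γ ↷ (A, τ)`: `M` is generated by a copy of `A`
and canonical unitaries `(u γ)` implementing the action, with its canonical
conditional expectation `E_A` onto `A` (characterising the Fourier coefficients),
together with the group von Neumann algebra `L(Γ) = {u γ : γ}'' ⊆ M` and the
conditional expectation onto it. -/
structure CrossedProduct (Γ : Type) [Group Γ]
    (H : Type) [NormedAddCommGroup H] [InnerProductSpace ℂ H] [CompleteSpace H] : Type where
  M : VonNeumannAlgebra H
  A : VonNeumannAlgebra H
  A_sub : (A : Set (H →L[ℂ] H)) ⊆ (M : Set (H →L[ℂ] H))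
  tr : TraceOn H (M : Set (H →L[ℂ] H))
  u : Γ → (H →L[ℂ] H)
  u_mem : ∀ γ, u γ ∈ M
  u_one : u 1 = 1
  u_mul : ∀ γ δ, u γ * u δ = u (γ * δ)
  u_star : ∀ γ, star (u γ) = u γ⁻¹
  conj_mem : ∀ (γ : Γ), ∀ a ∈ A, u γ * a * star (u γ) ∈ A
  EA : CondExpOn H (M : Set (H →L[ℂ] H)) (A : Set (H →L[ℂ] H)) tr
  EA_u : ∀ γ : Γ, γ ≠ 1 → EA.E (u γ) = 0
  fourier_sep : ∀ x ∈ M, (∀ γ : Γ, EA.E (x * star (u γ)) = 0) → x = 0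
  Lg : VonNeumannAlgebra H
  Lg_eq : (Lg : Set (H →L[ℂ] H)) = vnGen (Set.range u)
  Lg_sub : (Lg : Set (H →L[ℂ] H)) ⊆ (M : Set (H →L[ℂ] H))
  EL : CondExpOn H (M : Set (H →L[ℂ] H)) (Lg : Set (H →L[ℂ] H)) tr

variable {Γ : Type} [Group Γ]

/-- The action `σ_γ = Ad(u γ)` of `Γ` on `B(H)`, restricting to the given
action on `A`. -/
def CrossedProduct.σ (X : CrossedProduct Γ H) (γ : Γ) (x : H →L[ℂ] H) : H →L[ℂ] H :=
  X.u γ * x * star (X.u γ)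

/-- The action is properly outer over the center of `P`; for abelian `P` this is
the usual freeness of the action. -/
def ProperlyOuterOn (X : CrossedProduct Γ H) (P : Set (H →L[ℂ] H)) : Prop :=
  ∀ γ : Γ, γ ≠ 1 → ∀ a ∈ P, (∀ b ∈ P, X.σ γ b * a = a * b) → a = 0

/-- Freeness of the action `Γ ↷ A`. -/
def IsFree (X : CrossedProduct Γ H) : Prop := ProperlyOuterOn X (X.A : Set (H →L[ℂ] H))

/-- Ergodicity of the action `Γ ↷ A`: the fixed points are the scalars. -/
def IsErgodic (X : CrossedProduct Γ H) : Prop :=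
  ∀ a ∈ X.A, (∀ γ : Γ, X.σ γ a = a) → ∃ c : ℂ, a = c • (1 : H →L[ℂ] H)

def IsAbelianSet (S : Set (H →L[ℂ] H)) : Prop := ∀ x ∈ S, ∀ y ∈ S, x * y = y * x

/-- `Q` is a `Γ`-invariant subset (in applications, subalgebra). -/
def InvariantUnder (X : CrossedProduct Γ H) (Q : Set (H →L[ℂ] H)) : Prop :=
  ∀ (γ : Γ), ∀ q ∈ Q, X.σ γ q ∈ Q

/-- The intermediate crossed product `Q ⋊ Γ ⊆ A ⋊ Γ` of a (`Γ`-invariant)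
subalgebra `Q ⊆ A`: those elements all of whose Fourier coefficients lie in `Q`. -/
def midCP (X : CrossedProduct Γ H) (Q : Set (H →L[ℂ] H)) : Set (H →L[ℂ] H) :=
  {x | x ∈ X.M ∧ ∀ γ : Γ, X.EA.E (x * star (X.u γ)) ∈ Q}

/-- The intermediate crossed product `A ⋊ K ⊆ A ⋊ Γ` of a subgroup `K ≤ Γ`:
those elements whose Fourier coefficients are supported on `K`. -/
def subgpCP (X : CrossedProduct Γ H) (K : Subgroup Γ) : Set (H →L[ℂ] H) :=
  {x | x ∈ X.M ∧ ∀ γ : Γ, γ ∉ K → X.EA.E (x * star (X.u γ)) = 0}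

/-- The quasinormalizer `QN_M(P)` of `P` inside `M`. -/
def QNset (M P : Set (H →L[ℂ] H)) : Set (H →L[ℂ] H) :=
  {x | x ∈ M ∧ ∃ (n : ℕ) (y : Fin n → (H →L[ℂ] H)), (∀ i, y i ∈ M) ∧
    (∀ p ∈ P, ∃ q : Fin n → (H →L[ℂ] H), (∀ i, q i ∈ P) ∧ p * x = ∑ i, y i * q i) ∧
    (∀ p ∈ P, ∃ q : Fin n → (H →L[ℂ] H), (∀ i, q i ∈ P) ∧ x * p = ∑ i, q i * y i)}

def IsUnitaryIn (S : Set (H →L[ℂ] H)) (x : H →L[ℂ] H) : Prop :=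
  x ∈ S ∧ star x * x = 1 ∧ x * star x = 1

def IsProjIn (S : Set (H →L[ℂ] H)) (p : H →L[ℂ] H) : Prop :=
  p ∈ S ∧ star p = p ∧ p * p = p

/-- The relative commutant `N' ∩ S`. -/
def commutantIn (N S : Set (H →L[ℂ] H)) : Set (H →L[ℂ] H) :=
  {x | x ∈ S ∧ ∀ y ∈ N, x * y = y * x}

/-- Conjugation `w ( · ) w*` applied to a set. -/
def conjSet (w : H →L[ℂ] H) (S : Set (H →L[ℂ] H)) : Set (H →L[ℂ] H) :=
  (fun y => w * y * star w) '' S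

/-- The scalars `ℂ 1 ⊆ B(H)`. -/
def scalars (H : Type) [NormedAddCommGroup H] [InnerProductSpace ℂ H] [CompleteSpace H] :
    Set (H →L[ℂ] H) :=
  Set.range (fun c : ℂ => c • (1 : H →L[ℂ] H))

/-- The extension `P₀ ⊆ P` of `Γ`-algebras is compact: there is a family `F ⊆ P`
with dense `‖·‖₂`-span in `P` such that the `Γ`-orbit of each `f ∈ F` can be
uniformly approximated by finitely many "`P₀`-finite rank modules". -/
def IsCompactExt (X : CrossedProduct Γ H) (P₀ P : Set (H →L[ℂ] H)) : Prop :=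
  ∃ F : Set (H →L[ℂ] H), F ⊆ P ∧
    (∀ p ∈ P, ∀ ε : ℝ, 0 < ε → ∃ (n : ℕ) (c : Fin n → ℂ) (f : Fin n → (H →L[ℂ] H)),
      (∀ i, f i ∈ F) ∧ X.tr.norm2 (p - ∑ i, c i • f i) ≤ ε) ∧
    (∀ f ∈ F, ∀ ε : ℝ, 0 < ε → ∃ (n : ℕ) (ξ : Fin n → (H →L[ℂ] H)) (C : ℝ),
      (∀ i, ξ i ∈ P) ∧
      ∀ γ : Γ, ∃ κ : Fin n → (H →L[ℂ] H), (∀ i, κ i ∈ P₀) ∧ (∀ i, ‖κ i‖ ≤ C) ∧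
        X.tr.norm2 (X.σ γ f - ∑ i, κ i * ξ i) ≤ ε)

/-- The action `Γ ↷ A` is compact: the extension over the scalars is compact. -/
def IsCompactAction (X : CrossedProduct Γ H) : Prop :=
  IsCompactExt X (scalars H) (X.A : Set (H →L[ℂ] H))

/-- The `Γ`-invariant subalgebra `B ⊆ A` gives a mixing extension: for
`t, z ∈ A ⊖ B` one has `‖E_B(t σ_γ(z))‖₂ → 0` as `γ → ∞`. -/
def IsMixingExt (X : CrossedProduct Γ H) (B : Set (H →L[ℂ] H))
    (EB : CondExpOn H (X.M : Set (H →L[ℂ] H)) B X.tr) : Prop :=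
  ∀ t ∈ X.A, ∀ z ∈ X.A, EB.E t = 0 → EB.E z = 0 →
    Filter.Tendsto (fun γ : Γ => X.tr.norm2 (EB.E (t * X.σ γ z))) Filter.cofinite (nhds 0)

/-- A `*`-isomorphism from (the von Neumann algebra with underlying set) `M ⊆ B(H₁)`
onto `N ⊆ B(H₂)`, given as a globally defined map with all axioms imposed on `M`. -/
structure StarIsoOn {H₁ : Type} [NormedAddCommGroup H₁] [InnerProductSpace ℂ H₁]
    [CompleteSpace H₁] {H₂ : Type} [NormedAddCommGroup H₂] [InnerProductSpace ℂ H₂]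
    [CompleteSpace H₂] (M : Set (H₁ →L[ℂ] H₁)) (N : Set (H₂ →L[ℂ] H₂)) : Type where
  Θ : (H₁ →L[ℂ] H₁) → (H₂ →L[ℂ] H₂)
  mem : ∀ x ∈ M, Θ x ∈ N
  map_one : Θ 1 = 1
  map_add : ∀ x ∈ M, ∀ y ∈ M, Θ (x + y) = Θ x + Θ y
  map_smul : ∀ (c : ℂ), ∀ x ∈ M, Θ (c • x) = c • Θ x
  map_mul : ∀ x ∈ M, ∀ y ∈ M, Θ (x * y) = Θ x * Θ y
  map_star : ∀ x ∈ M, Θ (star x) = star (Θ x)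
  inj : ∀ x ∈ M, ∀ y ∈ M, Θ x = Θ y → x = y
  surj : ∀ y ∈ N, ∃ x ∈ M, Θ x = y

/-- `r` is the (Pimsner–Popa/Jones) index of the inclusion `N ⊆ M`, witnessed by a
finite Pimsner–Popa basis `m₁, …, m_k` with `E_N (m_i m_j*) = δ_{ij} p_i`,
`x = ∑ᵢ E_N(x mᵢ*) mᵢ` for `x ∈ M`, and `r = ∑ᵢ τ(pᵢ)`. -/
def HasPPIndex {Mamb : Set (H →L[ℂ] H)} (tr : TraceOn H Mamb)
    (M N : Set (H →L[ℂ] H)) (r : ℝ) : Prop :=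
  ∃ E : (H →L[ℂ] H) →ₗ[ℂ] (H →L[ℂ] H),
    (∀ x ∈ M, E x ∈ N) ∧ (∀ x ∈ N, E x = x) ∧
    (∀ a ∈ N, ∀ b ∈ N, ∀ x ∈ M, E (a * x * b) = a * E x * b) ∧
    (∀ x ∈ M, tr.τ (E x) = tr.τ x) ∧
    ∃ (k : ℕ) (m p : Fin k → (H →L[ℂ] H)),
      (∀ i, m i ∈ M) ∧ (∀ i, p i ∈ N ∧ star (p i) = p i ∧ p i * p i = p i) ∧
      (∀ i j, E (m i * star (m j)) = if i = j then p i else 0) ∧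
      (∀ x ∈ M, x = ∑ i, E (x * star (m i)) * m i) ∧
      r = (∑ i, tr.τ (p i)).re

/-- The inclusion `N ⊆ M` has finite (Pimsner–Popa/Jones) index. -/
def FiniteIndexIn {Mamb : Set (H →L[ℂ] H)} (tr : TraceOn H Mamb)
    (M N : Set (H →L[ℂ] H)) : Prop :=
  ∃ r : ℝ, HasPPIndex tr M N r

/-- `S` (a von Neumann algebra) is a factor: trivial center. -/
def IsFactorSet (S : Set (H →L[ℂ] H)) : Prop :=
  ∀ x ∈ S, (∀ y ∈ S, x * y = y * x) → ∃ c : ℂ, x = c • (1 : H →L[ℂ] H)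

/-- `S` is a II₁ factor (with respect to the trace `tr`): a factor whose
projections realize every trace value in `[0,1]`. -/
def IsII1On {Mamb : Set (H →L[ℂ] H)} (tr : TraceOn H Mamb) (S : Set (H →L[ℂ] H)) : Prop :=
  IsFactorSet S ∧ ∀ r : ℝ, 0 ≤ r → r ≤ 1 →
    ∃ p ∈ S, star p = p ∧ p * p = p ∧ tr.τ p = (r : ℂ)

def IsFinDimSet (S : Set (H →L[ℂ] H)) : Prop :=
  ∃ (n : ℕ) (v : Fin n → (H →L[ℂ] H)), (∀ i, v i ∈ S) ∧
    ∀ x ∈ S, ∃ c : Fin n → ℂ, x = ∑ i, c i • v i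

def IsStarSubalgSet (S : Set (H →L[ℂ] H)) : Prop :=
  (1 : H →L[ℂ] H) ∈ S ∧ (∀ x ∈ S, ∀ y ∈ S, x + y ∈ S) ∧ (∀ x ∈ S, ∀ y ∈ S, x * y ∈ S) ∧
    (∀ (c : ℂ), ∀ x ∈ S, c • x ∈ S) ∧ (∀ x ∈ S, star x ∈ S)

/-- `S` is approximately finite dimensional (with respect to `‖·‖₂`); by Connes'
theorem this is equivalent to amenability for (separable, tracial) von Neumann
algebras. -/
def IsAFD {Mamb : Set (H →L[ℂ] H)} (tr : TraceOn H Mamb) (S : Set (H →L[ℂ] H)) : Prop :=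
  ∃ Q : ℕ → Set (H →L[ℂ] H), (∀ n, Q n ⊆ S) ∧ (∀ n, Q n ⊆ Q (n + 1)) ∧
    (∀ n, IsFinDimSet (Q n)) ∧ (∀ n, IsStarSubalgSet (Q n)) ∧
    ∀ x ∈ S, ∀ ε : ℝ, 0 < ε → ∃ n, ∃ y ∈ Q n, tr.norm2 (x - y) ≤ ε

/-- `S` is diffuse: it has no minimal projections. -/
def IsDiffuseSet (S : Set (H →L[ℂ] H)) : Prop :=
  ∀ p, IsProjIn S p → p ≠ 0 →
    ∃ q, IsProjIn S q ∧ q ≠ 0 ∧ q ≠ p ∧ q * p = q ∧ p * q = q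

/-- The (trace-preserving) action of `Γ` on the subalgebra `Q` is transitive:
`Q` is spanned by finitely many orthogonal minimal projections summing to `1`
which are permuted transitively by `Γ`. -/
def IsTransitiveOn (X : CrossedProduct Γ H) (Q : Set (H →L[ℂ] H)) : Prop :=
  ∃ (n : ℕ) (e : Fin n → (H →L[ℂ] H)),
    (∀ i, e i ∈ Q ∧ star (e i) = e i ∧ e i * e i = e i) ∧
    (∀ i j, i ≠ j → e i * e j = 0) ∧ (∑ i, e i = 1) ∧
    (∀ q ∈ Q, ∃ c : Fin n → ℂ, q = ∑ i, c i • e i) ∧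
    (∀ i j, ∃ γ : Γ, X.σ γ (e i) = e j)

/-- An abelian von Neumann algebra `S` is completely atomic: every nonzero
projection dominates a minimal projection. -/
def IsCompletelyAtomic (S : Set (H →L[ℂ] H)) : Prop :=
  ∀ p, IsProjIn S p → p ≠ 0 →
    ∃ q, IsProjIn S q ∧ q ≠ 0 ∧ q * p = q ∧
      ∀ r, IsProjIn S r → r * q = r → r = 0 ∨ r = q

end CD


noncomputable section
open scoped Classical

namespace CDP
open CD Filter Topology

section tools
variable {H : Type} [NormedAddCommGroup H] [InnerProductSpace ℂ H] [CompleteSpace H]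

/-- projections -/
def IsP (p : H →L[ℂ] H) : Prop := star p = p ∧ p * p = p

lemma mem_of_comm (N : VonNeumannAlgebra H) (x : H →L[ℂ] H)
    (h : ∀ T ∈ N.commutant, T * x = x * T) : x ∈ N := by
  rw [← N.commutant_commutant, VonNeumannAlgebra.mem_commutant_iff]
  exact h

lemma comm_of_mem {N : VonNeumannAlgebra H} {x T : H →L[ℂ] H}
    (hx : x ∈ N) (hT : T ∈ N.commutant) : T * x = x * T :=
  ((VonNeumannAlgebra.mem_commutant_iff.1 hT) x hx).symm

lemma smul_mem_vN (N : VonNeumannAlgebra H) (c : ℂ) {x : H →L[ℂ] H} (hx : x ∈ N) : c • x ∈ N := by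
  refine mem_of_comm N _ fun T hT => ?_
  rw [mul_smul_comm, smul_mul_assoc, comm_of_mem hx hT]

lemma sum_mem_vN (N : VonNeumannAlgebra H) {ι : Type*} (s : Finset ι) (f : ι → H →L[ℂ] H)
    (h : ∀ i ∈ s, f i ∈ N) : ∑ i ∈ s, f i ∈ N := sum_mem h

lemma cfc_mem (N : VonNeumannAlgebra H) {h : H →L[ℂ] H} (hh : IsSelfAdjoint h) (hN : h ∈ N)
    (f : ℝ → ℝ) : cfc f h ∈ N := by
  refine mem_of_comm N _ fun T hT => ?_
  have := (hh.commute_cfc (b := T) (comm_of_mem hN hT).symm f)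
  exact this.symm

lemma sqrt_mem (N : VonNeumannAlgebra H) {h : H →L[ℂ] H} (hh : 0 ≤ h) (hN : h ∈ N) :
    ∃ s ∈ N, 0 ≤ s ∧ star s = s ∧ s * s = h ∧ ∀ T, T * h = h * T → T * s = s * T := by
  refine ⟨CFC.sqrt h, ?_, CFC.sqrt_nonneg h, (CFC.sqrt_nonneg h).isSelfAdjoint,
    CFC.sqrt_mul_sqrt_self h, ?_⟩
  · refine mem_of_comm N _ fun T hT => ?_
    have := Commute.cfcₙ_nnreal (a := h) (b := T) (comm_of_mem hN hT).symm NNReal.sqrt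
    exact this.symm
  · intro T hT
    have := Commute.cfcₙ_nnreal (a := h) (b := T) hT.symm NNReal.sqrt
    exact this.symm

lemma strong_mem (N : VonNeumannAlgebra H) {ι : Type*} {l : Filter ι} [l.NeBot]
    (T : ι → H →L[ℂ] H) (T' : H →L[ℂ] H) (hT : ∀ i, T i ∈ N)
    (hl : ∀ ξ, Tendsto (fun i => T i ξ) l (𝓝 (T' ξ))) : T' ∈ N := by
  refine mem_of_comm N _ fun S hS => ?_
  ext ξ
  have h1 : Tendsto (fun i => S (T i ξ)) l (𝓝 (S (T' ξ))) :=
    (S.continuous.tendsto _).comp (hl ξ)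
  have h2 := hl (S ξ)
  have h3 : (fun i => S (T i ξ)) = fun i => T i (S ξ) := by
    funext i
    have := comm_of_mem (hT i) hS
    exact congrArg (fun A : H →L[ℂ] H => A ξ) this
  rw [h3] at h1
  exact tendsto_nhds_unique h1 h2

lemma strong_limit {ι : Type*} [Preorder ι] [IsDirectedOrder ι] [Nonempty ι]
    (T : ι → H →L[ℂ] H) (C : ℝ) (hC : 0 ≤ C) (hT : ∀ i, ‖T i‖ ≤ C)
    (φ : H → ι → ℝ) (D : H → ℝ) (hφ : ∀ ξ, Monotone (φ ξ)) (hD : ∀ ξ i, φ ξ i ≤ D ξ)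
    (hd : ∀ ξ i j, i ≤ j → ‖T j ξ - T i ξ‖ ^ 2 ≤ φ ξ j - φ ξ i) :
    ∃ T' : H →L[ℂ] H, ‖T'‖ ≤ C ∧ ∀ ξ, Tendsto (fun i => T i ξ) atTop (𝓝 (T' ξ)) := by
  have hex : ∀ ξ, ∃ η, Tendsto (fun i => T i ξ) atTop (𝓝 η) := by
    intro ξ
    have hconv : Tendsto (φ ξ) atTop (𝓝 (⨆ i, φ ξ i)) :=
      tendsto_atTop_ciSup (hφ ξ) ⟨D ξ, by rintro _ ⟨i, rfl⟩; exact hD ξ i⟩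
    apply cauchy_map_iff_exists_tendsto.1
    rw [Metric.cauchy_iff]
    refine ⟨inferInstance, fun ε hε => ?_⟩
    have := hconv.eventually (lt_mem_nhds (show (⨆ i, φ ξ i) - (ε / 2) ^ 2 < ⨆ i, φ ξ i by
      have : 0 < (ε/2)^2 := by positivity
      linarith))
    obtain ⟨i0, hi0⟩ := this.exists
    have hle : ∀ j, φ ξ j ≤ ⨆ i, φ ξ i := fun j =>
      le_ciSup ⟨D ξ, by rintro _ ⟨i, rfl⟩; exact hD ξ i⟩ j
    have key : ∀ j, i0 ≤ j → ‖T j ξ - T i0 ξ‖ < ε / 2 := by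
      intro j hj
      have h1 := hd ξ i0 j hj
      have h2 := hle j
      have : ‖T j ξ - T i0 ξ‖ ^ 2 < (ε / 2) ^ 2 := by linarith
      exact lt_of_pow_lt_pow_left₀ 2 (by positivity) this
    refine ⟨(fun i => T i ξ) '' Set.Ici i0, image_mem_map (mem_atTop i0), ?_⟩
    rintro _ ⟨i, hi, rfl⟩ _ ⟨j, hj, rfl⟩
    have h1 := key i hi
    have h2 := key j hj
    calc dist (T i ξ) (T j ξ) ≤ dist (T i ξ) (T i0 ξ) + dist (T j ξ) (T i0 ξ) :=
          dist_triangle_right _ _ _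
      _ < ε := by rw [dist_eq_norm, dist_eq_norm]; linarith
  choose F hF using hex
  let L : H →ₗ[ℂ] H :=
    { toFun := F
      map_add' := fun x y => by
        refine tendsto_nhds_unique (hF (x + y)) ?_
        simp only [map_add]
        exact (hF x).add (hF y)
      map_smul' := fun c x => by
        refine tendsto_nhds_unique (hF (c • x)) ?_
        simp only [map_smul]
        exact (hF x).const_smul c }
  have hb : ∀ ξ, ‖L ξ‖ ≤ C * ‖ξ‖ := by
    intro ξ
    refine le_of_tendsto (hF ξ).norm (Eventually.of_forall fun i => ?_)
    exact (T i).le_of_opNorm_le (hT i) ξ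
  exact ⟨L.mkContinuous C hb, L.mkContinuous_norm_le hC hb, fun ξ => hF ξ⟩

lemma rangeProj (S : Set (H →L[ℂ] H)) : ∃ P : H →L[ℂ] H, IsP P ∧ (∀ s ∈ S, P * s = s) ∧
    (∀ x : H →L[ℂ] H, (∀ s ∈ S, x * s = 0) → x * P = 0) := by
  let K0 : Submodule ℂ H := Submodule.span ℂ {η | ∃ s ∈ S, ∃ ξ, s ξ = η}
  let K : Submodule ℂ H := K0.topologicalClosure
  have : CompleteSpace K := K0.isClosed_topologicalClosure.completeSpace_coe
  refine ⟨K.starProjection, ⟨?_, ?_⟩, ?_, ?_⟩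
  · exact (isStarProjection_starProjection (U := K)).isSelfAdjoint
  · exact (isStarProjection_starProjection (U := K)).isIdempotentElem
  · intro s hs
    ext ξ
    have : s ξ ∈ K := K0.le_topologicalClosure (Submodule.subset_span ⟨s, hs, ξ, rfl⟩)
    exact Submodule.starProjection_eq_self_iff.2 this
  · intro x hx
    have hK : K ≤ LinearMap.ker (x : H →ₗ[ℂ] H) := by
      refine Submodule.topologicalClosure_minimal _ ?_ x.isClosed_ker
      rw [Submodule.span_le]
      rintro _ ⟨s, hs, ξ, rfl⟩
      exact congrArg (fun A : H →L[ℂ] H => A ξ) (hx s hs)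
    ext ξ
    exact hK (Submodule.starProjection_apply_mem K ξ)

lemma rangeProj_comm {S : Set (H →L[ℂ] H)} {P : H →L[ℂ] H} (hP : IsP P)
    (h2 : ∀ x : H →L[ℂ] H, (∀ s ∈ S, x * s = 0) → x * P = 0) (T : H →L[ℂ] H)
    (hT : ∀ s ∈ S, P * (T * s) = T * s) (hT' : ∀ s ∈ S, P * (star T * s) = star T * s) :
    T * P = P * T := by
  have a1 : (1 - P) * T * P = 0 := h2 _ fun s hs => by
    rw [mul_assoc, sub_mul, one_mul, hT s hs, sub_self]
  have a2 : (1 - P) * star T * P = 0 := h2 _ fun s hs => by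
    rw [mul_assoc, sub_mul, one_mul, hT' s hs, sub_self]
  have a3 := congrArg star a2
  simp only [star_mul, star_sub, star_one, star_star, hP.1, star_zero] at a3
  have b1 : T * P = P * T * P := by
    rw [sub_mul, one_mul, sub_mul, sub_eq_zero] at a1; exact a1
  have b2 : P * T = P * T * P := by
    rw [mul_sub, mul_sub, mul_one, sub_eq_zero, ← mul_assoc] at a3; exact a3
  rw [b1, ← b2]

lemma specProj (N : VonNeumannAlgebra H) {h : H →L[ℂ] H} (hh : IsSelfAdjoint h) (hN : h ∈ N)
    (t : ℝ) : ∃ q ∈ N, IsP q ∧ (∀ T, T * h = h * T → T * q = q * T) ∧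
      q * cfc (fun s : ℝ => max (s - t) 0) h = cfc (fun s : ℝ => max (s - t) 0) h ∧
      cfc (fun s : ℝ => max (t - s) 0) h * q = 0 := by
  set a := cfc (fun s : ℝ => max (s - t) 0) h with ha
  set b := cfc (fun s : ℝ => max (t - s) 0) h with hb
  obtain ⟨P, hP, h1, h2⟩ := rangeProj {a}
  have hcomm : ∀ T, T * h = h * T → T * P = P * T := by
    intro T hT
    have c1 : T * a = a * T := (hh.commute_cfc (b := T) hT.symm _).symm
    have hT' : star T * h = h * star T := by
      have := congrArg star hT
      simp only [star_mul, hh.star_eq] at this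
      exact this.symm
    have c2 : star T * a = a * star T := (hh.commute_cfc (b := star T) hT'.symm _).symm
    have h1a := h1 a rfl
    refine rangeProj_comm hP h2 T ?_ ?_
    · rintro s rfl
      rw [c1, ← mul_assoc, h1a]
    · rintro s rfl
      rw [c2, ← mul_assoc, h1a]
  refine ⟨P, mem_of_comm N _ fun T hT => hcomm T (comm_of_mem hN hT), hP, hcomm, h1 a rfl, ?_⟩
  apply h2
  rintro s rfl
  rw [ha, hb, ← cfc_mul _ _ h (by fun_prop) (by fun_prop)]
  have : (fun s : ℝ => max (t - s) 0 * max (s - t) 0) = fun _ => 0 := by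
    funext s
    rcases le_total s t with h | h
    · rw [max_eq_right (a := s - t) (by linarith), mul_zero]
    · rw [max_eq_right (a := t - s) (by linarith), zero_mul]
  rw [this]
  simp

lemma cfc_split {h : H →L[ℂ] H} (hh : IsSelfAdjoint h) (t : ℝ) :
    h - (t : ℂ) • 1 = cfc (fun s : ℝ => max (s - t) 0) h - cfc (fun s : ℝ => max (t - s) 0) h := by
  rw [← cfc_sub _ _ h (by fun_prop) (by fun_prop)]
  have : (fun s : ℝ => max (s - t) 0 - max (t - s) 0) = fun s => s - t := by
    funext s
    rcases le_total s t with h | h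
    · rw [max_eq_right (a := s - t) (by linarith), max_eq_left (by linarith)]; ring
    · rw [max_eq_right (a := t - s) (by linarith), max_eq_left (by linarith)]; ring
  rw [this, cfc_sub _ _ h (by fun_prop) (by fun_prop), cfc_id' ℝ h, cfc_const t h]
  rw [Algebra.algebraMap_eq_smul_one]
  rfl

lemma IsP.nonneg {p : H →L[ℂ] H} (hp : IsP p) : 0 ≤ p := by
  have := star_mul_self_nonneg p
  rwa [hp.1, hp.2] at this

lemma IsP.one_sub {p : H →L[ℂ] H} (hp : IsP p) : IsP (1 - p) :=
  ⟨by rw [star_sub, star_one, hp.1], by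
    rw [sub_mul, mul_sub, mul_sub, hp.2]; simp⟩

lemma IsP.norm_le {p : H →L[ℂ] H} (hp : IsP p) : ‖p‖ ≤ 1 := by
  have h := CStarRing.norm_star_mul_self (x := p)
  rw [hp.1, hp.2] at h
  nlinarith [norm_nonneg p]

lemma IsP.conj_eq {p a : H →L[ℂ] H} (hp : IsP p) : star p * a * p = p * a * p := by rw [hp.1]

/-- spectral projection, order form -/
lemma specProj' (N : VonNeumannAlgebra H) {h : H →L[ℂ] H} (hh : IsSelfAdjoint h) (hN : h ∈ N)
    (t : ℝ) : ∃ q ∈ N, IsP q ∧ (∀ T, T * h = h * T → T * q = q * T) ∧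
      (t : ℂ) • q ≤ h * q ∧ h * (1 - q) ≤ (t : ℂ) • (1 - q) := by
  obtain ⟨q, hqN, hq, hc, h1, h2⟩ := specProj N hh hN t
  have hs := cfc_split hh t
  have pa : 0 ≤ cfc (fun s : ℝ => max (s - t) 0) h := cfc_nonneg (fun x _ => le_max_right _ _)
  have pb : 0 ≤ cfc (fun s : ℝ => max (t - s) 0) h := cfc_nonneg (fun x _ => le_max_right _ _)
  generalize cfc (fun s : ℝ => max (s - t) 0) h = a at *
  generalize cfc (fun s : ℝ => max (t - s) 0) h = b at *
  have h1' : a * q = a := by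
    have := congrArg star h1
    rwa [star_mul, hq.1, pa.isSelfAdjoint.star_eq] at this
  refine ⟨q, hqN, hq, hc, ?_, ?_⟩
  · rw [← sub_nonneg]
    have : h * q - (t : ℂ) • q = a := by
      have : h * q - (t : ℂ) • q = (h - (t : ℂ) • 1) * q := by rw [sub_mul, smul_mul_assoc, one_mul]
      rw [this, hs, sub_mul, h1', h2, sub_zero]
    rwa [this]
  · rw [← sub_nonneg]
    have : (t : ℂ) • (1 - q) - h * (1 - q) = b := by
      have : (t : ℂ) • (1 - q) - h * (1 - q) = - ((h - (t : ℂ) • 1) * (1 - q)) := by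
        rw [sub_mul, smul_mul_assoc, one_mul]; abel
      rw [this, hs, sub_mul, mul_sub, h1', mul_sub, h2]; simp
    rwa [this]

lemma norm_le_of_le {h : H →L[ℂ] H} (hh : 0 ≤ h) {t : ℝ} (ht : 0 ≤ t) (hle : h ≤ (t : ℂ) • 1) :
    ‖h‖ ≤ t := by
  rw [CStarAlgebra.norm_le_iff_le_algebraMap h ht hh, Algebra.algebraMap_eq_smul_one]
  exact hle

lemma le_norm_smul {h : H →L[ℂ] H} (hh : IsSelfAdjoint h) : h ≤ (‖h‖ : ℂ) • 1 := by
  have := hh.le_algebraMap_norm_self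
  rwa [Algebra.algebraMap_eq_smul_one] at this

/-- inverse on a spectral piece -/
lemma specInv (N : VonNeumannAlgebra H) {y : H →L[ℂ] H} (hN : y ∈ N) (hy : y ≠ 0) :
    ∃ e ∈ N, ∃ k ∈ N, IsP e ∧ e ≠ 0 ∧ star k = k ∧ k * (star y * y) * k = e ∧
      k * k * (star y * y) = e ∧ e * k = k := by
  set h := star y * y with hdef
  have hpos : 0 ≤ h := star_mul_self_nonneg y
  have hh : IsSelfAdjoint h := hpos.isSelfAdjoint
  have hhN : h ∈ N := mul_mem (star_mem hN) hN
  have hne : h ≠ 0 := by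
    intro h0
    exact hy (CStarRing.star_mul_self_eq_zero_iff y |>.1 h0)
  have hn : 0 < ‖h‖ := norm_pos_iff.2 hne
  set t := ‖h‖ / 2 with ht
  have ht0 : 0 < t := by positivity
  obtain ⟨q, hqN, hq, hc, h1, h2⟩ := specProj N hh hhN t
  have hq0 : q ≠ 0 := by
    intro h0
    rw [h0, zero_mul] at h1
    have hs := cfc_split hh t
    rw [← h1, zero_sub] at hs
    have pb : 0 ≤ cfc (fun s : ℝ => max (t - s) 0) h := cfc_nonneg (fun x _ => le_max_right _ _)
    have : h ≤ (t : ℂ) • 1 := by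
      rw [← sub_nonneg, ← neg_sub, hs, neg_neg]; exact pb
    have := norm_le_of_le hpos ht0.le this
    linarith
  have hcont : Continuous (fun s : ℝ => (Real.sqrt (max s t))⁻¹) := by
    refine Continuous.inv₀ (by fun_prop) fun s => ?_
    have : 0 < max s t := lt_max_of_lt_right ht0
    positivity
  set g := cfc (fun s : ℝ => (Real.sqrt (max s t))⁻¹) h with hg
  have hgN : g ∈ N := cfc_mem N hh hhN _
  have hgs : star g = g := (cfc_predicate (fun s : ℝ => (Real.sqrt (max s t))⁻¹) h)
  have hgh : h * g = g * h := ((hh.commute_cfc (b := h) rfl _).symm).eq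
  have hgq : g * q = q * g := hc g hgh.symm
  have hhq : h * q = q * h := hc h rfl
  have hggh : g * g * h = 1 - (t⁻¹ : ℝ) • cfc (fun s : ℝ => max (t - s) 0) h := by
    have e1 : g * g * h = cfc (fun s : ℝ => (Real.sqrt (max s t))⁻¹ * (Real.sqrt (max s t))⁻¹ * s) h := by
      rw [cfc_mul (fun s : ℝ => (Real.sqrt (max s t))⁻¹ * (Real.sqrt (max s t))⁻¹) (fun s => s) h
        (hcont.mul hcont).continuousOn (by fun_prop),
        cfc_mul _ _ h hcont.continuousOn hcont.continuousOn, cfc_id' ℝ h]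
    rw [e1, ← cfc_smul _ _ h (by fun_prop), ← cfc_one ℝ h, ← cfc_sub _ _ h (by fun_prop) (by fun_prop)]
    congr 1
    funext s
    have hm : 0 < max s t := lt_max_of_lt_right ht0
    rw [← mul_inv, Real.mul_self_sqrt hm.le]
    simp only [Pi.one_apply, smul_eq_mul]
    rcases le_total s t with h | h
    · rw [max_eq_right h, max_eq_left (by linarith)]; field_simp; ring
    · rw [max_eq_left h, max_eq_right (by linarith)]
      have : s ≠ 0 := by linarith
      field_simp; ring
  have hqe : g * g * h * q = q := by
    rw [hggh, sub_mul, one_mul, smul_mul_assoc, h2, smul_zero, sub_zero]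
  refine ⟨q, hqN, g * q, mul_mem hgN hqN, hq, hq0, ?_, ?_, ?_, ?_⟩
  · rw [star_mul, hq.1, hgs, hgq]
  · calc g * q * h * (g * q) = g * (q * (h * g)) * q := by simp only [mul_assoc]
      _ = g * (q * g) * h * q := by rw [hgh]; simp only [mul_assoc]
      _ = g * g * (q * h) * q := by rw [← hgq]; simp only [mul_assoc]
      _ = g * g * h * (q * q) := by rw [← hhq]; simp only [mul_assoc]
      _ = q := by rw [hq.2, hqe]
  · calc g * q * (g * q) * h = g * (q * g) * (q * h) := by simp only [mul_assoc]
      _ = g * g * (q * h) * q := by rw [← hgq, ← hhq]; simp only [mul_assoc]; rw [← mul_assoc q h, ← hhq]; simp only [mul_assoc]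
      _ = g * g * h * (q * q) := by rw [← hhq]; simp only [mul_assoc]
      _ = q := by rw [hq.2, hqe]
  · rw [← mul_assoc, ← hgq, mul_assoc, hq.2]

/-- the trivial commutation lemma for a factor -/
lemma factor_zero (N : VonNeumannAlgebra H)
    (hfac : ∀ x ∈ N, (∀ y ∈ N, x * y = y * x) → ∃ c : ℂ, x = c • (1 : H →L[ℂ] H))
    {e f : H →L[ℂ] H} (hfN : f ∈ N) (he : e ≠ 0) (h : ∀ m ∈ N, e * m * f = 0) : f = 0 := by
  obtain ⟨P, hP, h1, h2⟩ := rangeProj {s : H →L[ℂ] H | ∃ m ∈ N, s = m * f}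
  have hPN : P ∈ N := by
    refine mem_of_comm N _ fun T hT => ?_
    have hT' : star T ∈ N.commutant := star_mem hT
    refine rangeProj_comm hP h2 T ?_ ?_
    · rintro s ⟨m, hm, rfl⟩
      rw [comm_of_mem (mul_mem hm hfN) hT, ← mul_assoc, h1 _ ⟨m, hm, rfl⟩]
    · rintro s ⟨m, hm, rfl⟩
      rw [comm_of_mem (mul_mem hm hfN) hT', ← mul_assoc, h1 _ ⟨m, hm, rfl⟩]
  have hPc : ∀ y ∈ N, P * y = y * P := by
    intro y hy
    refine (rangeProj_comm hP h2 y ?_ ?_).symm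
    · rintro s ⟨m, hm, rfl⟩
      rw [← mul_assoc y, h1 _ ⟨y * m, mul_mem hy hm, rfl⟩]
    · rintro s ⟨m, hm, rfl⟩
      rw [← mul_assoc (star y), h1 _ ⟨star y * m, mul_mem (star_mem hy) hm, rfl⟩]
  obtain ⟨c, hc⟩ := hfac P hPN hPc
  have heP : e * P = 0 := h2 e (by
    rintro s ⟨m, hm, rfl⟩
    rw [← mul_assoc]; exact h m hm)
  have hc0 : c = 0 := by
    rw [hc, mul_smul_comm, mul_one] at heP
    exact (smul_eq_zero.1 heP).resolve_right he
  have := h1 f ⟨1, one_mem N, (one_mul f).symm⟩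
  rw [hc, hc0, zero_smul, zero_mul] at this
  exact this.symm

/-- density in the strong topology -/
lemma vn_density (A : StarSubalgebra ℂ (H →L[ℂ] H)) (x : H →L[ℂ] H)
    (hx : x ∈ Set.centralizer (Set.centralizer (A : Set (H →L[ℂ] H)))) (n : ℕ) (ξ : Fin n → H)
    (ε : ℝ) (hε : 0 < ε) : ∃ a ∈ A, ∑ i, ‖(x - a) (ξ i)‖ ^ 2 < ε := by
  let V : Type := PiLp 2 (fun _ : Fin n => H)
  let ev : (H →L[ℂ] H) →ₗ[ℂ] PiLp 2 (fun _ : Fin n => H) :=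
    { toFun := fun a => WithLp.toLp 2 (fun i => a (ξ i))
      map_add' := fun a b => by ext i; simp
      map_smul' := fun c a => by ext i; simp }
  let K0 : Submodule ℂ (PiLp 2 (fun _ : Fin n => H)) := (A.toSubalgebra.toSubmodule).map ev
  let K := K0.topologicalClosure
  have : CompleteSpace K := K0.isClosed_topologicalClosure.completeSpace_coe
  -- matrix coefficients of the projection
  let inc : Fin n → (H →L[ℂ] PiLp 2 (fun _ : Fin n => H)) := fun j =>
    (PiLp.continuousLinearEquiv 2 ℂ (fun _ : Fin n => H)).symm.toContinuousLinearMap.comp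
      (ContinuousLinearMap.single ℂ (fun _ : Fin n => H) j)
  let co : Fin n → (PiLp 2 (fun _ : Fin n => H) →L[ℂ] H) := fun i =>
    PiLp.proj 2 (fun _ : Fin n => H) i
  let dg : (H →L[ℂ] H) → (PiLp 2 (fun _ : Fin n => H) →L[ℂ] PiLp 2 (fun _ : Fin n => H)) := fun b =>
    (PiLp.continuousLinearEquiv 2 ℂ (fun _ : Fin n => H)).symm.toContinuousLinearMap.comp
      (ContinuousLinearMap.pi fun i => b.comp (co i))
  have hdg : ∀ b v i, (dg b v) i = b (v i) := fun b v i => rfl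
  have hdgstar : ∀ b, star (dg b) = dg (star b) := by
    intro b
    rw [ContinuousLinearMap.star_eq_adjoint, eq_comm, ContinuousLinearMap.eq_adjoint_iff]
    intro v v'
    simp only [PiLp.inner_apply, hdg]
    refine Finset.sum_congr rfl fun i _ => ?_
    rw [ContinuousLinearMap.star_eq_adjoint, ContinuousLinearMap.adjoint_inner_left]
  have hinv : ∀ a ∈ A, ∀ v ∈ K, dg a v ∈ K := by
    intro a ha v hv
    have : K0 ≤ K0.comap (dg a : _ →ₗ[ℂ] _) := by
      rintro _ ⟨b, hb, rfl⟩
      refine ⟨a * b, mul_mem (S := StarSubalgebra ℂ (H →L[ℂ] H)) ha hb, ?_⟩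
      ext i; simp [hdg, ev]
    have h3 : K ≤ K.comap (dg a : _ →ₗ[ℂ] _) := by
      refine Submodule.topologicalClosure_minimal _ (this.trans (Submodule.comap_mono K0.le_topologicalClosure)) ?_
      exact K0.isClosed_topologicalClosure.preimage (dg a).continuous
    exact h3 hv
  have hPcomm : ∀ a ∈ A, dg a * K.starProjection = K.starProjection * dg a := by
    intro a ha
    have hsa : star K.starProjection = K.starProjection :=
      (isStarProjection_starProjection (U := K)).isSelfAdjoint
    have e1 : ∀ b ∈ A, K.starProjection * dg b * K.starProjection = dg b * K.starProjection := by
      intro b hb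
      ext1 v
      exact Submodule.starProjection_eq_self_iff.2 (hinv b hb _ (Submodule.starProjection_apply_mem K v))
    have e2 := congrArg star (e1 (star a) (star_mem ha))
    simp only [star_mul, hsa, hdgstar, star_star] at e2
    rw [← e2, ← mul_assoc, e1 a ha]
  have hco : ∀ (i j : Fin n), (co i) ∘L K.starProjection ∘L (inc j) ∈ Set.centralizer (A : Set (H →L[ℂ] H)) := by
    intro i j a ha
    ext η
    have h1 : (inc j) (a η) = dg a (inc j η) := by
      ext k
      rw [hdg]
      simp only [inc, ContinuousLinearMap.comp_apply]
      by_cases hk : k = j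
      · subst hk; simp
      · simp [hk]
    have h2 := congrArg (fun A => A (inc j η)) (hPcomm a ha)
    change a (co i (K.starProjection (inc j η))) = co i (K.starProjection (inc j (a η)))
    rw [h1]
    change dg a (K.starProjection (inc j η)) = K.starProjection (dg a (inc j η)) at h2
    rw [← h2]
    rfl
  have hx' : ∀ v, K.starProjection (dg x v) = dg x (K.starProjection v) := by
    intro v
    have hv : ∀ v : PiLp 2 (fun _ : Fin n => H), v = ∑ j, inc j (v j) := by
      intro v
      ext k
      simp only [inc, ContinuousLinearMap.comp_apply]
      rw [WithLp.ofLp_sum, Finset.sum_apply]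
      rw [Finset.sum_eq_single k]
      · simp
      · intro b _ hb; simp [Ne.symm hb]
      · simp
    ext i
    rw [hdg]
    conv_lhs => rw [hv (dg x v)]
    conv_rhs => rw [hv v]
    have hs : ∀ f : Fin n → PiLp 2 (fun _ : Fin n => H), (∑ j, f j) i = ∑ j, (f j) i := by
      intro f; rw [WithLp.ofLp_sum, Finset.sum_apply]
    rw [map_sum, map_sum, hs, hs, map_sum]
    refine Finset.sum_congr rfl fun j _ => ?_
    rw [hdg]
    have := hx _ (hco i j)
    exact congrArg (fun A : H →L[ℂ] H => A (v j)) this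
  have h1K : ev 1 ∈ K := K0.le_topologicalClosure ⟨1, one_mem A, rfl⟩
  have hxK : ev x ∈ K := by
    have h4 : ev x = dg x (ev 1) := by ext i; rw [hdg]; simp [ev]
    rw [← Submodule.starProjection_eq_self_iff, h4, hx', Submodule.starProjection_eq_self_iff.2 h1K]
  obtain ⟨v, ⟨a, ha, rfl⟩, hv⟩ := Metric.mem_closure_iff.1 hxK (Real.sqrt ε) (Real.sqrt_pos.2 hε)
  refine ⟨a, ha, ?_⟩
  rw [dist_eq_norm, ← map_sub] at hv
  have h5 : ‖ev (x - a)‖ ^ 2 = ∑ i, ‖(x - a) (ξ i)‖ ^ 2 := by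
    rw [PiLp.norm_sq_eq_of_L2]; rfl
  rw [← h5]
  calc ‖ev (x - a)‖ ^ 2 < (Real.sqrt ε) ^ 2 := by gcongr
    _ = ε := Real.sq_sqrt hε.le

end tools
end CDP
end

noncomputable section
open scoped Classical

namespace CDP
open CD Filter Topology

section trace
variable {H : Type} [NormedAddCommGroup H] [InnerProductSpace ℂ H] [CompleteSpace H]
variable {N : VonNeumannAlgebra H} (tr : TraceOn H (N : Set (H →L[ℂ] H)))

/-- squared 2-norm -/
def nsq (x : H →L[ℂ] H) : ℝ := (tr.τ (star x * x)).re

lemma nsq_nonneg {x : H →L[ℂ] H} (hx : x ∈ N) : 0 ≤ nsq tr x := (tr.nonneg x hx).1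

lemma nsq_coe {x : H →L[ℂ] H} (hx : x ∈ N) : tr.τ (star x * x) = (nsq tr x : ℂ) := by
  apply Complex.ext
  · rfl
  · exact (tr.nonneg x hx).2

lemma nsq_zero {x : H →L[ℂ] H} (hx : x ∈ N) (h : nsq tr x = 0) : x = 0 := by
  apply tr.faithful x hx
  rw [nsq_coe tr hx, h]; rfl

lemma nsq_star {x : H →L[ℂ] H} (hx : x ∈ N) : nsq tr (star x) = nsq tr x := by
  unfold nsq
  rw [star_star, tr.tracial x hx (star x) (star_mem hx)]

lemma nsq_smul (c : ℂ) (x : H →L[ℂ] H) : nsq tr (c • x) = ‖c‖ ^ 2 * nsq tr x := by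
  unfold nsq
  rw [star_smul, smul_mul_assoc, mul_smul_comm, smul_smul, map_smul, smul_eq_mul]
  have : star c * c = ((‖c‖ ^ 2 : ℝ) : ℂ) := by
    have := Complex.conj_mul' c
    rw [Complex.ofReal_pow]; exact this
  rw [this, Complex.re_ofReal_mul]

lemma nsq_zero_eq : nsq tr 0 = 0 := by simp [nsq]

lemma tau_pos {a : H →L[ℂ] H} (ha : a ∈ N) (h0 : 0 ≤ a) : 0 ≤ (tr.τ a).re ∧ (tr.τ a).im = 0 := by
  obtain ⟨s, hs, -, h2, h3, -⟩ := sqrt_mem N h0 ha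
  have := tr.nonneg s hs
  rwa [h2, h3] at this

lemma tau_mono {a b : H →L[ℂ] H} (ha : a ∈ N) (hb : b ∈ N) (h : a ≤ b) :
    (tr.τ a).re ≤ (tr.τ b).re := by
  have := (tau_pos tr (sub_mem hb ha) (sub_nonneg.2 h)).1
  rw [map_sub, Complex.sub_re] at this
  linarith

lemma nsq_proj {p : H →L[ℂ] H} (hp : IsP p) : nsq tr p = (tr.τ p).re := by
  unfold nsq; rw [hp.1, hp.2]

lemma star_mul_self_le (k : H →L[ℂ] H) : star k * k ≤ ((‖k‖ ^ 2 : ℝ) : ℂ) • 1 := by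
  have h := le_norm_smul (IsSelfAdjoint.star_mul_self k)
  rw [CStarRing.norm_star_mul_self, ← pow_two] at h
  exact h

lemma nsq_mul_left_le {x k : H →L[ℂ] H} (hx : x ∈ N) (hk : k ∈ N) :
    nsq tr (k * x) ≤ ‖k‖ ^ 2 * nsq tr x := by
  have h1 : star x * (star k * k) * x ≤ star x * (((‖k‖ ^ 2 : ℝ) : ℂ) • 1) * x := by
    exact star_left_conjugate_le_conjugate (star_mul_self_le k) x
  have h2 := tau_mono tr (mul_mem (mul_mem (star_mem hx) (mul_mem (star_mem hk) hk)) hx)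
    (mul_mem (mul_mem (star_mem hx) (smul_mem_vN N _ (one_mem N))) hx) h1
  rw [mul_smul_comm, mul_one, smul_mul_assoc, map_smul, smul_eq_mul, Complex.re_ofReal_mul] at h2
  unfold nsq
  rw [star_mul]
  simpa only [mul_assoc] using h2

lemma nsq_mul_right_le {x k : H →L[ℂ] H} (hx : x ∈ N) (hk : k ∈ N) :
    nsq tr (x * k) ≤ ‖k‖ ^ 2 * nsq tr x := by
  rw [← nsq_star tr (mul_mem hx hk), star_mul, ← nsq_star tr hx, ← norm_star k]
  exact nsq_mul_left_le tr (star_mem hx) (star_mem hk)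

lemma nsq_add_le {x y : H →L[ℂ] H} (hx : x ∈ N) (hy : y ∈ N) :
    nsq tr (x + y) ≤ 2 * nsq tr x + 2 * nsq tr y := by
  have h := nsq_nonneg tr (sub_mem hx hy)
  have : nsq tr (x + y) + nsq tr (x - y) = 2 * nsq tr x + 2 * nsq tr y := by
    unfold nsq
    simp only [star_add, star_sub, add_mul, mul_add, sub_mul, mul_sub, map_add, map_sub,
      Complex.add_re, Complex.sub_re]
    ring
  linarith

lemma proj_le {e f : H →L[ℂ] H} (he : IsP e) (hf : IsP f) (h : e * f * e = e) :
    f * e = e ∧ e * f = e := by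
  have h1 : star ((1 - f) * e) * ((1 - f) * e) = 0 := by
    rw [star_mul, he.1, hf.one_sub.1]
    calc e * (1 - f) * ((1 - f) * e) = e * ((1 - f) * (1 - f)) * e := by simp only [mul_assoc]
      _ = 0 := by rw [hf.one_sub.2, mul_sub, sub_mul, mul_one, he.2, h, sub_self]
  have h2 := (CStarRing.star_mul_self_eq_zero_iff _).1 h1
  rw [sub_mul, one_mul, sub_eq_zero] at h2
  refine ⟨h2.symm, ?_⟩
  have := congrArg star h2
  rw [star_mul, he.1, hf.1] at this
  exact this.symm

/-- elements dominated by finitely many vectors -/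
def Good (m : H →L[ℂ] H) : Prop := ∃ (ι : Type) (_ : Fintype ι) (ξ : ι → H),
  ∀ x ∈ N, nsq tr (x * m) ≤ ∑ i, ‖x (ξ i)‖ ^ 2

lemma Good.mul_right {m k : H →L[ℂ] H} (hm : m ∈ N) (hk : k ∈ N) (h : Good tr m) :
    Good tr (m * k) := by
  obtain ⟨ι, _, ξ, hξ⟩ := h
  refine ⟨ι, inferInstance, fun i => (‖k‖ : ℂ) • ξ i, fun x hx => ?_⟩
  have h1 := nsq_mul_right_le tr (mul_mem hx hm) hk
  rw [mul_assoc] at h1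
  refine h1.trans ?_
  have := mul_le_mul_of_nonneg_left (hξ x hx) (sq_nonneg ‖k‖)
  refine this.trans (le_of_eq ?_)
  rw [Finset.mul_sum]
  refine Finset.sum_congr rfl fun i _ => ?_
  rw [map_smul, norm_smul, mul_pow]; simp

lemma Good.mul_left {m k : H →L[ℂ] H} (hk : k ∈ N) (h : Good tr m) :
    Good tr (k * m) := by
  obtain ⟨ι, _, ξ, hξ⟩ := h
  refine ⟨ι, inferInstance, fun i => k (ξ i), fun x hx => ?_⟩
  have := hξ (x * k) (mul_mem hx hk)
  rw [mul_assoc] at this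
  exact this

lemma Good.add {m k : H →L[ℂ] H} (hm : m ∈ N) (hk : k ∈ N) (h : Good tr m) (h' : Good tr k) :
    Good tr (m + k) := by
  obtain ⟨ι, _, ξ, hξ⟩ := h
  obtain ⟨ι', _, ξ', hξ'⟩ := h'
  refine ⟨ι ⊕ ι', inferInstance, Sum.elim (fun i => (Real.sqrt 2 : ℂ) • ξ i)
    (fun i => (Real.sqrt 2 : ℂ) • ξ' i), fun x hx => ?_⟩
  rw [Fintype.sum_sum_type]
  simp only [Sum.elim_inl, Sum.elim_inr, map_smul, norm_smul, mul_pow]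
  have h2 : ‖(Real.sqrt 2 : ℂ)‖ ^ 2 = 2 := by
    rw [Complex.norm_real, Real.norm_eq_abs, sq_abs, Real.sq_sqrt (by norm_num)]
  rw [h2, ← Finset.mul_sum, ← Finset.mul_sum, mul_add]
  have := nsq_add_le tr (mul_mem hx hm) (mul_mem hx hk)
  have a1 := hξ x hx
  have a2 := hξ' x hx
  linarith

lemma inner_op (T : H →L[ℂ] H) (ξ η : H) : inner ℂ (T ξ) η = inner ℂ ξ (star T η) := by
  rw [ContinuousLinearMap.star_eq_adjoint, ContinuousLinearMap.adjoint_inner_right]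

lemma norm_sq_op (T : H →L[ℂ] H) (ξ : H) : ‖T ξ‖ ^ 2 = (inner ℂ ((star T * T) ξ) ξ).re := by
  change _ = (inner ℂ (star T (T ξ)) ξ).re
  rw [inner_op, star_star, ← inner_self_eq_norm_sq (𝕜 := ℂ)]
  rfl

lemma re_inner_mono {a b : H →L[ℂ] H} (h : a ≤ b) (ξ : H) :
    (inner ℂ (a ξ) ξ).re ≤ (inner ℂ (b ξ) ξ).re := by
  have := (ContinuousLinearMap.le_def a b).1 h
  have := this.re_inner_nonneg_left ξ
  rw [sub_apply, inner_sub_left, map_sub] at this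
  exact sub_nonneg.1 this

lemma norm_sq_le_of_contr {c : H →L[ℂ] H} (h0 : 0 ≤ c) (h1 : c ≤ 1) (ξ : H) :
    ‖c ξ‖ ^ 2 ≤ (inner ℂ (c ξ) ξ).re := by
  have hsa : star c = c := h0.isSelfAdjoint
  obtain ⟨s, h2, h3⟩ : ∃ s : H →L[ℂ] H, star s = s ∧ s * s = c :=
    ⟨CFC.sqrt c, (CFC.sqrt_nonneg c).isSelfAdjoint, CFC.sqrt_mul_sqrt_self c⟩
  have h5 : c * c ≤ c := by
    have := star_left_conjugate_le_conjugate h1 s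
    rw [h2, mul_one, h3] at this
    have h6 : s * c * s = c * c := by rw [← h3]; simp only [mul_assoc]
    rwa [h6] at this
  have h7 := re_inner_mono h5 ξ
  refine le_trans (le_of_eq ?_) h7
  have : inner ℂ ((c * c) ξ) ξ = inner ℂ (c ξ) (c ξ) := by
    change inner ℂ (c (c ξ)) ξ = _
    rw [inner_op, hsa]
  rw [this, ← inner_self_eq_norm_sq (𝕜 := ℂ)]
  rfl

lemma strong_le {ι : Type*} {l : Filter ι} [l.NeBot]
    (T : ι → H →L[ℂ] H) (T' c : H →L[ℂ] H) (hT : ∀ᶠ i in l, c ≤ T i) (hsa : ∀ i, star (T i) = T i)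
    (hc : star c = c) (hl : ∀ ξ, Tendsto (fun i => T i ξ) l (𝓝 (T' ξ))) : star T' = T' ∧ c ≤ T' := by
  have h1 : star T' = T' := by
    rw [ContinuousLinearMap.star_eq_adjoint, eq_comm, ContinuousLinearMap.eq_adjoint_iff]
    intro x y
    have a1 : Tendsto (fun i => inner ℂ (T i x) y) l (𝓝 (inner ℂ (T' x) y)) :=
      (hl x).inner tendsto_const_nhds
    have a2 : Tendsto (fun i => inner ℂ x (T i y)) l (𝓝 (inner ℂ x (T' y))) :=
      tendsto_const_nhds.inner (hl y)
    have : (fun i => inner ℂ (T i x) y) = fun i => inner ℂ x (T i y) := by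
      funext i; rw [inner_op, hsa]
    rw [this] at a1
    exact tendsto_nhds_unique a1 a2
  refine ⟨h1, ?_⟩
  rw [← sub_nonneg, ContinuousLinearMap.nonneg_iff_isPositive, ContinuousLinearMap.isPositive_iff_complex]
  intro x
  have hs : star (T' - c) = T' - c := by rw [star_sub, h1, hc]
  constructor
  · have : (inner ℂ ((T' - c) x) x) = starRingEnd ℂ (inner ℂ ((T' - c) x) x) := by
      rw [inner_conj_symm]; conv_lhs => rw [inner_op, hs]
    exact (Complex.conj_eq_iff_re.1 this.symm)
  · have a1 : Tendsto (fun i => (inner ℂ (T i x) x).re) l (𝓝 (inner ℂ (T' x) x).re) :=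
      (Complex.continuous_re.tendsto _).comp ((hl x).inner tendsto_const_nhds)
    have := ge_of_tendsto a1 (hT.mono fun i hi => re_inner_mono hi x)
    rw [sub_apply, inner_sub_left]
    change 0 ≤ (_ - _ : ℂ).re
    rw [Complex.sub_re]; linarith

lemma contr_norm {c : H →L[ℂ] H} (h0 : 0 ≤ c) (h1 : c ≤ 1) : ‖c‖ ≤ 1 := by
  apply norm_le_of_le h0 zero_le_one
  simpa using h1

/-- directed sup of positive contractions -/
lemma chain_sup {C : Set (H →L[ℂ] H)} (hne : C.Nonempty) (hch : IsChain (· ≤ ·) C)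
    (h0 : ∀ a ∈ C, 0 ≤ a) (h1 : ∀ a ∈ C, a ≤ 1) (hN : ∀ a ∈ C, a ∈ N) :
    ∃ T ∈ N, 0 ≤ T ∧ T ≤ 1 ∧ (∀ a ∈ C, a ≤ T) ∧
      ∀ ξ (D : ℝ), (∀ a ∈ C, (inner ℂ (a ξ) ξ).re ≤ D) → (inner ℂ (T ξ) ξ).re ≤ D := by
  have : Nonempty C := hne.to_subtype
  have hdir : IsDirectedOrder C := ⟨fun a b => by
    rcases hch.total a.2 b.2 with h | h
    · exact ⟨b, h, le_rfl⟩
    · exact ⟨a, le_rfl, h⟩⟩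
  obtain ⟨T, -, hT⟩ := strong_limit (fun a : C => (a : H →L[ℂ] H)) 1 zero_le_one
    (fun a => contr_norm (h0 a a.2) (h1 a a.2)) (fun ξ a => (inner ℂ ((a : H →L[ℂ] H) ξ) ξ).re)
    (fun ξ => (inner ℂ ((1 : H →L[ℂ] H) ξ) ξ).re) (fun ξ a b hab => re_inner_mono hab ξ)
    (fun ξ a => re_inner_mono (h1 a a.2) ξ) (by
      intro ξ a b hab
      have hab' : (a : H →L[ℂ] H) ≤ b := hab
      have := norm_sq_le_of_contr (c := (b : H →L[ℂ] H) - (a : H →L[ℂ] H)) (sub_nonneg.2 hab')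
        ((sub_le_self _ (h0 a a.2)).trans (h1 b b.2)) ξ
      rw [sub_apply, inner_sub_left, Complex.sub_re] at this
      exact this)
  have hsa : ∀ a : C, star (a : H →L[ℂ] H) = a := fun a => (h0 a a.2).isSelfAdjoint
  have hTs := strong_le (fun a : C => (a : H →L[ℂ] H)) T 0 (Eventually.of_forall fun a => h0 a a.2)
    hsa (star_zero _) hT
  refine ⟨T, strong_mem N _ T (fun a : C => hN a a.2) hT, hTs.2, ?_, ?_, ?_⟩
  · have := (strong_le (fun a : C => -(a : H →L[ℂ] H)) (-T) (-1)
      (Eventually.of_forall fun a => neg_le_neg (h1 a a.2))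
      (fun a => by rw [star_neg, hsa]) (by simp) (fun ξ => (hT ξ).neg)).2
    exact neg_le_neg_iff.1 this
  · intro a ha
    refine (strong_le (fun a : C => (a : H →L[ℂ] H)) T a ?_ hsa (hsa ⟨a, ha⟩) hT).2
    filter_upwards [mem_atTop (⟨a, ha⟩ : C)] with b hb using hb
  · intro ξ D hD
    have a1 : Tendsto (fun i : C => (inner ℂ ((i : H →L[ℂ] H) ξ) ξ).re) atTop (𝓝 (inner ℂ (T ξ) ξ).re) :=
      (Complex.continuous_re.tendsto _).comp ((hT ξ).inner tendsto_const_nhds)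
    exact le_of_tendsto a1 (Eventually.of_forall fun i => hD i i.2)

lemma K1 : ∃ m ∈ N, m ≠ 0 ∧ Good tr m := by
  obtain ⟨ξ, hξ⟩ : ∃ ξ : H, ‖ξ‖ = 1 := by
    have : Nontrivial H := by
      by_contra hs
      rw [not_nontrivial_iff_subsingleton] at hs
      have : (1 : H →L[ℂ] H) = 0 := by ext x; exact Subsingleton.elim _ _
      have h := tr.unital
      rw [this, map_zero] at h
      exact zero_ne_one h
    obtain ⟨v, hv⟩ := exists_ne (0 : H)
    exact ⟨((‖v‖⁻¹ : ℝ) : ℂ) • v, by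
      rw [norm_smul, Complex.norm_real, norm_inv, norm_norm, inv_mul_cancel₀ (norm_ne_zero_iff.2 hv)]⟩
  let S : Set (H →L[ℂ] H) := {a | a ∈ N ∧ 0 ≤ a ∧ a ≤ 1 ∧ 2 * (inner ℂ (a ξ) ξ).re ≤ (tr.τ a).re}
  have h0S : (0 : H →L[ℂ] H) ∈ S := ⟨zero_mem N, le_rfl, zero_le_one, by simp⟩
  obtain ⟨a, -, ha⟩ := zorn_le_nonempty₀ S (by
    intro c hc hch y hy
    obtain ⟨T, hTN, hT0, hT1, hTa, hTD⟩ := chain_sup (N := N) ⟨y, hy⟩ hch (fun a ha => (hc ha).2.1)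
      (fun a ha => (hc ha).2.2.1) (fun a ha => (hc ha).1)
    refine ⟨T, ⟨hTN, hT0, hT1, ?_⟩, hTa⟩
    have := hTD ξ ((tr.τ T).re / 2) (fun a ha => by
      have h1 := (hc ha).2.2.2
      have h2 := tau_mono tr (hc ha).1 hTN (hTa a ha)
      linarith)
    linarith) 0 h0S
  obtain ⟨haN, ha0, ha1, ha2⟩ := ha.prop
  have hc0 : 0 ≤ 1 - a := sub_nonneg.2 ha1
  have hcN : 1 - a ∈ N := sub_mem (one_mem N) haN
  obtain ⟨m, hmN, hm0, hms, hmm, -⟩ := sqrt_mem N hc0 hcN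
  refine ⟨m, hmN, ?_, Unit, inferInstance, fun _ => (Real.sqrt 2 : ℂ) • m ξ, fun x hx => ?_⟩
  · rintro rfl
    rw [mul_zero] at hmm
    have : a = 1 := (sub_eq_zero.1 hmm.symm).symm
    rw [this, tr.unital] at ha2
    have : (inner ℂ ((1 : H →L[ℂ] H) ξ) ξ).re = 1 := by
      change (inner ℂ ξ ξ).re = 1
      have := inner_self_eq_norm_sq (𝕜 := ℂ) ξ
      rw [hξ] at this
      simpa using this
    rw [this] at ha2
    norm_num at ha2
  · simp only [Finset.univ_unique, Finset.sum_singleton, map_smul, norm_smul, mul_pow]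
    have h2 : ‖(Real.sqrt 2 : ℂ)‖ ^ 2 = 2 := by
      rw [Complex.norm_real, Real.norm_eq_abs, sq_abs, Real.sq_sqrt (by norm_num)]
    rw [h2]
    by_contra hcon
    push Not at hcon
    have hx0 : x ≠ 0 := by
      rintro rfl
      simp [nsq_zero_eq] at hcon
    have hxn : 0 < ‖x‖ := norm_pos_iff.2 hx0
    set s : ℝ := (‖x‖ ^ 2)⁻¹ with hs
    have hs0 : 0 < s := by positivity
    set b : H →L[ℂ] H := (s : ℂ) • (star (x * m) * (x * m)) with hb
    have hbN : b ∈ N := smul_mem_vN N _ (mul_mem (star_mem (mul_mem hx hmN)) (mul_mem hx hmN))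
    have hb0 : 0 ≤ b := by
      have : b = star (((Real.sqrt s : ℝ) : ℂ) • (x * m)) * (((Real.sqrt s : ℝ) : ℂ) • (x * m)) := by
        rw [star_smul, smul_mul_assoc, mul_smul_comm, smul_smul, hb]
        congr 1
        change _ = (starRingEnd ℂ) _ * _
        rw [Complex.conj_ofReal, ← Complex.ofReal_mul, Real.mul_self_sqrt hs0.le]
      rw [this]; exact star_mul_self_nonneg _
    have hb1 : b ≤ 1 - a := by
      have h3 := star_left_conjugate_nonneg (sub_nonneg.2 (star_mul_self_le x)) m
      have h4 := smul_nonneg hs0.le h3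
      rw [← sub_nonneg]
      convert h4 using 1
      rw [hb, mul_sub, sub_mul, mul_smul_comm, smul_mul_assoc, mul_one, hms, hmm, star_mul, hms, smul_sub]
      have : s • ((‖x‖ ^ 2 : ℝ) : ℂ) • (1 - a) = 1 - a := by
        change (s : ℂ) • ((‖x‖ ^ 2 : ℝ) : ℂ) • (1 - a) = 1 - a
        rw [smul_smul, ← Complex.ofReal_mul, hs, inv_mul_cancel₀ (by positivity)]; simp
      rw [this]
      simp only [mul_assoc]
      rfl
    have hbS : a + b ∈ S := by
      refine ⟨add_mem haN hbN, add_nonneg ha0 hb0, ?_, ?_⟩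
      · have := add_le_add_right hb1 a
        simpa using this
      · rw [map_add, Complex.add_re, add_apply, inner_add_left, Complex.add_re]
        have e1 : (tr.τ b).re = s * nsq tr (x * m) := by
          rw [hb, map_smul, smul_eq_mul, Complex.re_ofReal_mul]; rfl
        have e2 : (inner ℂ (b ξ) ξ).re = s * ‖x (m ξ)‖ ^ 2 := by
          have := norm_sq_op (x * m) ξ
          change ‖x (m ξ)‖ ^ 2 = _ at this
          rw [this, hb, smul_apply, inner_smul_left, Complex.conj_ofReal, Complex.re_ofReal_mul]
        rw [e1, e2]
        have := mul_le_mul_of_nonneg_left hcon.le hs0.le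
        linarith
    have h5 := ha.le_of_ge hbS (le_add_of_nonneg_right hb0)
    have hbz : b = 0 := le_antisymm (by simpa using h5) hb0
    have : star (x * m) * (x * m) = 0 := by
      rw [hb] at hbz
      exact (smul_eq_zero.1 hbz).resolve_left (by exact_mod_cast hs0.ne')
    have : nsq tr (x * m) = 0 := by unfold nsq; rw [this]; simp
    rw [this] at hcon
    have := sq_nonneg ‖x (m ξ)‖
    linarith

lemma K2 : ∃ p ∈ N, IsP p ∧ p ≠ 0 ∧ Good tr p := by
  obtain ⟨m, hm, hm0, hg⟩ := K1 tr
  obtain ⟨e, he, k, hk, hP, he0, -, -, h2, -⟩ := specInv N hm hm0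
  refine ⟨e, he, hP, he0, ?_⟩
  rw [← h2, ← mul_assoc]
  exact Good.mul_left tr (mul_mem (mul_mem hk hk) (star_mem hm)) hg

end trace
end CDP
end

noncomputable section
open scoped Classical

namespace CDP
open CD Filter Topology

section Kthm
variable {H : Type} [NormedAddCommGroup H] [InnerProductSpace ℂ H] [CompleteSpace H]
variable {N : VonNeumannAlgebra H} (tr : TraceOn H (N : Set (H →L[ℂ] H)))

/-- partial isometries of `N` from under `r` to under `p` -/
def PI (N : VonNeumannAlgebra H) (p r V : H →L[ℂ] H) : Prop :=
  V ∈ N ∧ V * star V * V = V ∧ p * V = V ∧ V * r = V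

lemma PI.init {p r V : H →L[ℂ] H} (h : PI N p r V) : IsP (star V * V) :=
  ⟨by rw [star_mul, star_star], by
    calc star V * V * (star V * V) = star V * (V * star V * V) := by simp only [mul_assoc]
      _ = _ := by rw [h.2.1]⟩

lemma PI.final {p r V : H →L[ℂ] H} (h : PI N p r V) : IsP (V * star V) :=
  ⟨by rw [star_mul, star_star], by
    calc V * star V * (V * star V) = (V * star V * V) * star V := by simp only [mul_assoc]
      _ = _ := by rw [h.2.1]⟩

lemma PI.sub {p r V W : H →L[ℂ] H} (hV : PI N p r V) (hW : PI N p r W)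
    (h : W * (star V * V) = V) :
    (star W * W) * (star V * V) = star V * V ∧ star W * V = star V * V ∧ star V * W = star V * V := by
  have h1 : (star V * V) * (star W * W) * (star V * V) = star V * V := by
    have h2 : star V = (star V * V) * star W := by
      conv_lhs => rw [← h]
      rw [star_mul, star_mul, star_star]
    calc (star V * V) * (star W * W) * (star V * V)
        = ((star V * V) * star W) * (W * (star V * V)) := by simp only [mul_assoc]
      _ = _ := by rw [← h2, h]
  have h3 := (proj_le hV.init hW.init h1).1
  have h4 : star W * V = star V * V := by
    conv_lhs => rw [← h]
    rw [← mul_assoc, h3]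
  refine ⟨h3, h4, ?_⟩
  have := congrArg star h4
  simpa [star_mul] using this

/-- wrapper type for partial isometries -/
structure PIT (N : VonNeumannAlgebra H) (p r : H →L[ℂ] H) : Type where
  /-- the operator -/
  val : H →L[ℂ] H
  /-- the property -/
  prop : PI N p r val

/-- extension order on partial isometries -/
instance piPre (N : VonNeumannAlgebra H) (p r : H →L[ℂ] H) : Preorder (PIT N p r) where
  le V W := W.1 * (star V.1 * V.1) = V.1
  le_refl V := by rw [← mul_assoc]; exact V.2.2.1
  le_trans U V W h1 h2 := by
    have h3 := (PI.sub U.2 V.2 h1).1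
    change W.1 * (star U.1 * U.1) = U.1
    rw [← h3, ← mul_assoc, h2, h1]

lemma PI.diff {p r V W : H →L[ℂ] H} (hV : PI N p r V) (hW : PI N p r W)
    (h : W * (star V * V) = V) (ξ : H) : ‖W ξ - V ξ‖ ^ 2 ≤ ‖W ξ‖ ^ 2 - ‖V ξ‖ ^ 2 := by
  obtain ⟨-, h2, h3⟩ := PI.sub hV hW h
  rw [← sub_apply, norm_sq_op, norm_sq_op, norm_sq_op]
  have : star (W - V) * (W - V) = star W * W - star V * V := by
    rw [star_sub, sub_mul, mul_sub, mul_sub, h2, h3]; abel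
  rw [this, sub_apply, inner_sub_left, Complex.sub_re]

lemma PI.norm {p r V : H →L[ℂ] H} (h : PI N p r V) : ‖V‖ ≤ 1 := by
  have h1 := h.init.norm_le
  rw [CStarRing.norm_star_mul_self] at h1
  nlinarith [norm_nonneg V]

lemma exists_max_PI (p r : H →L[ℂ] H) : ∃ V, PI N p r V ∧
    ∀ W, PI N p r W → W * (star V * V) = V → V * (star W * W) = W := by
  have key : ∃ m : PIT N p r, IsMax m := by
    apply zorn_le
    intro c hc
    rcases c.eq_empty_or_nonempty with rfl | hne
    · exact ⟨⟨0, zero_mem N, by simp, by simp, by simp⟩, by simp [upperBounds]⟩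
    have : Nonempty c := hne.to_subtype
    have hdir : IsDirectedOrder c := ⟨fun a b => by
      rcases hc.total a.2 b.2 with h | h
      · exact ⟨b, h, le_rfl⟩
      · exact ⟨a, le_rfl, h⟩⟩
    have hle : ∀ (i j : c), i ≤ j → j.1.1 * (star i.1.1 * i.1.1) = i.1.1 := fun i j h => h
    obtain ⟨T, -, hT⟩ := strong_limit (fun a : c => a.1.1) 1 zero_le_one
      (fun a => a.1.prop.norm) (fun ξ a => ‖a.1.1 ξ‖ ^ 2) (fun ξ => ‖ξ‖ ^ 2)
      (fun ξ a b hab => by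
        have := PI.diff a.1.2 b.1.2 (hle a b hab) ξ
        have h2 := sq_nonneg ‖b.1.1 ξ - a.1.1 ξ‖
        dsimp only
        linarith)
      (fun ξ a => by
        have := a.1.1.le_of_opNorm_le a.1.prop.norm ξ
        rw [one_mul] at this
        gcongr)
      (fun ξ a b hab => PI.diff a.1.2 b.1.2 (hle a b hab) ξ)
    have hTN : T ∈ N := strong_mem N _ T (fun a : c => a.1.2.1) hT
    have e1 : ∀ i : c, T * (star i.1.1 * i.1.1) = i.1.1 := by
      intro i
      ext ξ
      refine tendsto_nhds_unique (hT _) ?_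
      refine tendsto_const_nhds.congr' ?_
      filter_upwards [mem_atTop i] with j hj
      exact (congrArg (fun A : H →L[ℂ] H => A ξ) (hle i j hj)).symm
    have e2 : ∀ i : c, star i.1.1 * T = star i.1.1 * i.1.1 := by
      intro i
      ext ξ
      have := ((star i.1.1).continuous.tendsto _).comp (hT ξ)
      refine tendsto_nhds_unique this ?_
      refine tendsto_const_nhds.congr' ?_
      filter_upwards [mem_atTop i] with j hj
      exact (congrArg (fun A : H →L[ℂ] H => A ξ) (PI.sub i.1.2 j.1.2 (hle i j hj)).2.2).symm
    have e3 : ∀ i : c, star T * i.1.1 = star i.1.1 * i.1.1 := by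
      intro i
      have := congrArg star (e2 i)
      simpa [star_mul] using this
    have hTPI : PI N p r T := by
      refine ⟨hTN, ?_, ?_, ?_⟩
      · ext ξ
        have := ((T * star T).continuous.tendsto _).comp (hT ξ)
        refine tendsto_nhds_unique this ?_
        refine (hT ξ).congr fun i => ?_
        have : (T * star T) * i.1.1 = i.1.1 := by rw [mul_assoc, e3, e1]
        exact (congrArg (fun A : H →L[ℂ] H => A ξ) this).symm
      · ext ξ
        have := (p.continuous.tendsto _).comp (hT ξ)
        refine tendsto_nhds_unique this ?_
        refine (hT ξ).congr fun i => ?_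
        exact (congrArg (fun A : H →L[ℂ] H => A ξ) i.1.2.2.2.1).symm
      · ext ξ
        refine tendsto_nhds_unique (hT (r ξ)) ?_
        refine (hT ξ).congr fun i => ?_
        exact (congrArg (fun A : H →L[ℂ] H => A ξ) i.1.2.2.2.2).symm
    exact ⟨⟨T, hTPI⟩, fun i hi => e1 ⟨i, hi⟩⟩
  obtain ⟨m, hm⟩ := key
  exact ⟨m.1, m.2, fun W hW h => hm (b := ⟨W, hW⟩) h⟩

/-- comparison: in a factor, either all of `p` is used or all of `r` is. -/
lemma comparison (hfac : IsFactorSet (N : Set (H →L[ℂ] H))) {p r : H →L[ℂ] H}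
    (hp : IsP p) (hr : IsP r) (hpN : p ∈ N) (hrN : r ∈ N) :
    ∃ V, PI N p r V ∧ (V * star V = p ∨ star V * V = r) := by
  obtain ⟨V, hV, hmax⟩ := exists_max_PI (N := N) p r
  refine ⟨V, hV, ?_⟩
  by_contra hcon
  push Not at hcon
  obtain ⟨hc1, hc2⟩ := hcon
  have hVs : star V * p = star V := by
    have := congrArg star hV.2.2.1
    rwa [star_mul, hp.1] at this
  have hrV : r * star V = star V := by
    have := congrArg star hV.2.2.2
    rwa [star_mul, hr.1] at this
  have hpf : p - V * star V ∈ N := sub_mem hpN (mul_mem hV.1 (star_mem hV.1))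
  have hre : r - star V * V ∈ N := sub_mem hrN (mul_mem (star_mem hV.1) hV.1)
  have hVVV : star V * V * star V = star V := by
    have := congrArg star hV.2.1
    simpa [star_mul, mul_assoc] using this
  apply hc2
  symm
  rw [← sub_eq_zero]
  refine factor_zero N hfac hre (e := p - V * star V) (fun h => hc1 (sub_eq_zero.1 h).symm) ?_
  intro m hm
  by_contra hy
  set y := (p - V * star V) * m * (r - star V * V) with hydef
  have hyN : y ∈ N := mul_mem (mul_mem hpf hm) hre
  obtain ⟨e, he, k, hk, hP, he0, hks, hke, hkk, hek⟩ := specInv N hyN hy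
  have hke' : k * e = k := by
    have := congrArg star hek
    rwa [star_mul, hP.1, hks] at this
  have hpp : V * star V * (p - V * star V) = 0 := by
    rw [mul_sub, mul_assoc, hVs, hV.final.2, sub_self]
  have hVp : star V * (p - V * star V) = 0 := by
    rw [mul_sub, hVs, ← mul_assoc, hVVV, sub_self]
  have hrVs : (r - star V * V) * star V = 0 := by
    rw [sub_mul, hrV, hVVV, sub_self]
  have hyV : y * star V = 0 := by rw [hydef, mul_assoc, hrVs, mul_zero]
  have hVy : star V * y = 0 := by rw [hydef, ← mul_assoc, ← mul_assoc, hVp, zero_mul, zero_mul]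
  have hyr : y * r = y := by
    rw [hydef, mul_assoc _ _ r, sub_mul r, hr.2, mul_assoc (star V), hV.2.2.2]
  have hpy : p * y = y := by
    rw [hydef, ← mul_assoc, ← mul_assoc, mul_sub p, hp.2, ← mul_assoc, hV.2.2.1]
  have heV : e * star V = 0 := by
    rw [← hkk, mul_assoc, mul_assoc (star y), hyV, mul_zero, mul_zero]
  have her : e * r = e := by rw [← hkk, mul_assoc, mul_assoc (star y), hyr]
  set U := y * k with hU
  have hUU : star U * U = e := by rw [hU, star_mul, hks, ← hke]; simp only [mul_assoc]
  have hUe : U * e = U := by rw [hU, mul_assoc, hke']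
  have hUN : U ∈ N := mul_mem hyN hk
  have hVU : star V * U = 0 := by rw [hU, ← mul_assoc, hVy, zero_mul]
  have hUV' : star U * V = 0 := by
    have := congrArg star hVU
    simpa [star_mul] using this
  have hUVs : U * star V = 0 := by rw [← hUe, mul_assoc, heV, mul_zero]
  have hVe : V * e = 0 := by
    have := congrArg star heV
    rwa [star_mul, star_star, hP.1, star_zero] at this
  have hWW : star (V + U) * (V + U) = star V * V + e := by
    rw [star_add, add_mul, mul_add, mul_add, hVU, hUV', hUU]; abel
  have hW : PI N p r (V + U) := by
    refine ⟨add_mem hV.1 hUN, ?_, ?_, ?_⟩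
    · rw [mul_assoc, hWW, add_mul, mul_add, mul_add, hVe, hUe, ← mul_assoc, ← mul_assoc, hV.2.1, hUVs]
      simp
    · rw [mul_add, hV.2.2.1, hU, ← mul_assoc, hpy]
    · rw [add_mul, hV.2.2.2]
      congr 1
      rw [← hUe, mul_assoc, her]
  have h1 := hmax (V + U) hW (by
    rw [add_mul, ← mul_assoc, hV.2.1, ← mul_assoc, hUVs, zero_mul, add_zero])
  rw [hWW, mul_add, hVe, add_zero, ← mul_assoc, hV.2.1] at h1
  have hU0 : U = 0 := by simpa using h1.symm
  rw [hU0, mul_zero] at hUU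
  exact he0 hUU.symm

/-- Lemma K: the trace of a finite factor is dominated by a normal functional. -/
theorem lemmaK (hfac : IsFactorSet (N : Set (H →L[ℂ] H))) :
    ∃ (n : ℕ) (ξ : Fin n → H), ∀ x ∈ N, nsq tr x ≤ ∑ i, ‖x (ξ i)‖ ^ 2 := by
  suffices h : Good tr 1 by
    obtain ⟨ι, _, ξ, hξ⟩ := h
    refine ⟨Fintype.card ι, fun i => ξ ((Fintype.equivFin ι).symm i), fun x hx => ?_⟩
    have := hξ x hx
    rw [mul_one] at this
    rw [(Fintype.equivFin ι).symm.sum_comp (fun i => ‖x (ξ i)‖ ^ 2)]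
    exact this
  obtain ⟨p, hpN, hp, hp0, hpg⟩ := K2 tr
  have hτp : 0 < (tr.τ p).re := by
    rw [← nsq_proj tr hp]
    refine lt_of_le_of_ne (nsq_nonneg tr hpN) fun h => hp0 (nsq_zero tr hpN h.symm)
  let Q : Set ℝ := {s | ∃ q ∈ N, IsP q ∧ Good tr q ∧ s = (tr.τ q).re}
  have hQ : BddAbove Q := ⟨1, by
    rintro s ⟨q, hqN, hq, -, rfl⟩
    have h1 : q ≤ 1 := by
      rw [← sub_nonneg]; exact hq.one_sub.nonneg
    have := tau_mono tr hqN (one_mem N) h1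
    rwa [tr.unital] at this⟩
  obtain ⟨_, ⟨q, hqN, hq, hqg, rfl⟩, hlt⟩ := exists_lt_of_lt_csSup
    (show Q.Nonempty from ⟨_, p, hpN, hp, hpg, rfl⟩) (sub_lt_self (sSup Q) hτp)
  have hrN : 1 - q ∈ N := sub_mem (one_mem N) hqN
  obtain ⟨V, hV, hor⟩ := comparison (N := N) hfac hp hq.one_sub hpN hrN
  have hVg : Good tr (star V * V) := by
    have : star V * V = star V * (p * V) := by rw [hV.2.2.1]
    rw [this]
    exact Good.mul_left tr (star_mem hV.1) (Good.mul_right tr hpN hV.1 hpg)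
  have hVN : star V * V ∈ N := mul_mem (star_mem hV.1) hV.1
  rcases hor with h | h
  · exfalso
    have hVq : V * q = 0 := by
      have := hV.2.2.2
      rw [mul_sub, mul_one] at this
      simpa using this
    have hqV : q * star V = 0 := by
      have := congrArg star hVq
      rwa [star_mul, hq.1, star_zero] at this
    have hP : IsP (q + star V * V) := by
      refine ⟨by rw [star_add, hq.1, hV.init.1], ?_⟩
      rw [add_mul, mul_add, mul_add, hq.2, hV.init.2, ← mul_assoc, hqV, mul_assoc, hVq]
      simp
    have := le_csSup hQ ⟨_, add_mem hqN hVN, hP, Good.add tr hqN hVN hqg hVg, rfl⟩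
    rw [map_add, Complex.add_re, tr.tracial _ (star_mem hV.1) _ hV.1, h] at this
    linarith
  · have := Good.add tr hqN hVN hqg hVg
    rw [h] at this
    simpa using this

end Kthm
end CDP
end

noncomputable section
open scoped Classical

namespace CDP
open CD Filter Topology

section cp
variable {H : Type} [NormedAddCommGroup H] [InnerProductSpace ℂ H] [CompleteSpace H]

section tr
variable {N : VonNeumannAlgebra H} (tr : TraceOn H (N : Set (H →L[ℂ] H)))

lemma tau_sq_le {x : H →L[ℂ] H} (hx : x ∈ N) : ‖tr.τ x‖ ^ 2 ≤ nsq tr x := by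
  have h := nsq_nonneg tr (sub_mem hx (smul_mem_vN N (tr.τ x) (one_mem N)))
  have : nsq tr (x - tr.τ x • 1) = nsq tr x - ‖tr.τ x‖ ^ 2 := by
    have e : tr.τ (star (x - tr.τ x • 1) * (x - tr.τ x • 1))
        = tr.τ (star x * x) - starRingEnd ℂ (tr.τ x) * tr.τ x := by
      simp only [star_sub, star_smul, star_one, sub_mul, mul_sub, smul_mul_assoc, mul_smul_comm,
        one_mul, mul_one, map_sub, map_smul, smul_eq_mul, tr.star_eq x hx, tr.unital]
      rw [starRingEnd_apply]
      ring
    unfold nsq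
    rw [e, Complex.conj_mul', Complex.sub_re]
    norm_cast
  linarith

lemma nsq_expect {A : Set (H →L[ℂ] H)} (E : CondExpOn H (N : Set (H →L[ℂ] H)) A tr)
    (hA : A ⊆ N) {x : H →L[ℂ] H} (hx : x ∈ N) : nsq tr (E.E x) ≤ nsq tr x := by
  have := E.contractive x hx
  unfold TraceOn.norm2 at this
  exact (Real.sqrt_le_sqrt_iff (nsq_nonneg tr hx)).1 this

variable {A : VonNeumannAlgebra H}
  (E : CondExpOn H (N : Set (H →L[ℂ] H)) (A : Set (H →L[ℂ] H)) tr)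

lemma E_left {a x : H →L[ℂ] H} (ha : a ∈ A) (hx : x ∈ N) : E.E (a * x) = a * E.E x := by
  have := E.bimod a ha 1 (one_mem A) x hx
  simpa using this

lemma E_right {a x : H →L[ℂ] H} (ha : a ∈ A) (hx : x ∈ N) : E.E (x * a) = E.E x * a := by
  have := E.bimod 1 (one_mem A) a ha x hx
  simpa using this

lemma E_char (hA : ∀ a ∈ A, a ∈ N) {x b : H →L[ℂ] H} (hx : x ∈ N) (hb : b ∈ A)
    (h : ∀ a ∈ A, tr.τ (a * x) = tr.τ (a * b)) : E.E x = b := by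
  have hd : E.E x - b ∈ A := sub_mem (E.mem x hx) hb
  rw [← sub_eq_zero]
  apply tr.faithful _ (hA _ hd)
  rw [mul_sub, map_sub, sub_eq_zero, ← h _ (star_mem hd), ← E_left tr E (star_mem hd) hx,
    E.trace_eq _ (mul_mem (hA _ (star_mem hd)) hx)]

lemma E_conj (hA : ∀ a ∈ A, a ∈ N) {g x : H →L[ℂ] H} (hg : g ∈ N) (hx : x ∈ N)
    (h1 : star g * g = 1) (hn : ∀ a ∈ A, g * a * star g ∈ A)
    (hn' : ∀ a ∈ A, star g * a * g ∈ A) : E.E (g * x * star g) = g * E.E x * star g := by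
  have hE := E.mem x hx
  refine E_char tr E hA (mul_mem (mul_mem hg hx) (star_mem hg)) (hn _ hE) fun a ha => ?_
  have key : ∀ z ∈ N, tr.τ (a * (g * z * star g)) = tr.τ (star g * a * g * z) := by
    intro z hz
    have := tr.tracial (a * g * z) (mul_mem (mul_mem (hA a ha) hg) hz) (star g) (star_mem hg)
    simp only [mul_assoc] at this ⊢
    exact this
  rw [key x hx, key _ (hA _ hE), ← E_left tr E (hn' a ha) hx,
    E.trace_eq _ (mul_mem (hA _ (hn' a ha)) hx)]

end tr

section XP
variable {Λ : Type} [Group Λ] (Y : CrossedProduct Λ H)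

lemma AM {a : H →L[ℂ] H} (ha : a ∈ Y.A) : a ∈ Y.M := Y.A_sub ha
lemma LM {a : H →L[ℂ] H} (ha : a ∈ Y.Lg) : a ∈ Y.M := Y.Lg_sub ha

lemma u_ss (γ : Λ) : star (Y.u γ) * Y.u γ = 1 := by rw [Y.u_star, Y.u_mul, inv_mul_cancel, Y.u_one]
lemma u_ss' (γ : Λ) : Y.u γ * star (Y.u γ) = 1 := by rw [Y.u_star, Y.u_mul, mul_inv_cancel, Y.u_one]

lemma conj_mem' (γ : Λ) {a : H →L[ℂ] H} (ha : a ∈ Y.A) : star (Y.u γ) * a * Y.u γ ∈ Y.A := by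
  have := Y.conj_mem γ⁻¹ a ha
  rwa [Y.u_star, inv_inv, ← Y.u_star] at this

lemma u_Lg (γ : Λ) : Y.u γ ∈ Y.Lg := by
  have : Y.u γ ∈ (Y.Lg : Set (H →L[ℂ] H)) := by
    rw [Y.Lg_eq]
    exact Set.subset_centralizer_centralizer ⟨γ, rfl⟩
  exact this

lemma E_u (γ : Λ) : Y.EA.E (Y.u γ) = if γ = 1 then 1 else 0 := by
  split_ifs with h
  · rw [h, Y.u_one]; exact Y.EA.fix 1 (one_mem Y.A)
  · exact Y.EA_u γ h

lemma tau_u (γ : Λ) : Y.tr.τ (Y.u γ) = if γ = 1 then 1 else 0 := by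
  rw [← Y.EA.trace_eq _ (Y.u_mem γ), E_u]
  split_ifs with h
  · exact Y.tr.unital
  · exact map_zero _

/-- normalizing unitaries -/
structure Nrm (g : H →L[ℂ] H) : Prop where
  mem : g ∈ Y.M
  ss : star g * g = 1
  ss' : g * star g = 1
  nm : ∀ a ∈ Y.A, g * a * star g ∈ Y.A
  nm' : ∀ a ∈ Y.A, star g * a * g ∈ Y.A

lemma u_nrm (γ : Λ) : Nrm Y (Y.u γ) :=
  ⟨Y.u_mem γ, u_ss Y γ, u_ss' Y γ, Y.conj_mem γ, fun _ ha => conj_mem' Y γ ha⟩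

lemma Nrm.star {g : H →L[ℂ] H} (h : Nrm Y g) : Nrm Y (star g) :=
  ⟨star_mem h.mem, by rw [star_star, h.ss'], by rw [star_star, h.ss],
    by simpa using h.nm', by simpa using h.nm⟩

lemma Nrm.mul {g k : H →L[ℂ] H} (h : Nrm Y g) (h' : Nrm Y k) : Nrm Y (g * k) := by
  refine ⟨mul_mem h.mem h'.mem, ?_, ?_, fun a ha => ?_, fun a ha => ?_⟩
  · calc _ = Star.star k * (Star.star g * g) * k := by simp only [star_mul, mul_assoc]
      _ = 1 := by rw [h.ss, mul_one, h'.ss]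
  · calc _ = g * (k * Star.star k) * Star.star g := by simp only [star_mul, mul_assoc]
      _ = 1 := by rw [h'.ss', mul_one, h.ss']
  · have := h.nm _ (h'.nm a ha)
    simpa only [star_mul, mul_assoc] using this
  · have := h'.nm' _ (h.nm' a ha)
    simpa only [star_mul, mul_assoc] using this

lemma Nrm.E_conj {g x : H →L[ℂ] H} (h : Nrm Y g) (hx : x ∈ Y.M) :
    Y.EA.E (g * x * Star.star g) = g * Y.EA.E x * Star.star g :=
  CDP.E_conj Y.tr Y.EA (fun _ => AM Y) h.mem hx h.ss h.nm h.nm'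

/-- `b u* = u* σ(b)` -/
lemma move_u (γ : Λ) (b : H →L[ℂ] H) : b * star (Y.u γ) = star (Y.u γ) * (Y.u γ * b * star (Y.u γ)) := by
  calc b * star (Y.u γ) = (star (Y.u γ) * Y.u γ) * (b * star (Y.u γ)) := by rw [u_ss, one_mul]
    _ = _ := by simp only [mul_assoc]

lemma E_move (γ : Λ) {x b : H →L[ℂ] H} (hx : x ∈ Y.M) (hb : b ∈ Y.A) :
    Y.EA.E (x * b * star (Y.u γ)) = Y.EA.E (x * star (Y.u γ)) * (Y.u γ * b * star (Y.u γ)) := by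
  rw [mul_assoc, move_u, ← mul_assoc]
  exact E_right Y.tr Y.EA (Y.conj_mem γ b hb) (mul_mem hx (star_mem (Y.u_mem γ)))

lemma rel_comm (hab : IsAbelianSet (Y.A : Set (H →L[ℂ] H))) (hfree : IsFree Y)
    {x : H →L[ℂ] H} (hx : x ∈ Y.M) (hc : ∀ b ∈ Y.A, x * b = b * x) : x ∈ Y.A := by
  have hE := Y.EA.mem x hx
  have hEM : Y.EA.E x ∈ Y.M := AM Y hE
  have h0 : ∀ γ, γ ≠ 1 → Y.EA.E (x * star (Y.u γ)) = 0 := by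
    intro γ hγ
    have hm := Y.EA.mem _ (mul_mem hx (star_mem (Y.u_mem γ)))
    refine hfree γ hγ _ hm fun b hb => ?_
    have e1 := E_move Y γ hx hb
    rw [hc b hb, mul_assoc, E_left Y.tr Y.EA hb (mul_mem hx (star_mem (Y.u_mem γ)))] at e1
    rw [CrossedProduct.σ, hab _ (Y.conj_mem γ b hb) _ hm, ← e1]
    exact hab _ hb _ hm
  have : x - Y.EA.E x = 0 := by
    refine Y.fourier_sep _ (sub_mem hx hEM) fun γ => ?_
    rw [sub_mul, map_sub, E_left Y.tr Y.EA hE (star_mem (Y.u_mem γ))]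
    by_cases hγ : γ = 1
    · subst hγ
      rw [Y.u_one, star_one, mul_one, Y.EA.fix 1 (one_mem Y.A), mul_one, sub_self]
    · rw [h0 γ hγ, Y.u_star, E_u, if_neg (inv_ne_one.2 hγ)]; simp
  rw [sub_eq_zero.1 this]; exact hE

lemma is_factor (hab : IsAbelianSet (Y.A : Set (H →L[ℂ] H))) (hfree : IsFree Y)
    (herg : IsErgodic Y) : IsFactorSet (Y.M : Set (H →L[ℂ] H)) := by
  intro x hx hc
  have hxA := rel_comm Y hab hfree hx fun b hb => hc b (AM Y hb)
  refine herg x hxA fun γ => ?_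
  rw [CrossedProduct.σ, ← hc _ (Y.u_mem γ), mul_assoc, u_ss', mul_one]

/-- the span of the canonical unitaries -/
def spanAlg {Γ : Type} [Group Γ] (u : Γ → H →L[ℂ] H) (h1 : u 1 = 1)
    (hm : ∀ γ δ, u γ * u δ = u (γ * δ)) (hs : ∀ γ, star (u γ) = u γ⁻¹) :
    StarSubalgebra ℂ (H →L[ℂ] H) where
  carrier := Submodule.span ℂ (Set.range u)
  mul_mem' := by
    intro a b ha hb
    have := Submodule.mul_mem_mul ha hb
    rw [Submodule.span_mul_span] at this
    refine Submodule.span_mono ?_ this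
    rintro _ ⟨_, ⟨γ, rfl⟩, _, ⟨δ, rfl⟩, rfl⟩
    exact ⟨γ * δ, (hm γ δ).symm⟩
  add_mem' := fun ha hb => add_mem ha hb
  algebraMap_mem' := fun c => by
    rw [Algebra.algebraMap_eq_smul_one, ← h1]
    exact Submodule.smul_mem _ _ (Submodule.subset_span ⟨1, rfl⟩)
  star_mem' := by
    intro a ha
    refine Submodule.span_induction (p := fun a _ => star a ∈ Submodule.span ℂ (Set.range u))
      ?_ ?_ ?_ ?_ ha
    · rintro _ ⟨γ, rfl⟩
      rw [hs]; exact Submodule.subset_span ⟨_, rfl⟩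
    · rw [star_zero]; exact zero_mem _
    · intro x y _ _ hx hy; rw [star_add]; exact add_mem hx hy
    · intro c x _ hx; rw [star_smul]; exact Submodule.smul_mem _ _ hx

/-- 2-norm density of the group algebra in the group von Neumann algebra -/
lemma span_dense (hfac : IsFactorSet (Y.M : Set (H →L[ℂ] H)))
    (tr : TraceOn H (Y.M : Set (H →L[ℂ] H))) {l : H →L[ℂ] H} (hl : l ∈ Y.Lg) {ε : ℝ} (hε : 0 < ε) :
    ∃ a ∈ Submodule.span ℂ (Set.range Y.u), nsq tr (l - a) < ε := by
  obtain ⟨n, ξ, hξ⟩ := lemmaK tr hfac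
  have hl' : l ∈ Set.centralizer (Set.centralizer ((spanAlg Y.u Y.u_one Y.u_mul Y.u_star :
      StarSubalgebra ℂ (H →L[ℂ] H)) : Set (H →L[ℂ] H))) := by
    have h1 : l ∈ (Y.Lg : Set (H →L[ℂ] H)) := hl
    rw [Y.Lg_eq] at h1
    refine Set.centralizer_subset (Set.centralizer_subset ?_) h1
    exact Submodule.subset_span
  obtain ⟨a, ha, hlt⟩ := vn_density _ l hl' n ξ ε hε
  refine ⟨a, ha, lt_of_le_of_lt (hξ _ (sub_mem (LM Y hl) ?_)) hlt⟩
  have : Submodule.span ℂ (Set.range Y.u) ≤ Y.M.toStarSubalgebra.toSubalgebra.toSubmodule := by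
    rw [Submodule.span_le]
    rintro _ ⟨γ, rfl⟩
    exact Y.u_mem γ
  exact this ha

lemma span_M {a : H →L[ℂ] H} (ha : a ∈ Submodule.span ℂ (Set.range Y.u)) : a ∈ Y.M := by
  have : Submodule.span ℂ (Set.range Y.u) ≤ Y.M.toStarSubalgebra.toSubalgebra.toSubmodule := by
    rw [Submodule.span_le]
    rintro _ ⟨γ, rfl⟩
    exact Y.u_mem γ
  exact this ha

lemma E_Lg (hfac : IsFactorSet (Y.M : Set (H →L[ℂ] H))) {l : H →L[ℂ] H} (hl : l ∈ Y.Lg) :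
    Y.EA.E l = Y.tr.τ l • 1 := by
  have hlM := LM Y hl
  rw [← sub_eq_zero]
  have hmem : Y.EA.E l - Y.tr.τ l • 1 ∈ Y.M :=
    sub_mem (AM Y (Y.EA.mem l hlM)) (smul_mem_vN _ _ (one_mem _))
  apply nsq_zero Y.tr hmem
  apply le_antisymm _ (nsq_nonneg Y.tr hmem)
  apply le_of_forall_pos_le_add
  intro ε hε
  obtain ⟨a, ha, hlt⟩ := span_dense Y hfac Y.tr hl (ε := ε / 4) (by positivity)
  have haM := span_M Y ha
  have hEa : Y.EA.E a = Y.tr.τ a • 1 := by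
    refine Submodule.span_induction (p := fun a _ => Y.EA.E a = Y.tr.τ a • 1) ?_ ?_ ?_ ?_ ha
    · rintro _ ⟨γ, rfl⟩
      rw [E_u, tau_u]; split_ifs <;> simp
    · simp
    · intro x y _ _ hx hy; rw [map_add, map_add, hx, hy, add_smul]
    · intro c x _ hx; rw [map_smul, map_smul, hx, smul_smul, smul_eq_mul]
  have hla := sub_mem hlM haM
  have e1 : Y.EA.E l - Y.tr.τ l • 1 = Y.EA.E (l - a) + (-Y.tr.τ (l - a)) • 1 := by
    rw [map_sub, map_sub, hEa, neg_smul, sub_smul]; abel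
  rw [e1]
  have h1 := nsq_add_le Y.tr (AM Y (Y.EA.mem _ hla)) (smul_mem_vN Y.M (-Y.tr.τ (l - a)) (one_mem _))
  have h2 := nsq_expect Y.tr Y.EA Y.A_sub hla
  have h3 : nsq Y.tr ((-Y.tr.τ (l - a)) • (1 : H →L[ℂ] H)) ≤ nsq Y.tr (l - a) := by
    rw [nsq_smul, norm_neg]
    have : nsq Y.tr 1 = 1 := by unfold nsq; rw [star_one, mul_one, Y.tr.unital]; rfl
    rw [this, mul_one]
    exact tau_sq_le Y.tr hla
  linarith

/-! ### normalizing unitaries and their pieces -/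

/-- Fourier coefficient -/
def co (g : H →L[ℂ] H) (s : Λ) : H →L[ℂ] H := Y.EA.E (g * star (Y.u s))

lemma co_mem {g : H →L[ℂ] H} (hg : g ∈ Y.M) (s : Λ) : co Y g s ∈ Y.A :=
  Y.EA.mem _ (mul_mem hg (star_mem (Y.u_mem s)))

/-- piece -/
def pc (g : H →L[ℂ] H) (s : Λ) : H →L[ℂ] H := star g * co Y g s * Y.u s

variable (hab : IsAbelianSet (Y.A : Set (H →L[ℂ] H))) (hfree : IsFree Y)

section pieces
variable {g : H →L[ℂ] H}

lemma g_pc (hg : Nrm Y g) (s : Λ) : g * pc Y g s = co Y g s * Y.u s := by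
  rw [pc, ← mul_assoc, ← mul_assoc, hg.ss', one_mul]

lemma co_rel (hg : Nrm Y g) (s : Λ) {b : H →L[ℂ] H} (hb : b ∈ Y.A) :
    co Y g s * (Y.u s * b * star (Y.u s)) = g * b * star g * co Y g s := by
  rw [co, ← E_move Y s hg.mem hb, ← E_left Y.tr Y.EA (hg.nm b hb) (mul_mem hg.mem (star_mem (Y.u_mem s)))]
  congr 1
  calc g * b * star (Y.u s) = g * b * (star g * g) * star (Y.u s) := by rw [hg.ss, mul_one]
    _ = _ := by simp only [mul_assoc]

lemma pc_full (hg : Nrm Y g) {p : H →L[ℂ] H} (hp : p ∈ Y.A) (h : ∀ s, pc Y g s * p = 0) : p = 0 := by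
  have h0 : g * p = 0 := by
    refine Y.fourier_sep _ (mul_mem hg.mem (AM Y hp)) fun s => ?_
    rw [E_move Y s hg.mem hp]
    change co Y g s * _ = 0
    calc co Y g s * (Y.u s * p * star (Y.u s)) = (co Y g s * Y.u s) * p * star (Y.u s) := by simp only [mul_assoc]
      _ = g * (pc Y g s * p) * star (Y.u s) := by rw [← g_pc Y hg]; simp only [mul_assoc]
      _ = 0 := by rw [h, mul_zero, zero_mul]
  calc p = star g * (g * p) := by rw [← mul_assoc, hg.ss, one_mul]
    _ = 0 := by rw [h0, mul_zero]


lemma pc_mem (hab : IsAbelianSet (Y.A : Set (H →L[ℂ] H))) (hfree : IsFree Y) (hg : Nrm Y g) (s : Λ) : pc Y g s ∈ Y.A := by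
  refine rel_comm Y hab hfree
    (mul_mem (mul_mem (star_mem hg.mem) (AM Y (co_mem Y hg.mem s))) (Y.u_mem s)) fun b hb => ?_
  have h1 := co_rel Y hg s hb
  calc star g * co Y g s * Y.u s * b
      = star g * co Y g s * (Y.u s * b * (star (Y.u s) * Y.u s)) := by
        rw [u_ss, mul_one]; simp only [mul_assoc]
    _ = star g * (co Y g s * (Y.u s * b * star (Y.u s))) * Y.u s := by simp only [mul_assoc]
    _ = (star g * g) * b * star g * co Y g s * Y.u s := by rw [h1]; simp only [mul_assoc]
    _ = b * (star g * co Y g s * Y.u s) := by rw [hg.ss, one_mul]; simp only [mul_assoc]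

lemma pc_isP (hab : IsAbelianSet (Y.A : Set (H →L[ℂ] H))) (hfree : IsFree Y) (hg : Nrm Y g) (s : Λ) : IsP (pc Y g s) := by
  have hd := pc_mem Y hab hfree hg s
  have hbm := co_mem Y hg.mem s
  have key : star (pc Y g s) = star (pc Y g s) * pc Y g s := by
    have e1 : star (pc Y g s) = star (Y.u s) * (star (co Y g s) * (g * star (Y.u s))) * Y.u s := by
      rw [pc, star_mul, star_mul, star_star]
      simp only [mul_assoc]
      rw [u_ss, mul_one]
    have e2 := Nrm.E_conj Y (Nrm.star Y (u_nrm Y s)) (x := star (co Y g s) * (g * star (Y.u s)))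
      (mul_mem (star_mem (AM Y hbm)) (mul_mem hg.mem (star_mem (Y.u_mem s))))
    rw [star_star, ← e1, Y.EA.fix _ (star_mem hd), E_left Y.tr Y.EA (star_mem hbm)
      (mul_mem hg.mem (star_mem (Y.u_mem s)))] at e2
    change _ = _ * (_ * co Y g s) * _ at e2
    conv_lhs => rw [e2]
    rw [pc, star_mul, star_mul, star_star]
    calc star (Y.u s) * (star (co Y g s) * co Y g s) * Y.u s
        = star (Y.u s) * (star (co Y g s) * ((g * star g) * co Y g s)) * Y.u s := by
          rw [hg.ss', one_mul]
      _ = _ := by simp only [mul_assoc]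
  have h2 : star (pc Y g s) = pc Y g s := by
    have := congrArg star key
    rw [star_mul, star_star] at this
    rw [key, ← this]
  refine ⟨h2, ?_⟩
  rw [h2] at key
  exact key.symm

lemma pc_orth (hab : IsAbelianSet (Y.A : Set (H →L[ℂ] H))) (hfree : IsFree Y) (hg : Nrm Y g) {s t : Λ} (hst : s ≠ t) : pc Y g s * pc Y g t = 0 := by
  have hs := pc_mem Y hab hfree hg s
  have ht := pc_mem Y hab hfree hg t
  have hbs := co_mem Y hg.mem s
  have hbt := co_mem Y hg.mem t
  rw [← Y.EA.fix _ (mul_mem hs ht)]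
  have e1 : pc Y g s * pc Y g t = star (Y.u s) * (star (co Y g s) * co Y g t) * Y.u s * Y.u (s⁻¹ * t) := by
    rw [← (pc_isP Y hab hfree hg s).1]
    rw [pc, pc, star_mul, star_mul, star_star, ← Y.u_mul, ← Y.u_star]
    calc star (Y.u s) * (star (co Y g s) * g) * (star g * co Y g t * Y.u t)
        = star (Y.u s) * (star (co Y g s) * ((g * star g) * co Y g t)) * Y.u t := by simp only [mul_assoc]
      _ = star (Y.u s) * (star (co Y g s) * co Y g t) * (Y.u s * star (Y.u s)) * Y.u t := by
        rw [hg.ss', one_mul, u_ss', mul_one]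
      _ = _ := by simp only [mul_assoc]
  rw [e1, E_left Y.tr Y.EA (conj_mem' Y s (mul_mem (star_mem hbs) hbt)) (Y.u_mem _), E_u, if_neg, mul_zero]
  intro h
  exact hst (inv_mul_eq_one.1 h)

end pieces
end XP
end cp
end CDP
end

noncomputable section
open scoped Classical

namespace CDP
open CD Filter Topology

section hilb
variable {K : Type} [NormedAddCommGroup K] [InnerProductSpace ℂ K] [CompleteSpace K]


/-- unitary representation -/
structure URep (G : Type) [Group G] (L : G → K →L[ℂ] K) : Prop where
  one : ∀ x, L 1 x = x
  mul : ∀ s t x, L s (L t x) = L (s * t) x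
  nrm : ∀ s x, ‖L s x‖ = ‖x‖

section rep
variable {G : Type} [Group G] {L : G → K →L[ℂ] K}

lemma URep.inn (h : URep G L) (s : G) (x y : K) : (inner ℂ (L s x) (L s y)) = (inner ℂ (x) (y)) :=
  (⟨(L s).toLinearMap, h.nrm s⟩ : K →ₗᵢ[ℂ] K).inner_map_map x y

lemma URep.inv (h : URep G L) (s : G) (x : K) : L s⁻¹ (L s x) = x := by
  rw [h.mul, inv_mul_cancel, h.one]

lemma URep.inv' (h : URep G L) (s : G) (x : K) : L s (L s⁻¹ x) = x := by
  rw [h.mul, mul_inv_cancel, h.one]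

lemma URep.adj (h : URep G L) (s : G) (x y : K) : (inner ℂ (L s x) (y)) = (inner ℂ (x) (L s⁻¹ y)) := by
  rw [← h.inn s⁻¹, h.inv]

/-- `e` generates an orthonormal basis -/
structure Gen (L : G → K →L[ℂ] K) (e : K) : Prop where
  nrm : ‖e‖ = 1
  orth : ∀ s, s ≠ 1 → (inner ℂ (L s e) (e)) = 0
  tot : ∀ y, (∀ s, (inner ℂ (L s e) (y)) = 0) → y = 0

lemma Gen.ortho (h : URep G L) {e : K} (hn : ‖e‖ = 1) (ho : ∀ s, s ≠ 1 → (inner ℂ (L s e) (e)) = 0) :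
    Orthonormal ℂ (fun s => L s e) := by
  refine ⟨fun s => by rw [h.nrm, hn], fun s t hst => ?_⟩
  have : (inner ℂ (L s e) (L t e)) = (inner ℂ (L (t⁻¹ * s) e) (e)) := by
    rw [← h.inn t⁻¹, h.inv, h.mul]
  change (inner ℂ (L s e) (L t e)) = 0
  rw [this]
  apply ho
  intro h1
  exact hst (inv_mul_eq_one.1 h1).symm

def Gen.basis (h : URep G L) {e : K} (he : Gen L e) : HilbertBasis G ℂ K :=
  HilbertBasis.mkOfOrthogonalEqBot (Gen.ortho h he.nrm he.orth) (by
    rw [Submodule.eq_bot_iff]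
    intro y hy
    refine he.tot y fun s => ?_
    rw [Submodule.mem_orthogonal] at hy
    exact hy _ (Submodule.subset_span ⟨s, rfl⟩))

lemma Gen.basis_apply (h : URep G L) {e : K} (he : Gen L e) (s : G) : he.basis h s = L s e := by
  rw [Gen.basis, HilbertBasis.coe_mkOfOrthogonalEqBot]

lemma Gen.hasSum (h : URep G L) {e : K} (he : Gen L e) (x y : K) :
    HasSum (fun s => (inner ℂ (x) (L s e)) * (inner ℂ (L s e) (y))) (inner ℂ (x) (y)) := by
  have := (he.basis h).hasSum_inner_mul_inner x y
  simpa only [Gen.basis_apply] using this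

/-- coefficients vanish at infinity -/
lemma Gen.coef (h : URep G L) {e : K} (he : Gen L e) (x y : K) {ε : ℝ} (hε : 0 < ε) :
    {s | ε ≤ ‖(inner ℂ (L s x) (y))‖}.Finite := by
  have hS : ∀ x : K, x ∈ closure (Submodule.span ℂ (Set.range fun s => L s e) : Set K) := by
    intro x
    have : (Submodule.span ℂ (Set.range fun s => L s e)).topologicalClosure = ⊤ := by
      rw [Submodule.topologicalClosure_eq_top_iff, Submodule.eq_bot_iff]
      intro y hy
      refine he.tot y fun s => ?_
      rw [Submodule.mem_orthogonal] at hy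
      exact hy _ (Submodule.subset_span ⟨s, rfl⟩)
    change x ∈ (Submodule.span ℂ (Set.range fun s => L s e)).topologicalClosure
    rw [this]; trivial
  have hT : ∀ x ∈ Submodule.span ℂ (Set.range fun s => L s e),
      Tendsto (fun s => (inner ℂ (L s x) (y))) cofinite (𝓝 0) := by
    intro x hx
    refine Submodule.span_induction
      (p := fun x _ => Tendsto (fun s => (inner ℂ (L s x) (y))) cofinite (𝓝 0)) ?_ ?_ ?_ ?_ hx
    · rintro _ ⟨t, rfl⟩
      have h1 := (Gen.ortho h he.nrm he.orth).inner_products_summable (x := y)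
      have h2 := h1.tendsto_cofinite_zero
      have h3 : Tendsto (fun s => ‖(inner ℂ (L s e) (y))‖) cofinite (𝓝 0) := by
        have := h2.sqrt
        simpa [Real.sqrt_sq] using this
      have h4 := tendsto_zero_iff_norm_tendsto_zero.2 h3
      have h5 := h4.comp ((mul_left_injective t).tendsto_cofinite)
      refine h5.congr fun s => ?_
      simp only [Function.comp, h.mul]
    · simp only [map_zero, inner_zero_left]; exact tendsto_const_nhds
    · intro a b _ _ ha hb
      have := ha.add hb
      simpa [inner_add_left] using this
    · intro c a _ ha
      have := ha.const_mul (starRingEnd ℂ c)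
      simpa [inner_smul_left, mul_comm] using this
  obtain ⟨x', hx', hd⟩ := Metric.mem_closure_iff.1 (hS x) (ε / (2 * (‖y‖ + 1))) (by positivity)
  have hfin : {s | ε / 2 ≤ ‖(inner ℂ (L s x') (y))‖}.Finite := by
    have := (tendsto_zero_iff_norm_tendsto_zero.1 (hT x' hx')).eventually_lt_const (half_pos hε)
    rw [eventually_cofinite] at this
    simpa using this
  refine hfin.subset fun s hs => ?_
  have h1 : ‖(inner ℂ (L s x) (y)) - (inner ℂ (L s x') (y))‖ ≤ ε / 2 := by
    rw [← inner_sub_left, ← map_sub]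
    refine (norm_inner_le_norm _ _).trans ?_
    rw [h.nrm]
    rw [dist_eq_norm] at hd
    have : ‖x - x'‖ * ‖y‖ ≤ ε / (2 * (‖y‖ + 1)) * (‖y‖ + 1) := by gcongr; linarith
    refine this.trans (le_of_eq ?_)
    field_simp
  have h2 := norm_sub_norm_le (inner ℂ (L s x) (y)) (inner ℂ (L s x') (y))
  simp only [Set.mem_ofPred_eq] at hs ⊢
  linarith

lemma perp_of_parseval {ι : Type} {v : ι → K} (hv : Orthonormal ℂ v) {x y : K}
    (hs : HasSum (fun i => ‖(inner ℂ (v i) (x))‖ ^ 2) (‖x‖ ^ 2)) (hy : ∀ i, (inner ℂ (v i) (y)) = 0) : (inner ℂ (x) (y)) = 0 := by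
  have h1 : ∀ F : Finset ι, ‖(inner ℂ (x) (y))‖ ^ 2 ≤ (‖x‖ ^ 2 - ∑ i ∈ F, ‖(inner ℂ (v i) (x))‖ ^ 2) * ‖y‖ ^ 2 := by
    intro F
    have e : inner ℂ (x - ∑ i ∈ F, (inner ℂ (v i) (x)) • v i) y = (inner ℂ (x) (y)) := by
      rw [inner_sub_left, sum_inner]
      simp [inner_smul_left, hy]
    have n : ‖x - ∑ i ∈ F, (inner ℂ (v i) (x)) • v i‖ ^ 2 = ‖x‖ ^ 2 - ∑ i ∈ F, ‖(inner ℂ (v i) (x))‖ ^ 2 := by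
      have hs2 : inner ℂ x (∑ i ∈ F, (inner ℂ (v i) (x)) • v i) = ((∑ i ∈ F, ‖(inner ℂ (v i) (x))‖ ^ 2 : ℝ) : ℂ) := by
        rw [inner_sum]
        push_cast
        refine Finset.sum_congr rfl fun i _ => ?_
        rw [inner_smul_right, ← Complex.mul_conj', inner_conj_symm]
      have hs3 : ‖∑ i ∈ F, (inner ℂ (v i) (x)) • v i‖ ^ 2 = ∑ i ∈ F, ‖(inner ℂ (v i) (x))‖ ^ 2 := by
        have h0 : inner ℂ (∑ i ∈ F, (inner ℂ (v i) (x)) • v i) (∑ i ∈ F, (inner ℂ (v i) (x)) • v i)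
            = ((∑ i ∈ F, ‖(inner ℂ (v i) (x))‖ ^ 2 : ℝ) : ℂ) := by
          rw [hv.inner_sum]
          push_cast
          refine Finset.sum_congr rfl fun i _ => ?_
          rw [Complex.conj_mul']
        rw [inner_self_eq_norm_sq_to_K] at h0
        exact Complex.ofReal_injective (by simpa using h0)
      rw [@norm_sub_sq ℂ, hs2, hs3]
      simp only [RCLike.re_to_complex, Complex.ofReal_re]
      ring
    rw [← n, ← e]
    have := norm_inner_le_norm (𝕜 := ℂ) (x - ∑ i ∈ F, (inner ℂ (v i) (x)) • v i) y
    rw [← mul_pow]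
    gcongr
  have h2 : Tendsto (fun F : Finset ι => (‖x‖ ^ 2 - ∑ i ∈ F, ‖(inner ℂ (v i) (x))‖ ^ 2) * ‖y‖ ^ 2) atTop (𝓝 0) := by
    have := (tendsto_const_nhds (x := ‖x‖ ^ 2)).sub hs
    simpa using this.mul_const (‖y‖ ^ 2)
  have h3 := ge_of_tendsto' h2 h1
  have : ‖(inner ℂ (x) (y))‖ ^ 2 = 0 := le_antisymm h3 (sq_nonneg _)
  simpa using this
end rep

section two
variable {Λ Γ : Type} [Group Λ] [Group Γ] {L : Λ → K →L[ℂ] K} {R : Γ → K →L[ℂ] K}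

/-- totality of the orbit of `ω` -/
lemma tot_of (hL : URep Λ L) (hR : URep Γ R) (hc : ∀ s g x, L s (R g x) = R g (L s x))
    {e : K} (heL : Gen L e) (heR : Gen R e) {ω : K} (hω : ‖ω‖ = 1)
    (ho : ∀ g, g ≠ 1 → (inner ℂ (R g ω) (ω)) = 0) : Gen R ω := by
  refine ⟨hω, ho, fun y hy => heL.tot y fun s => ?_⟩
  refine perp_of_parseval (Gen.ortho hR hω ho) ?_ hy
  have h1 := heR.hasSum hR (L s⁻¹ ω) (L s⁻¹ ω)
  rw [hL.inn, inner_self_eq_norm_sq_to_K, hω] at h1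
  have h2 : HasSum (fun g => ‖(inner ℂ (R g ω) (L s e))‖ ^ 2) (1 : ℝ) := by
    have h3 := (Equiv.inv Γ).hasSum_iff.2 h1
    have h4 := (Complex.hasSum_iff _ _).1 h3
    have h5 := h4.1
    simp only [Function.comp] at h5
    have e1 : ∀ g : Γ, ((inner ℂ (L s⁻¹ ω) (R ((Equiv.inv Γ) g) e)) * (inner ℂ (R ((Equiv.inv Γ) g) e) (L s⁻¹ ω))).re
        = ‖(inner ℂ (R g ω) (L s e))‖ ^ 2 := by
      intro g
      have e2 : (inner ℂ (R g ω) (L s e)) = (inner ℂ (L s⁻¹ ω) (R g⁻¹ e)) := by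
        rw [hR.adj, ← hc, hL.adj, inv_inv]
      rw [e2, Equiv.inv_apply, ← inner_conj_symm (R g⁻¹ e), Complex.mul_conj']
      norm_cast
    simp only [e1] at h5
    simpa using h5
  rw [hL.nrm, heL.nrm, one_pow]
  exact h2

lemma orthL_of (hL : URep Λ L) (hR : URep Γ R) (hc : ∀ s g x, L s (R g x) = R g (L s x))
    {e : K} (heL : Gen L e) (heR : Gen R e) {ω : K} (hωR : Gen R ω) (s : Λ) (hs : s ≠ 1) :
    (inner ℂ (L s ω) (ω)) = 0 := by
  have h1 := (Equiv.inv Γ).hasSum_iff.2 (heR.hasSum hR (L s ω) ω)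
  have h2 := hωR.hasSum hR e (L s⁻¹ e)
  have h3 : (inner ℂ (e) (L s⁻¹ e)) = 0 := by
    rw [← hL.adj]; exact heL.orth s hs
  rw [h3] at h2
  refine h1.unique ?_
  refine h2.congr_fun ?_
  intro g
  simp only [Function.comp, Equiv.inv_apply]
  have a1 : (inner ℂ (L s ω) (R g⁻¹ e)) = (inner ℂ (R g ω) (L s⁻¹ e)) := by
    rw [hL.adj, hR.adj, hc]
  have a2 : (inner ℂ (R g⁻¹ e) (ω)) = (inner ℂ (e) (R g ω)) := by
    rw [hR.adj, inv_inv]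
  rw [a1, a2, mul_comm]

/-- the relative compactness property -/
def PropP (L : Λ → K →L[ℂ] K) (R : Γ → K →L[ℂ] K) (ω : K) : Prop :=
  ∀ ε : ℝ, 0 < ε → ∃ C : Set K, C.Finite ∧ ∀ γ, ∃ c ∈ C, ∃ χ : ℂ, ∃ s, ‖χ‖ = 1 ∧
    ‖R γ ω - χ • L s c‖ ≤ ε

lemma inner_close {a b a' b' : K} {ε N : ℝ} (hε : 0 ≤ ε) (ha : ‖a - a'‖ ≤ ε) (hb : ‖b - b'‖ ≤ ε)
    (hN : ‖a‖ ≤ N) (hN' : ‖b‖ ≤ N) : ‖(inner ℂ (a) (b)) - (inner ℂ (a') (b'))‖ ≤ ε * (2 * N + ε) := by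
  have e : (inner ℂ (a) (b)) - (inner ℂ (a') (b')) = (inner ℂ (a - a') (b)) + (inner ℂ (a') (b - b')) := by
    rw [inner_sub_left, inner_sub_right]; ring
  have h1 := norm_inner_le_norm (𝕜 := ℂ) (a - a') b
  have h2 := norm_inner_le_norm (𝕜 := ℂ) a' (b - b')
  have h3 : ‖a'‖ ≤ N + ε := by
    have := norm_sub_norm_le a' a
    rw [norm_sub_rev] at this; linarith
  rw [e]
  calc _ ≤ ‖(inner ℂ (a - a') (b))‖ + ‖(inner ℂ (a') (b - b'))‖ := norm_add_le _ _
    _ ≤ ε * N + (N + ε) * ε := by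
      have := norm_nonneg b; have := norm_nonneg (b - b'); have := norm_nonneg a'
      refine add_le_add (h1.trans ?_) (h2.trans ?_)
      · gcongr
      · exact mul_le_mul h3 hb (norm_nonneg _) (le_trans (norm_nonneg _) h3)
    _ = _ := by ring

lemma mainA (hicc : IsICC Γ) (hL : URep Λ L) (hR : URep Γ R) (hc : ∀ s g x, L s (R g x) = R g (L s x))
    {e : K} (heL : Gen L e) (heR : Gen R e) {ω : K} (hω : ‖ω‖ = 1) (hP : PropP L R ω)
    (h : Γ) (s0 : Λ) (hk : (inner ℂ (ω) (L s0⁻¹ (R h ω))) ≠ 0) (g : Γ) (hg : g ≠ 1) :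
    (inner ℂ (R g ω) (L s0⁻¹ (R h ω))) = 0 := by
  set ω1 := L s0⁻¹ (R h ω) with hω1
  by_contra hη
  set k := ‖(inner ℂ (ω) (ω1))‖ with hkd
  set η := ‖(inner ℂ (R g ω) (ω1))‖ with hηd
  have hk0 : 0 < k := norm_pos_iff.2 hk
  have hη0 : 0 < η := norm_pos_iff.2 hη
  have hω1n : ‖ω1‖ = 1 := by rw [hω1, hL.nrm, hR.nrm, hω]
  set m := min 1 (min k η) with hm
  have hm0 : 0 < m := lt_min one_pos (lt_min hk0 hη0)
  have hm1 : m ≤ 1 := min_le_left _ _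
  have hmk : m ≤ k := (min_le_right _ _).trans (min_le_left _ _)
  have hmη : m ≤ η := (min_le_right _ _).trans (min_le_right _ _)
  obtain ⟨C, hC, hCp⟩ := hP (m / 8) (by positivity)
  have herr : m / 8 * (2 * 1 + m / 8) ≤ m / 2 := by nlinarith
  -- the finite set of `t`
  set T : Set Λ := ⋃ c ∈ C, ⋃ c' ∈ C, {t | k / 2 ≤ ‖(inner ℂ (L t c') (c))‖} with hT
  have hTf : T.Finite := hC.biUnion fun c _ => hC.biUnion fun c' _ => heL.coef hL c' c (half_pos hk0)
  set S : Set Γ := ⋃ c ∈ C, ⋃ c' ∈ C, ⋃ t ∈ T, {g' | η / 2 ≤ ‖(inner ℂ (R g' c) (L t c'))‖} with hS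
  have hSf : S.Finite := hC.biUnion fun c _ => hC.biUnion fun c' _ => hTf.biUnion fun t _ =>
    heR.coef hR c _ (half_pos hη0)
  refine hicc g hg (hSf.subset ?_)
  rintro _ ⟨γ, rfl⟩
  obtain ⟨c, hcC, χ, l, hχ, hcl⟩ := hCp γ
  obtain ⟨c', hcC', χ', l', hχ', hcl'⟩ := hCp (γ * h)
  set t := l⁻¹ * (s0⁻¹ * l') with ht
  have hd : ‖R γ ω1 - χ' • L l (L t c')‖ ≤ m / 8 := by
    have e1 : R γ ω1 - χ' • L l (L t c') = L s0⁻¹ (R (γ * h) ω - χ' • L l' c') := by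
      rw [hω1, ← hc, hR.mul, map_sub, map_smul, hL.mul, hL.mul, ht, mul_inv_cancel_left]
    rw [e1, hL.nrm]; exact hcl'
  have n1 : ‖R γ ω‖ ≤ 1 := by rw [hR.nrm, hω]
  have n2 : ‖R γ ω1‖ ≤ 1 := by rw [hR.nrm, hω1n]
  have hε : 0 ≤ m / 8 := by positivity
  have hp : ∀ a b : K, ‖(inner ℂ (χ • a) (χ' • b))‖ = ‖(inner ℂ (a) (b))‖ := by
    intro a b
    rw [inner_smul_left, inner_smul_right, norm_mul, norm_mul, RCLike.norm_conj, hχ, hχ']; simp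
  have htT : t ∈ T := by
    have h1 := inner_close hε hcl hd n1 n2
    have h2 := norm_sub_norm_le (inner ℂ (R γ ω) (R γ ω1)) (inner ℂ (χ • L l c) (χ' • L l (L t c')))
    rw [hR.inn, hp, hL.inn] at h2
    rw [hR.inn] at h1
    have h3 : k / 2 ≤ ‖(inner ℂ (L t c') (c))‖ := by
      rw [norm_inner_symm]
      linarith
    simp only [hT, Set.mem_iUnion]
    exact ⟨c, hcC, c', hcC', h3⟩
  have hcl2 : ‖R (γ * g * γ⁻¹) (R γ ω) - χ • L l (R (γ * g * γ⁻¹) c)‖ ≤ m / 8 := by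
    rw [hc, ← map_smul, ← map_sub, hR.nrm]; exact hcl
  have h1 := inner_close hε hcl2 hd (by rw [hR.nrm]; exact n1) n2
  have h2 := norm_sub_norm_le (inner ℂ (R (γ * g * γ⁻¹) (R γ ω)) (R γ ω1))
    (inner ℂ (χ • L l (R (γ * g * γ⁻¹) c)) (χ' • L l (L t c')))
  have h3 : (inner ℂ (R (γ * g * γ⁻¹) (R γ ω)) (R γ ω1)) = (inner ℂ (R g ω) (ω1)) := by
    rw [hR.mul, inv_mul_cancel_right, ← hR.mul, hR.inn]
  rw [hp, hL.inn, h3] at h2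
  rw [h3] at h1
  have h4 : η / 2 ≤ ‖(inner ℂ (R (γ * g * γ⁻¹) c) (L t c'))‖ := by linarith
  simp only [hS, Set.mem_iUnion]
  exact ⟨c, hcC, c', hcC', t, htT, h4⟩

/-- Lemma A -/
lemma lemmaA (hicc : IsICC Γ) (hL : URep Λ L) (hR : URep Γ R) (hc : ∀ s g x, L s (R g x) = R g (L s x))
    {e : K} (heL : Gen L e) (heR : Gen R e) {ω : K} (hω : ‖ω‖ = 1) (hP : PropP L R ω) :
    Gen R ω ∧ Gen L ω ∧ ∀ h, ∃ s, ∃ χ : ℂ, ‖χ‖ = 1 ∧ R h ω = χ • L s ω := by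
  have a3 : ∀ g, g ≠ 1 → (inner ℂ (R g ω) (ω)) = 0 := by
    intro g hg
    have := mainA hicc hL hR hc heL heR hω hP 1 1 (by
      rw [inv_one, hL.one, hR.one, inner_self_eq_norm_sq_to_K, hω]; simp) g hg
    rwa [inv_one, hL.one, hR.one] at this
  have gR := tot_of hL hR hc heL heR hω a3
  have gL := tot_of hR hL (fun g s x => (hc s g x).symm) heR heL hω
    (orthL_of hL hR hc heL heR gR)
  refine ⟨gR, gL, fun h => ?_⟩
  have : ∃ s, (inner ℂ (L s ω) (R h ω)) ≠ 0 := by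
    by_contra hcon
    push Not at hcon
    have h0 := gL.tot _ hcon
    have := hR.nrm h ω
    rw [h0, norm_zero, hω] at this
    exact zero_ne_one this
  obtain ⟨s, hs⟩ := this
  set ω1 := L s⁻¹ (R h ω) with hω1
  have hk : (inner ℂ (ω) (ω1)) ≠ 0 := by rwa [hω1, ← hL.adj]
  have hz : ω1 - (inner ℂ (ω) (ω1)) • ω = 0 := by
    refine gR.tot _ fun g => ?_
    rw [inner_sub_right, inner_smul_right]
    by_cases hg : g = 1
    · rw [hg, hR.one, inner_self_eq_norm_sq_to_K, hω]; simp
    · rw [mainA hicc hL hR hc heL heR hω hP h s hk g hg, a3 g hg]; simp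
  have h1 : R h ω = (inner ℂ (ω) (ω1)) • L s ω := by
    rw [← map_smul, ← sub_eq_zero.1 hz, hω1, hL.inv']
  refine ⟨s, (inner ℂ (ω) (ω1)), ?_, h1⟩
  have := congrArg norm h1
  rw [hR.nrm, norm_smul, hL.nrm, hω, mul_one] at this
  exact this.symm
end two
end hilb
end CDP
end

noncomputable section
open scoped Classical

namespace CDP
open CD Filter Topology

section ab
variable {H : Type} [NormedAddCommGroup H] [InnerProductSpace ℂ H] [CompleteSpace H]
variable {B : VonNeumannAlgebra H}

/-- nonzero projection in `B` -/
structure Pj (B : VonNeumannAlgebra H) (q : H →L[ℂ] H) : Prop where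
  mem : q ∈ B
  isP : IsP q
  ne : q ≠ 0

lemma Pj.norm {q : H →L[ℂ] H} (h : Pj B q) : ‖q‖ = 1 := by
  have h1 : ‖star q * q‖ = ‖q‖ * ‖q‖ := CStarRing.norm_star_mul_self
  rw [h.isP.1, h.isP.2] at h1
  have h0 : ‖q‖ ≠ 0 := norm_ne_zero_iff.2 h.ne
  field_simp at h1
  exact h1.symm

lemma cut_norm {q q' x : H →L[ℂ] H} (h : Pj B q') (hq : q' * q = q') : ‖q' * x‖ ≤ ‖q * x‖ := by
  rw [← hq, mul_assoc]
  refine (norm_mul_le _ _).trans ?_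
  rw [h.norm, one_mul]

lemma conj_le {a b : H →L[ℂ] H} (h : a ≤ b) {q : H →L[ℂ] H} (hq : star q = q) :
    q * a * q ≤ q * b * q := by
  have := star_left_conjugate_le_conjugate h q
  rwa [hq] at this

lemma smul_mono_proj {s t : ℝ} (h : s ≤ t) {q : H →L[ℂ] H} (hq : IsP q) :
    (s : ℂ) • q ≤ (t : ℂ) • q := by
  rw [← sub_nonneg, ← sub_smul, ← Complex.ofReal_sub]
  have := smul_nonneg (sub_nonneg.2 h) hq.nonneg
  exact_mod_cast this

lemma proj_le_one {q : H →L[ℂ] H} (hq : IsP q) : q ≤ 1 := by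
  rw [← sub_nonneg]; exact hq.one_sub.nonneg

lemma smul_proj_le {t : ℝ} (h : 0 ≤ t) {q : H →L[ℂ] H} (hq : IsP q) :
    (t : ℂ) • q ≤ (t : ℂ) • 1 := by
  rw [← sub_nonneg, ← smul_sub]
  have := smul_nonneg h hq.one_sub.nonneg
  exact_mod_cast this

/-- Lemma S -/
lemma lemS (hab : ∀ x ∈ B, ∀ y ∈ B, x * y = y * x) {a : H →L[ℂ] H} (ha : a ∈ B)
    (h : ∀ r, Pj B r → ∀ ε : ℝ, 0 < ε → ∃ q, Pj B q ∧ q * r = q ∧ ‖q * a‖ ≤ ε) : a = 0 := by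
  by_contra h0
  obtain ⟨e, he, k, hk, heP, he0, -, -, hke, -⟩ := specInv B ha h0
  obtain ⟨q, hq, hqe, hle⟩ := h e ⟨he, heP, he0⟩ (1 / (2 * (‖k‖ * ‖k‖ * ‖star a‖ + 1))) (by positivity)
  have h1 : q = k * k * star a * (q * a) := by
    calc q = q * (k * k * (star a * a)) := by rw [hke, hqe]
      _ = (k * k * star a * a) * q := by
        rw [hab q hq.mem _ (mul_mem (mul_mem hk hk) (mul_mem (star_mem ha) ha))]; simp only [mul_assoc]
      _ = k * k * star a * (q * a) := by rw [mul_assoc, hab a ha q hq.mem]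
  have h2 : ‖q‖ ≤ ‖k‖ * ‖k‖ * ‖star a‖ * ‖q * a‖ := by
    calc ‖q‖ = ‖k * k * star a * (q * a)‖ := by rw [← h1]
      _ ≤ ‖k * k * star a‖ * ‖q * a‖ := norm_mul_le _ _
      _ ≤ _ := by gcongr; exact (norm_mul_le _ _).trans (by gcongr; exact norm_mul_le _ _)
  rw [hq.norm] at h2
  have h3 : ‖k‖ * ‖k‖ * ‖star a‖ * ‖q * a‖ ≤ (‖k‖ * ‖k‖ * ‖star a‖ + 1) * (1 / (2 * (‖k‖ * ‖k‖ * ‖star a‖ + 1))) := by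
    gcongr; linarith
  have h4 : (‖k‖ * ‖k‖ * ‖star a‖ + 1) * (1 / (2 * (‖k‖ * ‖k‖ * ‖star a‖ + 1))) = 1 / 2 := by
    field_simp
  linarith

/-- spectral localisation, self-adjoint case -/
lemma lemS2sa (hab : ∀ x ∈ B, ∀ y ∈ B, x * y = y * x) {a r : H →L[ℂ] H} (ha : a ∈ B)
    (hsa : IsSelfAdjoint a) (hr : Pj B r) {ε : ℝ} (hε : 0 < ε) :
    ∃ q, Pj B q ∧ q * r = q ∧ ∃ t : ℝ, ‖q * (a - (t : ℂ) • 1)‖ ≤ ε := by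
  set m : ℝ := ‖a‖ + 1 with hm
  have hmB : a + (m : ℂ) • 1 ∈ B := add_mem ha (smul_mem_vN B _ (one_mem B))
  set b := r * (a + (m : ℂ) • 1) with hb
  have hbB : b ∈ B := mul_mem hr.mem hmB
  have hbr : b = r * (a + (m : ℂ) • 1) * r := by
    rw [mul_assoc, hab _ hmB r hr.mem, ← mul_assoc, hr.isP.2]
  have hmr : star (m : ℂ) = m := Complex.conj_ofReal m
  have hbsa : IsSelfAdjoint b := by
    rw [IsSelfAdjoint, hb, star_mul, star_add, hsa.star_eq, star_smul, star_one, hr.isP.1, hmr,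
      hab _ hmB r hr.mem]
  have hale : -((‖a‖ : ℂ) • (1 : H →L[ℂ] H)) ≤ a := by
    have := le_norm_smul (h := -a) hsa.neg
    rw [norm_neg] at this
    exact neg_le.1 this
  have hrb : r ≤ b := by
    rw [hbr]
    have : (1 : H →L[ℂ] H) ≤ a + (m : ℂ) • 1 := by
      have h1 : (1 : H →L[ℂ] H) = -((‖a‖ : ℂ) • (1 : H →L[ℂ] H)) + (m : ℂ) • 1 := by
        rw [hm]; push_cast; rw [add_smul, one_smul]; abel
      calc (1 : H →L[ℂ] H) = -((‖a‖ : ℂ) • (1 : H →L[ℂ] H)) + (m : ℂ) • 1 := h1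
        _ ≤ _ := by gcongr
    have := conj_le this hr.isP.1
    rwa [mul_one, hr.isP.2] at this
  have hb0 : 0 ≤ b := hr.isP.nonneg.trans hrb
  set t := ‖b‖ with ht
  have htpos : 0 < t := by
    rw [ht, norm_pos_iff]
    intro h
    rw [h] at hrb
    exact hr.ne (le_antisymm hrb hr.isP.nonneg)
  set ε' := min ε (t / 2) with hε'
  have hε'0 : 0 < ε' := lt_min hε (half_pos htpos)
  have hε't : ε' ≤ t / 2 := min_le_right _ _
  obtain ⟨p, hpB, hp, -, hp1, hp2⟩ := specProj' B hbsa hbB (t - ε')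
  have hpr := hab p hpB r hr.mem
  have hqP : IsP (p * r) := by
    refine ⟨by rw [star_mul, hp.1, hr.isP.1, hpr], ?_⟩
    calc p * r * (p * r) = p * (r * p) * r := by simp only [mul_assoc]
      _ = p * p * (r * r) := by rw [← hpr]; simp only [mul_assoc]
      _ = _ := by rw [hp.2, hr.isP.2]
  have hqr : p * r * r = p * r := by rw [mul_assoc, hr.isP.2]
  have hqb : p * r * b = p * r * (a + (m : ℂ) • 1) := by
    rw [hb, ← mul_assoc, hqr]
  have hq0 : p * r ≠ 0 := by
    intro h0
    have hbp : b * p = 0 := by rw [hab b hbB p hpB, hb, ← mul_assoc, h0, zero_mul]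
    rw [mul_sub, hbp, mul_one, sub_zero] at hp2
    have := norm_le_of_le hb0 (t := t - ε') (by linarith) (hp2.trans (smul_proj_le (by linarith) hp.one_sub))
    linarith
  refine ⟨p * r, ⟨mul_mem hpB hr.mem, hqP, hq0⟩, hqr, t - m, ?_⟩
  -- sandwich
  set q := p * r with hq
  have hqB : q ∈ B := mul_mem hpB hr.mem
  have e1 : q * (a - ((t - m : ℝ) : ℂ) • 1) = -(q * ((t : ℂ) • 1 - b) * q) := by
    have : q * ((t : ℂ) • 1 - b) * q = q * ((t : ℂ) • 1 - b) := by
      rw [hab _ (mul_mem hqB (sub_mem (smul_mem_vN B _ (one_mem B)) hbB)) q hqB, ← mul_assoc, hqP.2]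
    rw [this, mul_sub q _ b, hqb]
    push_cast
    simp only [mul_sub, mul_add, sub_smul]
    abel
  rw [e1, norm_neg]
  have hge : 0 ≤ q * ((t : ℂ) • 1 - b) * q := by
    have : 0 ≤ (t : ℂ) • (1 : H →L[ℂ] H) - b := sub_nonneg.2 (le_norm_smul hbsa)
    have := conj_le this hqP.1
    rwa [mul_zero, zero_mul] at this
  have hle : q * ((t : ℂ) • 1 - b) * q ≤ (ε' : ℂ) • q := by
    have h1 := conj_le hp1 hqP.1
    have hpq : p * q = q := by rw [hq, ← mul_assoc, hp.2]
    have h2 : q * (((t - ε' : ℝ) : ℂ) • p) * q = ((t - ε' : ℝ) : ℂ) • q := by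
      rw [mul_smul_comm, smul_mul_assoc, mul_assoc, hpq, hqP.2]
    have h3 : q * (b * p) * q = q * b * q := by
      simp only [mul_assoc]; rw [hpq]
    rw [h2, h3] at h1
    rw [mul_sub, sub_mul, mul_smul_comm, mul_one, smul_mul_assoc, hqP.2, sub_le_iff_le_add]
    calc (t : ℂ) • q = (ε' : ℂ) • q + ((t - ε' : ℝ) : ℂ) • q := by
          rw [← add_smul]; congr 1; push_cast; ring
      _ ≤ _ := by gcongr
  exact (norm_le_of_le hge hε'0.le (hle.trans (smul_proj_le hε'0.le hqP))).trans (min_le_left _ _)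

/-- Lemma S'' -/
lemma lemS2 (hab : ∀ x ∈ B, ∀ y ∈ B, x * y = y * x) {a r : H →L[ℂ] H} (ha : a ∈ B)
    (hr : Pj B r) {ε : ℝ} (hε : 0 < ε) :
    ∃ q, Pj B q ∧ q * r = q ∧ ∃ χ : ℂ, ‖q * (a - χ • 1)‖ ≤ ε := by
  have h1 : (realPart a : H →L[ℂ] H) ∈ B := by
    rw [realPart_apply_coe]
    have := smul_mem_vN B ((2⁻¹ : ℝ) : ℂ) (add_mem ha (star_mem ha))
    exact_mod_cast this
  have h2 : (imaginaryPart a : H →L[ℂ] H) ∈ B := by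
    rw [imaginaryPart_apply_coe]
    have := smul_mem_vN B (-Complex.I) (smul_mem_vN B ((2⁻¹ : ℝ) : ℂ) (sub_mem ha (star_mem ha)))
    exact_mod_cast this
  obtain ⟨q1, hq1, hq1r, t1, ht1⟩ := lemS2sa hab h1 (realPart a).2 hr (half_pos hε)
  obtain ⟨q2, hq2, hq2r, t2, ht2⟩ := lemS2sa hab h2 (imaginaryPart a).2 hq1 (half_pos hε)
  refine ⟨q2, hq2, by rw [← hq2r, mul_assoc, hq1r], t1 + Complex.I * t2, ?_⟩
  have e : q2 * (a - ((t1 : ℂ) + Complex.I * t2) • 1) = q2 * ((realPart a : H →L[ℂ] H) - (t1 : ℂ) • 1)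
      + Complex.I • (q2 * ((imaginaryPart a : H →L[ℂ] H) - (t2 : ℂ) • 1)) := by
    conv_lhs => rw [← realPart_add_I_smul_imaginaryPart a]
    rw [← mul_smul_comm, ← mul_add, smul_sub, smul_smul, add_smul]
    congr 1; abel
  rw [e]
  refine (norm_add_le _ _).trans ?_
  rw [norm_smul, Complex.norm_I, one_mul]
  have := (cut_norm hq2 hq2r (x := (realPart a : H →L[ℂ] H) - (t1 : ℂ) • 1)).trans ht1
  linarith

/-- simultaneous localisation -/
lemma lemS2fin (hab : ∀ x ∈ B, ∀ y ∈ B, x * y = y * x) {ι : Type} (F : Finset ι)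
    (a : ι → H →L[ℂ] H) (ha : ∀ i, a i ∈ B) {r : H →L[ℂ] H}
    (hr : Pj B r) {ε : ℝ} (hε : 0 < ε) :
    ∃ q, Pj B q ∧ q * r = q ∧ ∃ χ : ι → ℂ, ∀ i ∈ F, ‖q * (a i - χ i • 1)‖ ≤ ε := by
  induction F using Finset.induction_on with
  | empty => exact ⟨r, hr, hr.isP.2, 0, by simp⟩
  | insert j F hj ih =>
    obtain ⟨q, hq, hqr, χ, hχ⟩ := ih
    obtain ⟨q', hq', hqr', χ', hχ'⟩ := lemS2 hab (ha j) hq hε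
    refine ⟨q', hq', by rw [← hqr', mul_assoc, hqr], Function.update χ j χ', ?_⟩
    intro i hi
    by_cases hij : i = j
    · subst hij; simpa using hχ'
    · rw [Function.update_of_ne hij]
      exact (cut_norm hq' hqr').trans (hχ i ((Finset.mem_insert.1 hi).resolve_left hij))

/-- uniform cut for a chain -/
lemma lemCut (hab : ∀ x ∈ B, ∀ y ∈ B, x * y = y * x) (S : ℕ → H →L[ℂ] H) (hS : ∀ n, S n ∈ B)
    (hmono : Monotone S) (h0 : ∀ n, 0 ≤ S n) (h1 : ∀ n, S n ≤ 1) {r : H →L[ℂ] H} (hr : Pj B r)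
    {ε : ℝ} (hε : 0 < ε) :
    ∃ q, Pj B q ∧ q * r = q ∧ ∃ n, ∀ m, n ≤ m → q * (S m - S n) * q ≤ (ε : ℂ) • 1 := by
  obtain ⟨T, hT, hT0, -, hle, hlub⟩ := chain_sup (N := B) (C := Set.range S) ⟨_, ⟨0, rfl⟩⟩
    (by rintro _ ⟨n, rfl⟩ _ ⟨m, rfl⟩ _
        rcases le_total n m with h | h
        · exact Or.inl (hmono h)
        · exact Or.inr (hmono h))
    (by rintro _ ⟨n, rfl⟩; exact h0 n) (by rintro _ ⟨n, rfl⟩; exact h1 n)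
    (by rintro _ ⟨n, rfl⟩; exact hS n)
  have hsa : ∀ n, IsSelfAdjoint (T - S n) := fun n =>
    (IsSelfAdjoint.of_nonneg hT0).sub (IsSelfAdjoint.of_nonneg (h0 n))
  choose p hpB hp hpc hp1 hp2 using fun n => specProj' B (hsa n) (sub_mem hT (hS n)) ε
  by_cases hex : ∃ n, r * (1 - p n) ≠ 0
  · obtain ⟨n, hn⟩ := hex
    have hp' := (hp n).one_sub
    have hpm : 1 - p n ∈ B := sub_mem (one_mem B) (hpB n)
    have hcomm := hab r hr.mem _ hpm
    have hqP : IsP (r * (1 - p n)) := by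
      refine ⟨by rw [star_mul, hp'.1, hr.isP.1, hcomm], ?_⟩
      calc r * (1 - p n) * (r * (1 - p n)) = r * ((1 - p n) * r) * (1 - p n) := by simp only [mul_assoc]
        _ = r * r * ((1 - p n) * (1 - p n)) := by rw [← hcomm]; simp only [mul_assoc]
        _ = _ := by rw [hp'.2, hr.isP.2]
    set q := r * (1 - p n) with hq
    have hqq : (1 - p n) * q = q := by rw [hcomm, ← mul_assoc, hp'.2]
    refine ⟨q, ⟨mul_mem hr.mem hpm, hqP, hn⟩, by rw [hcomm, mul_assoc, hr.isP.2],
      n, fun m _ => ?_⟩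
    have h3 := conj_le (hp2 n) hqP.1
    have e1 : q * ((T - S n) * (1 - p n)) * q = q * (T - S n) * q := by
      simp only [mul_assoc]; rw [hqq]
    have e2 : q * ((ε : ℂ) • (1 - p n)) * q = (ε : ℂ) • q := by
      rw [mul_smul_comm, smul_mul_assoc, mul_assoc, hqq, hqP.2]
    rw [e1, e2] at h3
    have h4 : S m - S n ≤ T - S n := sub_le_sub_right (hle _ ⟨m, rfl⟩) _
    exact (conj_le h4 hqP.1).trans (h3.trans (smul_proj_le hε.le hqP))
  · exfalso
    push Not at hex
    have hrp : ∀ n, p n * r = r := by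
      intro n
      have := hex n
      rw [mul_sub, mul_one, sub_eq_zero] at this
      rw [hab _ (hpB n) r hr.mem, ← this]
    apply hr.ne
    ext ξ
    have key : ∀ n, (inner ℂ ((S n) (r ξ)) (r ξ)).re ≤ (inner ℂ (T (r ξ)) (r ξ)).re - ε * ‖r ξ‖ ^ 2 := by
      intro n
      have h3 := re_inner_mono (hp1 n) (r ξ)
      have e1 : ((T - S n) * p n) (r ξ) = T (r ξ) - S n (r ξ) := by
        have : p n (r ξ) = r ξ := by
          change (p n * r) ξ = _; rw [hrp]
        change (T - S n) (p n (r ξ)) = _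
        rw [this]; rfl
      have e2 : ((ε : ℂ) • p n) (r ξ) = (ε : ℂ) • r ξ := by
        change (ε : ℂ) • (p n * r) ξ = _; rw [hrp]
      rw [e1, e2, inner_sub_left, inner_smul_left, Complex.sub_re, Complex.conj_ofReal,
        inner_self_eq_norm_sq_to_K] at h3
      have e3 : ((ε : ℂ) * ((‖r ξ‖ : ℝ) : ℂ) ^ 2).re = ε * ‖r ξ‖ ^ 2 := by norm_cast
      erw [e3] at h3
      linarith
    have := hlub (r ξ) _ (by rintro _ ⟨n, rfl⟩; exact key n)
    have h5 : ε * ‖r ξ‖ ^ 2 ≤ 0 := by linarith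
    have h6 : ‖r ξ‖ ^ 2 ≤ 0 := by
      by_contra hcon
      push Not at hcon
      have := mul_pos hε hcon
      linarith
    have h7 : ‖r ξ‖ = 0 := by
      have := sq_nonneg ‖r ξ‖
      exact pow_eq_zero_iff (two_ne_zero) |>.1 (le_antisymm h6 this)
    simpa using h7

/-- Lemma N -/
lemma lemN {N : VonNeumannAlgebra H} (tr : TraceOn H (N : Set (H →L[ℂ] H))) (hBN : ∀ a ∈ B, a ∈ N)
    {f : H →L[ℂ] H} (hf : f ∈ B) {C : ℝ} (hC : 0 ≤ C)
    (h : ∀ b ∈ B, nsq tr (f * b) ≤ C ^ 2 * nsq tr b) : ‖f‖ ≤ C := by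
  by_contra hcon
  push Not at hcon
  have hsa : IsSelfAdjoint (star f * f) := IsSelfAdjoint.star_mul_self f
  have hn : ‖star f * f‖ = ‖f‖ * ‖f‖ := CStarRing.norm_star_mul_self
  have hlt : C ^ 2 < ‖star f * f‖ := by rw [hn]; nlinarith
  obtain ⟨t, ht1, ht2⟩ := exists_between hlt
  have ht0 : 0 ≤ t := (sq_nonneg C).trans ht1.le
  have hm : star f * f ∈ B := mul_mem (star_mem hf) hf
  obtain ⟨p, hpB, hp, hpc, hp1, hp2⟩ := specProj' B hsa hm t
  have hp0 : p ≠ 0 := by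
    intro h0
    rw [h0, sub_zero, mul_one] at hp2
    have := norm_le_of_le (star_mul_self_nonneg f) ht0 hp2
    linarith
  have hpN := hBN p hpB
  have h1 := tau_mono tr (smul_mem_vN N _ hpN) (mul_mem (hBN _ hm) hpN) hp1
  have h2 := h p hpB
  have h3 : nsq tr (f * p) = (tr.τ (star f * f * p)).re := by
    unfold nsq
    have : star (f * p) * (f * p) = p * (star f * f * p) := by
      rw [star_mul, hp.1]; simp only [mul_assoc]
    rw [this, tr.tracial p hpN _ (mul_mem (hBN _ hm) hpN), mul_assoc, hp.2]
  rw [h3, nsq_proj tr hp] at h2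
  have h4 : (tr.τ ((t : ℂ) • p)).re = t * (tr.τ p).re := by
    rw [map_smul, smul_eq_mul, Complex.re_ofReal_mul]
  rw [h4] at h1
  have h5 : 0 < (tr.τ p).re := by
    rw [← nsq_proj tr hp]
    refine lt_of_le_of_ne (nsq_nonneg tr hpN) fun h => hp0 (nsq_zero tr hpN h.symm)
  nlinarith
end ab
end CDP
end

noncomputable section
open scoped Classical

namespace CDP
open CD Filter Topology

section hil
variable {H : Type} [NormedAddCommGroup H] [InnerProductSpace ℂ H] [CompleteSpace H]
variable {Λ : Type} [Group Λ] (Y : CrossedProduct Λ H)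

/-- the group von Neumann algebra as a pre-Hilbert space -/
def LD : Type := ↥(Y.Lg.toStarSubalgebra.toSubalgebra.toSubmodule)

instance : AddCommGroup (LD Y) :=
  inferInstanceAs (AddCommGroup ↥(Y.Lg.toStarSubalgebra.toSubalgebra.toSubmodule))
instance : Module ℂ (LD Y) :=
  inferInstanceAs (Module ℂ ↥(Y.Lg.toStarSubalgebra.toSubalgebra.toSubmodule))

/-- underlying operator -/
def LD.op : LD Y →ₗ[ℂ] (H →L[ℂ] H) := Submodule.subtype _

lemma LD.mem (x : LD Y) : LD.op Y x ∈ Y.Lg := x.2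
lemma LD.memM (x : LD Y) : LD.op Y x ∈ Y.M := LM Y x.2

/-- make an element -/
def LD.mk {x : H →L[ℂ] H} (hx : x ∈ Y.Lg) : LD Y := ⟨x, hx⟩

@[simp] lemma LD.op_mk {x : H →L[ℂ] H} (hx : x ∈ Y.Lg) : LD.op Y (LD.mk Y hx) = x := rfl
@[simp] lemma LD.mk_op (x : LD Y) : LD.mk Y (LD.mem Y x) = x := rfl

lemma LD.op_inj {x y : LD Y} (h : LD.op Y x = LD.op Y y) : x = y := Subtype.ext h

/-- inner product -/
def LDcore : InnerProductSpace.Core ℂ (LD Y) where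
  inner x y := Y.tr.τ (star (LD.op Y x) * LD.op Y y)
  conj_inner_symm x y := by
    rw [← Y.tr.star_eq _ (mul_mem (star_mem (LD.memM Y y)) (LD.memM Y x)), star_mul, star_star]
  re_inner_nonneg x := (Y.tr.nonneg _ (LD.memM Y x)).1
  add_left x y z := by simp [add_mul]
  smul_left x y r := by simp
  definite x h := LD.op_inj Y (by rw [map_zero]; exact Y.tr.faithful _ (LD.memM Y x) h)

instance : NormedAddCommGroup (LD Y) := (LDcore Y).toNormedAddCommGroup
instance : InnerProductSpace ℂ (LD Y) := InnerProductSpace.ofCore (LDcore Y).toCore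

lemma LD.inner_eq (x y : LD Y) : inner ℂ x y = Y.tr.τ (star (LD.op Y x) * LD.op Y y) := rfl

lemma LD.norm_sq (x : LD Y) : ‖x‖ ^ 2 = nsq Y.tr (LD.op Y x) := by
  have := inner_self_eq_norm_sq (𝕜 := ℂ) x
  rw [← this]; rfl

/-- completion -/
abbrev KK : Type := UniformSpace.Completion (LD Y)

/-- the vector of an operator -/
def hat {x : H →L[ℂ] H} (hx : x ∈ Y.Lg) : KK Y := ((LD.mk Y hx : LD Y) : KK Y)

lemma inner_hat {x y : H →L[ℂ] H} (hx : x ∈ Y.Lg) (hy : y ∈ Y.Lg) :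
    inner ℂ (hat Y hx) (hat Y hy) = Y.tr.τ (star x * y) := by
  rw [hat, hat, UniformSpace.Completion.inner_coe]; rfl

lemma norm_hat {x : H →L[ℂ] H} (hx : x ∈ Y.Lg) : ‖hat Y hx‖ ^ 2 = nsq Y.tr x := by
  rw [hat, UniformSpace.Completion.norm_coe, LD.norm_sq]; rfl

lemma hat_add {x y : H →L[ℂ] H} (hx : x ∈ Y.Lg) (hy : y ∈ Y.Lg) :
    hat Y (add_mem hx hy) = hat Y hx + hat Y hy := by
  rw [hat, hat, hat, ← UniformSpace.Completion.coe_add]; rfl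

lemma hat_sub {x y : H →L[ℂ] H} (hx : x ∈ Y.Lg) (hy : y ∈ Y.Lg) :
    hat Y (sub_mem hx hy) = hat Y hx - hat Y hy := by
  rw [hat, hat, hat, ← UniformSpace.Completion.coe_sub]; rfl

lemma hat_smul {x : H →L[ℂ] H} (hx : x ∈ Y.Lg) (c : ℂ) :
    hat Y (smul_mem_vN Y.Lg c hx) = c • hat Y hx := by
  rw [hat, hat, ← UniformSpace.Completion.coe_smul]; rfl

lemma hat_congr {x y : H →L[ℂ] H} (hx : x ∈ Y.Lg) (hy : y ∈ Y.Lg) (h : x = y) :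
    hat Y hx = hat Y hy := by subst h; rfl

lemma hat_inj {x y : H →L[ℂ] H} (hx : x ∈ Y.Lg) (hy : y ∈ Y.Lg) (h : hat Y hx = hat Y hy) : x = y := by
  have : LD.mk Y hx = LD.mk Y hy := UniformSpace.Completion.coe_injective _ h
  exact congrArg (LD.op Y) this

lemma KK.ind {p : KK Y → Prop} (hp : IsClosed {x | p x}) (h : ∀ x (hx : x ∈ Y.Lg), p (hat Y hx)) (x : KK Y) :
    p x :=
  UniformSpace.Completion.induction_on x hp fun a => h _ (LD.mem Y a)

lemma KK.orth_zero {y : KK Y} (h : ∀ x (hx : x ∈ Y.Lg), inner ℂ (hat Y hx) y = 0) : y = 0 := by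
  have : ∀ z : KK Y, inner ℂ z y = 0 :=
    KK.ind Y (isClosed_eq (by fun_prop) continuous_const) h
  exact inner_self_eq_zero.1 (this y)

/-- two sided multiplication -/
def biL {a b : H →L[ℂ] H} (ha : a ∈ Y.Lg) (hb : b ∈ Y.Lg) : LD Y →ₗ[ℂ] LD Y where
  toFun x := LD.mk Y (mul_mem (mul_mem ha (LD.mem Y x)) hb)
  map_add' x y := LD.op_inj Y (by simp [mul_add, add_mul])
  map_smul' c x := LD.op_inj Y (by simp)

/-- two sided multiplication -/
def bi {a b : H →L[ℂ] H} (ha : a ∈ Y.Lg) (hb : b ∈ Y.Lg) : KK Y →L[ℂ] KK Y :=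
  ((biL Y ha hb).mkContinuous (‖a‖ * ‖b‖) (fun x => by
    have h1 : ‖biL Y ha hb x‖ ^ 2 ≤ (‖a‖ * ‖b‖ * ‖x‖) ^ 2 := by
      rw [LD.norm_sq, mul_pow, LD.norm_sq, mul_pow]
      change nsq Y.tr (a * LD.op Y x * b) ≤ _
      have e1 := nsq_mul_right_le Y.tr (mul_mem (LM Y ha) (LD.memM Y x)) (LM Y hb)
      have e2 := nsq_mul_left_le Y.tr (LD.memM Y x) (LM Y ha)
      nlinarith [mul_le_mul_of_nonneg_left e2 (sq_nonneg ‖b‖)]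
    exact le_of_sq_le_sq h1 (by positivity))).completion

lemma bi_hat {a b x : H →L[ℂ] H} (ha : a ∈ Y.Lg) (hb : b ∈ Y.Lg) (hx : x ∈ Y.Lg) :
    bi Y ha hb (hat Y hx) = hat Y (mul_mem (mul_mem ha hx) hb) := by
  rw [bi, hat, ContinuousLinearMap.completion_apply_coe]; rfl

lemma bi_norm {a b : H →L[ℂ] H} (ha : a ∈ Y.Lg) (hb : b ∈ Y.Lg) (h1 : star a * a = 1)
    (h2 : b * star b = 1) (x : KK Y) : ‖bi Y ha hb x‖ = ‖x‖ := by
  induction x using KK.ind with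
  | hp => exact isClosed_eq (by fun_prop) (by fun_prop)
  | h x hx =>
    have : ‖bi Y ha hb (hat Y hx)‖ ^ 2 = ‖hat Y hx‖ ^ 2 := by
      rw [bi_hat, norm_hat, norm_hat, nsq, nsq]
      congr 1
      have e : star (a * x * b) * (a * x * b) = (star b * (star x * x)) * b := by
        calc _ = star b * (star x * (star a * a) * x) * b := by simp only [star_mul, mul_assoc]
          _ = _ := by rw [h1, mul_one]
      rw [e, Y.tr.tracial _ (mul_mem (star_mem (LM Y hb)) (mul_mem (star_mem (LM Y hx)) (LM Y hx))) _ (LM Y hb),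
        ← mul_assoc, h2, one_mul]
    exact (sq_eq_sq₀ (norm_nonneg _) (norm_nonneg _)).1 this

end hil
end CDP
end

noncomputable section
open scoped Classical

namespace CDP
open CD Filter Topology

section su
variable {H : Type} [NormedAddCommGroup H] [InnerProductSpace ℂ H] [CompleteSpace H]
variable {Λ : Type} [Group Λ] {Y : CrossedProduct Λ H} {Γ : Type} [Group Γ]

/-- the setup on the target side -/
structure Setup (Y : CrossedProduct Λ H) (g : Γ → H →L[ℂ] H) (w : H →L[ℂ] H) : Prop where
  hab : IsAbelianSet (Y.A : Set (H →L[ℂ] H))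
  hfree : IsFree Y
  hfac : IsFactorSet (Y.M : Set (H →L[ℂ] H))
  wM : w ∈ Y.M
  ws : star w * w = 1
  ws' : w * star w = 1
  gN : ∀ γ, Nrm Y (g γ)
  g_one : g 1 = 1
  g_mul : ∀ γ δ, g γ * g δ = g (γ * δ)
  g_star : ∀ γ, star (g γ) = g γ⁻¹
  g2 : ∀ γ, γ ≠ 1 → ∀ a ∈ Y.A, (∀ b ∈ Y.A, g γ * b * star (g γ) * a = a * b) → a = 0
  g3 : ∀ a ∈ Y.A, (∀ γ, g γ * a * star (g γ) = a) → ∃ c : ℂ, a = c • (1 : H →L[ℂ] H)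
  yL : ∀ γ, star w * g γ * w ∈ Y.Lg
  yD : ∀ l ∈ Y.Lg, ∀ ε : ℝ, 0 < ε →
    ∃ a ∈ Submodule.span ℂ (Set.range fun γ => star w * g γ * w), nsq Y.tr (l - a) < ε

lemma one_ne (Y : CrossedProduct Λ H) : (1 : H →L[ℂ] H) ≠ 0 := by
  intro h
  have := Y.tr.unital
  rw [h, map_zero] at this
  exact zero_ne_one this

/-- conjugation -/
def cj (g a : H →L[ℂ] H) : H →L[ℂ] H := g * a * star g

lemma cj_mul {k : H →L[ℂ] H} (hk : star k * k = 1) (a b : H →L[ℂ] H) : cj k a * cj k b = cj k (a * b) := by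
  unfold cj
  calc _ = k * a * (star k * k) * b * star k := by simp only [mul_assoc]
    _ = _ := by rw [hk, mul_one]; simp only [mul_assoc]

lemma cj_star (k a : H →L[ℂ] H) : star (cj k a) = cj k (star a) := by
  simp only [cj, star_mul, star_star, mul_assoc]

lemma cj_sub (k a b : H →L[ℂ] H) : cj k (a - b) = cj k a - cj k b := by
  simp only [cj, mul_sub, sub_mul]

lemma cj_smul (k a : H →L[ℂ] H) (c : ℂ) : cj k (c • a) = c • cj k a := by
  simp [cj]

lemma cj_one {k : H →L[ℂ] H} (hk : k * star k = 1) : cj k 1 = 1 := by simp [cj, hk]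

lemma cj_cj (k l a : H →L[ℂ] H) : cj k (cj l a) = cj (k * l) a := by
  simp only [cj, star_mul, mul_assoc]

lemma cj_inv {k : H →L[ℂ] H} (hk : star k * k = 1) (a : H →L[ℂ] H) : cj (star k) (cj k a) = a := by
  rw [cj_cj, hk]; simp [cj]

lemma cj_inv' {k : H →L[ℂ] H} (hk : k * star k = 1) (a : H →L[ℂ] H) : cj k (cj (star k) a) = a := by
  rw [cj_cj, hk]; simp [cj]

lemma norm_unitary_le {k : H →L[ℂ] H} (hk : star k * k = 1) : ‖k‖ ≤ 1 := by
  have h1 : ‖star k * k‖ = ‖k‖ * ‖k‖ := CStarRing.norm_star_mul_self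
  rw [hk] at h1
  have h2 : ‖(1 : H →L[ℂ] H)‖ ≤ 1 := ContinuousLinearMap.norm_id_le
  nlinarith [norm_nonneg k]

lemma cj_norm {k : H →L[ℂ] H} (hk : star k * k = 1) (a : H →L[ℂ] H) : ‖cj k a‖ = ‖a‖ := by
  have h1 := norm_unitary_le hk
  have hs : ‖star k‖ ≤ 1 := by rwa [norm_star]
  have key : ∀ (l b : H →L[ℂ] H), ‖l‖ ≤ 1 → ‖cj l b‖ ≤ ‖b‖ := by
    intro l b hl
    have h2 : ‖star l‖ ≤ 1 := by rwa [norm_star]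
    calc ‖l * b * star l‖ ≤ ‖l‖ * ‖b‖ * ‖star l‖ := (norm_mul_le _ _).trans (by gcongr; exact norm_mul_le _ _)
      _ ≤ 1 * ‖b‖ * 1 := by gcongr
      _ = _ := by ring
  refine le_antisymm (key _ _ h1) ?_
  have := key (star k) (cj k a) hs
  rwa [cj_inv hk] at this

lemma Nrm.cj_mem {k a : H →L[ℂ] H} (h : Nrm Y k) (ha : a ∈ Y.A) : cj k a ∈ Y.A := h.nm a ha

lemma Nrm.pj {k q : H →L[ℂ] H} (h : Nrm Y k) (hq : Pj Y.A q) : Pj Y.A (cj k q) := by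
  refine ⟨h.cj_mem hq.mem, ⟨by rw [cj_star, hq.isP.1], by rw [cj_mul h.ss, hq.isP.2]⟩, fun h0 => hq.ne ?_⟩
  rw [← cj_inv h.ss q, h0]; simp [cj]

lemma Nrm.tau {k a : H →L[ℂ] H} (h : Nrm Y k) (ha : a ∈ Y.M) : Y.tr.τ (cj k a) = Y.tr.τ a := by
  rw [cj, Y.tr.tracial _ (mul_mem h.mem ha) _ (star_mem h.mem), ← mul_assoc, h.ss, one_mul]

section S
variable {g : Γ → H →L[ℂ] H} {w : H →L[ℂ] H}

lemma Setup.tau_g (S : Setup Y g w) {γ : Γ} (h : γ ≠ 1) : Y.tr.τ (g γ) = 0 := by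
  have h0 : co Y (g γ) 1 = 0 := by
    refine S.g2 γ h _ (co_mem Y (S.gN γ).mem 1) fun b hb => ?_
    have := co_rel Y (S.gN γ) 1 hb
    rw [Y.u_one, star_one, one_mul, mul_one] at this
    exact this.symm
  rw [co, Y.u_one, star_one, mul_one] at h0
  rw [← Y.EA.trace_eq _ (S.gN γ).mem, h0, map_zero]

lemma Setup.y_mul (S : Setup Y g w) (γ δ : Γ) : (star w * g γ * w) * (star w * g δ * w) = star w * g (γ * δ) * w := by
  calc _ = star w * g γ * (w * star w) * g δ * w := by simp only [mul_assoc]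
    _ = star w * (g γ * g δ) * w := by rw [S.ws', mul_one]; simp only [mul_assoc]
    _ = _ := by rw [S.g_mul]

lemma Setup.y_one (S : Setup Y g w) : star w * g 1 * w = 1 := by rw [S.g_one, mul_one, S.ws]

lemma Setup.y_star (S : Setup Y g w) (γ : Γ) : star (star w * g γ * w) = star w * g γ⁻¹ * w := by
  simp only [star_mul, star_star, mul_assoc, S.g_star]

lemma Setup.y_tau (S : Setup Y g w) {γ : Γ} (h : γ ≠ 1) : Y.tr.τ (star w * g γ * w) = 0 := by
  rw [mul_assoc, Y.tr.tracial _ (star_mem S.wM) _ (mul_mem (S.gN γ).mem S.wM), mul_assoc, S.ws', mul_one, S.tau_g h]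

lemma Setup.y_ss' (S : Setup Y g w) (γ : Γ) : (star w * g γ * w) * star (star w * g γ * w) = 1 := by
  rw [S.y_star, S.y_mul, mul_inv_cancel, S.y_one]

/-- ergodicity -/
lemma Setup.erg (S : Setup Y g w) {q r : H →L[ℂ] H} (hq : Pj Y.A q) (hr : Pj Y.A r) : ∃ γ, cj (g γ) q * r ≠ 0 := by
  by_contra hcon
  push Not at hcon
  obtain ⟨P, hP, h1, h2⟩ := rangeProj (Set.range fun γ => cj (g γ) q)
  have hmem : ∀ γ, cj (g γ) q ∈ Y.A := fun γ => (S.gN γ).cj_mem hq.mem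
  have hPA : P ∈ Y.A := by
    refine mem_of_comm _ _ fun T hT => rangeProj_comm hP h2 T ?_ ?_
    · rintro _ ⟨γ, rfl⟩
      have e := comm_of_mem (hmem γ) hT
      have := h1 _ ⟨γ, rfl⟩
      simp only at this e ⊢
      rw [e, ← mul_assoc, this]
    · rintro _ ⟨γ, rfl⟩
      have e := comm_of_mem (hmem γ) (star_mem hT)
      have := h1 _ ⟨γ, rfl⟩
      simp only at this e ⊢
      rw [e, ← mul_assoc, this]
  have hg : ∀ δ, ∀ s ∈ Set.range (fun γ => cj (g γ) q), P * (g δ * s) = g δ * s := by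
    rintro δ _ ⟨γ, rfl⟩
    have e : g δ * cj (g γ) q = cj (g (δ * γ)) q * g δ := by
      rw [← S.g_mul, ← cj_cj]
      generalize cj (g γ) q = z
      rw [cj, mul_assoc (g δ * _), (S.gN δ).ss, mul_one]
    have := h1 _ ⟨δ * γ, rfl⟩
    simp only at this ⊢
    rw [e, ← mul_assoc, this]
  obtain ⟨c, hc⟩ := S.g3 P hPA fun δ => by
    rw [rangeProj_comm hP h2 (g δ) (hg δ) (by rw [S.g_star]; exact hg _), mul_assoc, (S.gN δ).ss', mul_one]
  have hq1 : c • q = q := by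
    have := h1 _ ⟨1, rfl⟩
    simp only [cj, S.g_one, one_mul, star_one, mul_one, hc, smul_mul_assoc] at this
    exact this
  have hc1 : c = 1 := by
    have : (c - 1) • q = 0 := by rw [sub_smul, hq1, one_smul, sub_self]
    rcases smul_eq_zero.1 this with h | h
    · exact sub_eq_zero.1 h
    · exact absurd h hq.ne
  have : r * P = 0 := h2 r (by
    rintro _ ⟨γ, rfl⟩
    rw [S.hab r hr.mem _ (hmem γ)]; exact hcon γ)
  rw [hc, hc1, one_smul, mul_one] at this
  exact hr.ne this

/-- finite covering -/
lemma Setup.fin (S : Setup Y g w) {q : H →L[ℂ] H} (hq : Pj Y.A q) :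
    ∃ T : Finset Γ, ∀ γ, ∃ i ∈ T, cj (g γ) q * cj (g i) q ≠ 0 := by
  have hmem : ∀ γ, cj (g γ) q ∈ Y.A := fun γ => (S.gN γ).cj_mem hq.mem
  have hpj : ∀ γ, Pj Y.A (cj (g γ) q) := fun γ => (S.gN γ).pj hq
  have ht : 0 < (Y.tr.τ q).re := by
    rw [← nsq_proj Y.tr hq.isP]
    exact lt_of_le_of_ne (nsq_nonneg Y.tr (AM Y hq.mem)) fun h => hq.ne (nsq_zero Y.tr (AM Y hq.mem) h.symm)
  have hbound : ∀ T : Finset Γ, (∀ i ∈ T, ∀ j ∈ T, i ≠ j → cj (g i) q * cj (g j) q = 0) →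
      (T.card : ℝ) * (Y.tr.τ q).re ≤ 1 := by
    intro T hT
    have hs : (∑ i ∈ T, cj (g i) q) ∈ Y.A := sum_mem fun i _ => hmem i
    have hsP : IsP (∑ i ∈ T, cj (g i) q) := by
      refine ⟨by rw [star_sum]; exact Finset.sum_congr rfl fun i _ => (hpj i).isP.1, ?_⟩
      rw [Finset.sum_mul]
      refine Finset.sum_congr rfl fun i hi => ?_
      rw [Finset.mul_sum, Finset.sum_eq_single_of_mem i hi fun j hj hji => hT i hi j hj hji.symm]
      exact (hpj i).isP.2
    have := tau_mono Y.tr (AM Y hs) (one_mem _) (proj_le_one hsP)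
    rw [map_sum, Y.tr.unital, Finset.sum_congr rfl fun i _ => (S.gN i).tau (AM Y hq.mem)] at this
    simpa using this
  by_contra hcon
  push Not at hcon
  have : ∀ n : ℕ, ∃ T : Finset Γ, T.card = n ∧ ∀ i ∈ T, ∀ j ∈ T, i ≠ j → cj (g i) q * cj (g j) q = 0 := by
    intro n
    induction n with
    | zero => exact ⟨∅, rfl, by simp⟩
    | succ n ih =>
      obtain ⟨T, hTn, hT⟩ := ih
      obtain ⟨γ, hγ⟩ := hcon T
      have hγT : γ ∉ T := fun h => (hpj γ).ne (by rw [← (hpj γ).isP.2]; exact hγ γ h)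
      refine ⟨insert γ T, by rw [Finset.card_insert_of_notMem hγT, hTn], fun i hi j hj hij => ?_⟩
      rcases Finset.mem_insert.1 hi with rfl | hi' <;> rcases Finset.mem_insert.1 hj with rfl | hj'
      · exact absurd rfl hij
      · exact hγ j hj'
      · rw [S.hab _ (hmem i) _ (hmem j)]; exact hγ i hi'
      · exact hT i hi' j hj' hij
  obtain ⟨n, hn⟩ := exists_nat_gt (1 / (Y.tr.τ q).re)
  obtain ⟨T, hTn, hT⟩ := this n
  have h1 := hbound T hT
  rw [hTn] at h1
  rw [div_lt_iff₀ ht] at hn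
  linarith

end S
variable (Y)
/-- left translation -/
def Lo (s : Λ) : KK Y →L[ℂ] KK Y := bi Y (u_Lg Y s) (one_mem Y.Lg)

lemma Lo_hat (s : Λ) {x : H →L[ℂ] H} (hx : x ∈ Y.Lg) :
    Lo Y s (hat Y hx) = hat Y (mul_mem (u_Lg Y s) hx) := by
  rw [Lo, bi_hat]; exact hat_congr Y _ _ (mul_one _)

lemma Lo_rep : URep Λ (Lo Y) where
  one x := by
    induction x using KK.ind with
    | hp => exact isClosed_eq (by fun_prop) (by fun_prop)
    | h x hx => rw [Lo_hat]; exact hat_congr Y _ _ (by rw [Y.u_one, one_mul])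
  mul s t x := by
    induction x using KK.ind with
    | hp => exact isClosed_eq (by fun_prop) (by fun_prop)
    | h x hx => rw [Lo_hat, Lo_hat, Lo_hat]; exact hat_congr Y _ _ (by rw [← mul_assoc, Y.u_mul])
  nrm s x := bi_norm Y _ _ (u_ss Y s) (by simp) x

lemma tot_of_dense {G : Type} {f : G → H →L[ℂ] H} (hf : ∀ s, f s ∈ Y.Lg)
    (hD : ∀ l ∈ Y.Lg, ∀ ε : ℝ, 0 < ε → ∃ a ∈ Submodule.span ℂ (Set.range f), nsq Y.tr (l - a) < ε)
    {y : KK Y} (h : ∀ s, inner ℂ (hat Y (hf s)) y = 0) : y = 0 := by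
  have hsp : ∀ a, a ∈ Submodule.span ℂ (Set.range f) → ∃ ha : a ∈ Y.Lg, inner ℂ (hat Y ha) y = 0 := by
    intro a ha
    induction ha using Submodule.span_induction with
    | mem x hx => obtain ⟨s, rfl⟩ := hx; exact ⟨hf s, h s⟩
    | zero => exact ⟨zero_mem _, by
        have : hat Y (zero_mem Y.Lg) = 0 := by rw [hat]; exact UniformSpace.Completion.coe_zero
        rw [this, inner_zero_left]⟩
    | add a b _ _ iha ihb =>
      obtain ⟨ha, h1⟩ := iha
      obtain ⟨hb, h2⟩ := ihb
      exact ⟨add_mem ha hb, by rw [hat_add Y ha hb, inner_add_left, h1, h2, add_zero]⟩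
    | smul c a _ iha =>
      obtain ⟨ha, h1⟩ := iha
      exact ⟨smul_mem_vN _ c ha, by rw [hat_smul Y ha, inner_smul_left, h1, mul_zero]⟩
  refine KK.orth_zero Y fun l hl => ?_
  by_contra hne
  have hpos : 0 < ‖inner ℂ (hat Y hl) y‖ := norm_pos_iff.2 hne
  have hε : 0 < (‖inner ℂ (hat Y hl) y‖ / (‖y‖ + 1)) ^ 2 := by positivity
  obtain ⟨a, ha, hla⟩ := hD l hl _ hε
  obtain ⟨haL, h0⟩ := hsp a ha
  have h1 : inner ℂ (hat Y (sub_mem hl haL)) y = inner ℂ (hat Y hl) y := by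
    rw [hat_sub Y hl haL, inner_sub_left, h0, sub_zero]
  have h2 := norm_inner_le_norm (𝕜 := ℂ) (hat Y (sub_mem hl haL)) y
  rw [← norm_hat Y (sub_mem hl haL)] at hla
  have h3 := lt_of_pow_lt_pow_left₀ 2 (by positivity) hla
  rw [h1] at h2
  rw [lt_div_iff₀ (by positivity)] at h3
  nlinarith [norm_nonneg (hat Y (sub_mem hl haL))]

lemma Lo_gen (hfac : IsFactorSet (Y.M : Set (H →L[ℂ] H))) : Gen (Lo Y) (hat Y (one_mem Y.Lg)) where
  nrm := by
    have : ‖hat Y (one_mem Y.Lg)‖ ^ 2 = 1 ^ 2 := by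
      rw [norm_hat, nsq, star_one, one_mul, Y.tr.unital]; simp
    exact (sq_eq_sq₀ (norm_nonneg _) zero_le_one).1 this
  orth s hs := by
    rw [Lo_hat, inner_hat, mul_one, mul_one, Y.u_star, tau_u, if_neg]
    simpa using hs
  tot y h := by
    refine tot_of_dense Y (fun s => u_Lg Y s) (fun l hl ε hε => span_dense Y hfac Y.tr hl hε) fun s => ?_
    have := h s
    rw [Lo_hat] at this
    rw [← this, hat_congr Y (u_Lg Y s) _ (mul_one _).symm]

variable {Y}
variable {g : Γ → H →L[ℂ] H} {w : H →L[ℂ] H} (S : Setup Y g w)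

/-- right translation -/
def Setup.Ro (S : Setup Y g w) (γ : Γ) : KK Y →L[ℂ] KK Y := bi Y (one_mem Y.Lg) (S.yL γ⁻¹)

lemma Setup.Ro_hat (γ : Γ) {x : H →L[ℂ] H} (hx : x ∈ Y.Lg) :
    S.Ro γ (hat Y hx) = hat Y (mul_mem hx (S.yL γ⁻¹)) := by
  rw [Setup.Ro, bi_hat]; exact hat_congr Y _ _ (by rw [one_mul])

lemma Setup.Ro_rep : URep Γ S.Ro where
  one x := by
    induction x using KK.ind with
    | hp => exact isClosed_eq (by fun_prop) (by fun_prop)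
    | h x hx => rw [S.Ro_hat]; exact hat_congr Y _ _ (by rw [inv_one, S.y_one, mul_one])
  mul s t x := by
    induction x using KK.ind with
    | hp => exact isClosed_eq (by fun_prop) (by fun_prop)
    | h x hx =>
      rw [S.Ro_hat, S.Ro_hat, S.Ro_hat]
      exact hat_congr Y _ _ (by rw [mul_assoc, S.y_mul, mul_inv_rev])
  nrm s x := bi_norm Y _ _ (by simp) (S.y_ss' _) x

lemma Setup.comm (s : Λ) (γ : Γ) (x : KK Y) : Lo Y s (S.Ro γ x) = S.Ro γ (Lo Y s x) := by
  induction x using KK.ind with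
  | hp => exact isClosed_eq (by fun_prop) (by fun_prop)
  | h x hx =>
    rw [S.Ro_hat, Lo_hat, Lo_hat, S.Ro_hat]
    exact hat_congr Y _ _ (by simp only [mul_assoc])

lemma Setup.Ro_gen : Gen S.Ro (hat Y (one_mem Y.Lg)) where
  nrm := (Lo_gen Y S.hfac).nrm
  orth s hs := by
    rw [S.Ro_hat, inner_hat, mul_one, one_mul, S.y_star, inv_inv, S.y_tau hs]
  tot y h := by
    refine tot_of_dense Y S.yL S.yD fun s => ?_
    have := h s⁻¹
    rw [S.Ro_hat] at this
    rw [← this]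
    congr 1
    exact hat_congr Y _ _ (by rw [inv_inv, one_mul])

/-- the map `c ↦ E(c w*)` -/
def Gpre (Y : CrossedProduct Λ H) (w : H →L[ℂ] H) : LD Y →ₗ[ℂ] (H →L[ℂ] H) :=
  Y.EA.E ∘ₗ (LinearMap.mulRight ℂ (star w)) ∘ₗ LD.op Y

lemma Setup.Gpre_bound (S : Setup Y g w) (x : LD Y) : ‖Gpre Y w x‖ ≤ 1 * ‖x‖ := by
  rw [one_mul]
  have hx := LD.memM Y x
  have hxw : LD.op Y x * star w ∈ Y.M := mul_mem hx (star_mem S.wM)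
  have hm : Gpre Y w x ∈ Y.A := Y.EA.mem _ hxw
  refine lemN Y.tr (fun a => AM Y) hm (norm_nonneg _) fun b hb => ?_
  rw [LD.norm_sq]
  have e1 : Gpre Y w x * b = Y.EA.E (b * LD.op Y x * star w) := by
    rw [S.hab _ hm _ hb, mul_assoc, E_left Y.tr Y.EA hb hxw]; rfl
  rw [e1]
  have hbx : b * LD.op Y x ∈ Y.M := mul_mem (AM Y hb) hx
  refine (nsq_expect Y.tr Y.EA Y.A_sub (mul_mem hbx (star_mem S.wM))).trans ?_
  have e2 : nsq Y.tr (b * LD.op Y x * star w) = nsq Y.tr (b * LD.op Y x) := by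
    rw [nsq, nsq]
    have : star (b * LD.op Y x * star w) * (b * LD.op Y x * star w)
        = cj w (star (b * LD.op Y x) * (b * LD.op Y x)) := by
      simp only [cj, star_mul, star_star, mul_assoc]
    rw [this, cj, Y.tr.tracial _ (mul_mem S.wM (mul_mem (star_mem hbx) hbx)) _ (star_mem S.wM), ← mul_assoc,
      S.ws, one_mul]
  rw [e2]
  apply le_of_eq
  set c := LD.op Y x with hc
  have hcL : c ∈ Y.Lg := LD.mem Y x
  have e3 : Y.tr.τ (star (b * c) * (b * c)) = Y.tr.τ (star c * c) * Y.tr.τ (star b * b) := by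
    have hbb : star b * b ∈ Y.A := mul_mem (star_mem hb) hb
    calc _ = Y.tr.τ (star c * (star b * b * c)) := by simp only [star_mul, mul_assoc]
      _ = Y.tr.τ (star b * b * (c * star c)) := by
        rw [Y.tr.tracial _ (star_mem hx) _ (mul_mem (AM Y hbb) hx), mul_assoc _ c]
      _ = Y.tr.τ (Y.EA.E (star b * b * (c * star c))) := by
        rw [Y.EA.trace_eq _ (mul_mem (AM Y hbb) (mul_mem hx (star_mem hx)))]
      _ = _ := by
        rw [E_left Y.tr Y.EA hbb (mul_mem hx (star_mem hx)), E_Lg Y S.hfac (mul_mem hcL (star_mem hcL)),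
          mul_smul_comm, mul_one, map_smul, smul_eq_mul, Y.tr.tracial _ hx _ (star_mem hx)]
  rw [nsq_coe Y.tr hbx, nsq_coe Y.tr hx, nsq_coe Y.tr (AM Y hb)] at e3
  exact_mod_cast e3

/-- extension of `Gpre` -/
def Setup.G (S : Setup Y g w) : KK Y →L[ℂ] (H →L[ℂ] H) :=
  ((Gpre Y w).mkContinuous 1 S.Gpre_bound).fromCompletion

lemma Setup.G_hat {x : H →L[ℂ] H} (hx : x ∈ Y.Lg) : S.G (hat Y hx) = Y.EA.E (x * star w) := by
  rw [Setup.G, hat, ContinuousLinearMap.fromCompletion_apply_coe]; rfl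

lemma Setup.G_norm (c : KK Y) : ‖S.G c‖ ≤ ‖c‖ := by
  induction c using UniformSpace.Completion.induction_on with
  | hp => exact isClosed_le (by fun_prop) (by fun_prop)
  | ih x =>
    rw [Setup.G, ContinuousLinearMap.fromCompletion_apply_coe, UniformSpace.Completion.norm_coe]
    have := S.Gpre_bound x
    rwa [one_mul] at this

lemma Setup.G_mem (c : KK Y) : S.G c ∈ Y.A := by
  refine mem_of_comm _ _ fun T hT => ?_
  induction c using KK.ind with
  | hp => exact isClosed_eq (by fun_prop) (by fun_prop)
  | h x hx =>
    rw [S.G_hat]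
    exact comm_of_mem (Y.EA.mem _ (mul_mem (LM Y hx) (star_mem S.wM))) hT

end su
end CDP
end

noncomputable section
open scoped Classical

namespace CDP
open CD Filter Topology

section ch
variable {H : Type} [NormedAddCommGroup H] [InnerProductSpace ℂ H] [CompleteSpace H]
variable {Λ : Type} [Group Λ] {Y : CrossedProduct Λ H} {Γ : Type} [Group Γ]

lemma rowCS {ι : Type} (F : Finset ι) (a : ι → H →L[ℂ] H) (c : ι → ℂ) {ε : ℝ} (hε : 0 ≤ ε)
    (h : ∑ i ∈ F, a i * star (a i) ≤ (ε : ℂ) • 1) :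
    ‖∑ i ∈ F, c i • a i‖ ≤ √ε * √(∑ i ∈ F, ‖c i‖ ^ 2) := by
  rw [← norm_star]
  refine ContinuousLinearMap.opNorm_le_bound _ (by positivity) fun η => ?_
  have h1 : ∑ i ∈ F, ‖star (a i) η‖ ^ 2 ≤ ε * ‖η‖ ^ 2 := by
    have := re_inner_mono h η
    have e1 : (inner ℂ ((∑ i ∈ F, a i * star (a i)) η) η : ℂ).re = ∑ i ∈ F, ‖star (a i) η‖ ^ 2 := by
      rw [sum_apply, sum_inner, Complex.re_sum]
      refine Finset.sum_congr rfl fun i _ => ?_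
      rw [mul_apply_eq_comp, ← ContinuousLinearMap.adjoint_inner_right]
      exact inner_self_eq_norm_sq (𝕜 := ℂ) _
    rw [e1] at this
    refine this.trans (le_of_eq ?_)
    change (inner ℂ ((ε : ℂ) • η) η : ℂ).re = _
    rw [inner_smul_left, Complex.conj_ofReal, Complex.re_ofReal_mul]
    congr 1
    exact inner_self_eq_norm_sq (𝕜 := ℂ) _
  rw [star_sum, sum_apply]
  calc ‖∑ i ∈ F, star (c i • a i) η‖ ≤ ∑ i ∈ F, ‖c i‖ * ‖star (a i) η‖ := by
        refine (norm_sum_le _ _).trans (Finset.sum_le_sum fun i _ => ?_)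
        rw [star_smul, smul_apply, norm_smul, norm_star]
    _ ≤ √(∑ i ∈ F, ‖c i‖ ^ 2) * √(∑ i ∈ F, ‖star (a i) η‖ ^ 2) := Real.sum_mul_le_sqrt_mul_sqrt _ _ _
    _ ≤ √(∑ i ∈ F, ‖c i‖ ^ 2) * √(ε * ‖η‖ ^ 2) := by gcongr
    _ = _ := by rw [Real.sqrt_mul hε, Real.sqrt_sq (norm_nonneg _)]; ring

variable {g : Γ → H →L[ℂ] H} {w : H →L[ℂ] H} (S : Setup Y g w)

/-- a chart -/
structure Ch (S : Setup Y g w) (q : H →L[ℂ] H) (ω : KK Y) (ε : ℝ) : Prop where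
  pj : Pj Y.A q
  bd : ∀ c, ‖q * (S.G c - (inner ℂ ω c : ℂ) • 1)‖ ≤ ε * ‖c‖

variable {S}

lemma Ch.restrict {q q' : H →L[ℂ] H} {ω : KK Y} {ε : ℝ} (h : Ch S q ω ε) (hq : Pj Y.A q') (hle : q' * q = q') :
    Ch S q' ω ε := ⟨hq, fun c => (cut_norm hq hle).trans (h.bd c)⟩

lemma Ch.mono {q : H →L[ℂ] H} {ω : KK Y} {ε ε' : ℝ} (h : Ch S q ω ε) (hle : ε ≤ ε') :
    Ch S q ω ε' := ⟨h.pj, fun c => (h.bd c).trans (by gcongr)⟩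

lemma Ch.dist {q : H →L[ℂ] H} {ω ω' : KK Y} {ε ε' : ℝ} (h : Ch S q ω ε) (h' : Ch S q ω' ε') :
    ‖ω - ω'‖ ≤ ε + ε' := by
  have h1 := h.bd (ω - ω')
  have h2 := h'.bd (ω - ω')
  have e : (inner ℂ (ω - ω') (ω - ω') : ℂ) • q
      = q * (S.G (ω - ω') - (inner ℂ ω' (ω - ω') : ℂ) • 1) - q * (S.G (ω - ω') - (inner ℂ ω (ω - ω') : ℂ) • 1) := by
    rw [inner_sub_left, ← mul_sub, sub_sub_sub_cancel_left, ← sub_smul, mul_smul_comm, mul_one]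
  have h3 := norm_sub_le (q * (S.G (ω - ω') - (inner ℂ ω' (ω - ω') : ℂ) • 1)) (q * (S.G (ω - ω') - (inner ℂ ω (ω - ω') : ℂ) • 1))
  rw [← e, norm_smul, h.pj.norm, mul_one, inner_self_eq_norm_sq_to_K] at h3
  have h3 : ‖ω - ω'‖ ^ 2 ≤ _ := le_trans (le_of_eq (by simp)) h3
  by_contra hcon
  push Not at hcon
  have hp : 0 ≤ ‖ω - ω'‖ := norm_nonneg _
  have hpos : 0 < ‖ω - ω'‖ := by
    rcases hp.lt_or_eq with hlt | heq
    · exact hlt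
    · exfalso
      rw [← heq] at hcon
      have hn : ∃ c : KK Y, 0 < ‖c‖ := ⟨hat Y (one_mem Y.Lg), by rw [(Lo_gen Y S.hfac).nrm]; exact one_pos⟩
      obtain ⟨c, hc⟩ := hn
      have a1 := (norm_nonneg _).trans (h.bd c)
      have a2 := (norm_nonneg _).trans (h'.bd c)
      nlinarith
  nlinarith

lemma Ch.move {q : H →L[ℂ] H} {ω ω' : KK Y} {ε ε' : ℝ} (h : Ch S q ω ε) (h' : ‖ω - ω'‖ ≤ ε') :
    Ch S q ω' (ε + ε') := by
  refine ⟨h.pj, fun c => ?_⟩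
  have e : q * (S.G c - (inner ℂ ω' c : ℂ) • 1)
      = q * (S.G c - (inner ℂ ω c : ℂ) • 1) + (inner ℂ (ω - ω') c : ℂ) • q := by
    rw [inner_sub_left, sub_smul, mul_sub, mul_sub, mul_smul_comm, mul_smul_comm, mul_one]; abel
  rw [e]
  refine (norm_add_le _ _).trans ?_
  rw [norm_smul, h.pj.norm, mul_one, add_mul]
  refine add_le_add (h.bd c) ((norm_inner_le_norm _ _).trans ?_)
  gcongr

variable (S)
lemma Setup.w_bessel (F : Finset Λ) :
    ∑ s ∈ F, S.G (hat Y (u_Lg Y s)) * star (S.G (hat Y (u_Lg Y s))) ≤ 1 := by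
  set f : Λ → H →L[ℂ] H := fun s => S.G (hat Y (u_Lg Y s)) with hf
  have hfA : ∀ s, f s ∈ Y.A := fun s => S.G_mem _
  have hfE : ∀ s, f s = Y.EA.E (Y.u s * star w) := fun s => S.G_hat _
  change ∑ s ∈ F, f s * star (f s) ≤ 1
  set T := ∑ s ∈ F, f s * star (f s) with hT
  have hTA : T ∈ Y.A := sum_mem fun s _ => mul_mem (hfA s) (star_mem (hfA s))
  have hTsa : IsSelfAdjoint T := by
    rw [IsSelfAdjoint, hT, star_sum]
    exact Finset.sum_congr rfl fun s _ => by rw [star_mul, star_star]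
  set x := ∑ s ∈ F, star (f s) * Y.u s with hx
  have hxM : x ∈ Y.M := sum_mem fun s _ => mul_mem (AM Y (star_mem (hfA s))) (Y.u_mem s)
  have hxT : Y.EA.E (x * star w) = T := by
    rw [hx, Finset.sum_mul, map_sum]
    refine Finset.sum_congr rfl fun s _ => ?_
    rw [mul_assoc, E_left Y.tr Y.EA (star_mem (hfA s)) (mul_mem (Y.u_mem s) (star_mem S.wM)), ← hfE,
      S.hab _ (hfA s) _ (star_mem (hfA s))]
  have hxx : Y.EA.E (x * star x) = T := by
    rw [hx, star_sum, Finset.sum_mul, map_sum]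
    refine Finset.sum_congr rfl fun s hs => ?_
    rw [Finset.mul_sum, map_sum, Finset.sum_eq_single_of_mem s hs]
    · rw [star_mul, star_star]
      have : star (f s) * Y.u s * (star (Y.u s) * f s) = star (f s) * f s := by
        rw [mul_assoc, ← mul_assoc (Y.u s), u_ss', one_mul]
      rw [this, Y.EA.fix _ (mul_mem (star_mem (hfA s)) (hfA s)), S.hab _ (hfA s) _ (star_mem (hfA s))]
    · intro t ht hts
      have : star (f s) * Y.u s * star (star (f t) * Y.u t) = star (f s) * Y.u (s * t⁻¹) * f t := by
        rw [star_mul, star_star, Y.u_star, ← Y.u_mul]; simp only [mul_assoc]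
      rw [this, Y.EA.bimod _ (star_mem (hfA s)) _ (hfA t) _ (Y.u_mem _), Y.EA_u, mul_zero, zero_mul]
      rw [ne_eq, mul_inv_eq_one]; exact fun h => hts h.symm
  have hn : ‖T‖ ≤ √‖T‖ := by
    refine lemN Y.tr (fun a => AM Y) hTA (by positivity) fun b hb => ?_
    have hbM := AM Y hb
    have hbx : b * x ∈ Y.M := mul_mem hbM hxM
    have e1 : T * b = Y.EA.E (b * x * star w) := by
      rw [mul_assoc, E_left Y.tr Y.EA hb (mul_mem hxM (star_mem S.wM)), hxT, S.hab _ hTA _ hb]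
    rw [e1, Real.sq_sqrt (norm_nonneg _)]
    refine (nsq_expect Y.tr Y.EA Y.A_sub (mul_mem hbx (star_mem S.wM))).trans ?_
    have e2 : nsq Y.tr (b * x * star w) ≤ nsq Y.tr (b * x) := by
      refine (nsq_mul_right_le Y.tr hbx (star_mem S.wM)).trans ?_
      have h1 : ‖star w‖ ≤ 1 := by rw [norm_star]; exact norm_unitary_le S.ws
      have h2 := nsq_nonneg Y.tr hbx
      nlinarith [norm_nonneg (star w), mul_le_one₀ h1 (norm_nonneg _) h1]
    refine e2.trans ?_
    have e3 : nsq Y.tr (b * x) = (Y.tr.τ (star (star b) * T * star b)).re := by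
      rw [← nsq_star Y.tr hbx, nsq, star_star]
      have : b * x * star (b * x) = b * (x * star x) * star b := by simp only [star_mul, mul_assoc]
      rw [this, ← Y.EA.trace_eq _ (mul_mem (mul_mem hbM (mul_mem hxM (star_mem hxM))) (star_mem hbM)),
        Y.EA.bimod _ hb _ (star_mem hb) _ (mul_mem hxM (star_mem hxM)), hxx, star_star]
    rw [e3]
    have h4 := star_left_conjugate_le_conjugate (le_norm_smul hTsa) (star b)
    have h5 := tau_mono Y.tr (mul_mem (mul_mem (star_mem (star_mem hbM)) (AM Y hTA)) (star_mem hbM))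
      (mul_mem (mul_mem (star_mem (star_mem hbM)) (smul_mem_vN Y.M _ (one_mem Y.M))) (star_mem hbM)) h4
    refine h5.trans (le_of_eq ?_)
    rw [mul_smul_comm, mul_one, smul_mul_assoc, map_smul, ← nsq_star Y.tr hbM, nsq]
    simp
  have hle : ‖T‖ ≤ 1 := by
    have h0 := norm_nonneg T
    have h1 := Real.sq_sqrt h0
    have h2 := Real.sqrt_nonneg ‖T‖
    by_contra hcon
    push Not at hcon
    nlinarith
  refine (le_norm_smul hTsa).trans ?_
  have := smul_nonneg (sub_nonneg.2 hle) (zero_le_one : (0 : H →L[ℂ] H) ≤ 1)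
  rw [← sub_nonneg]
  have e : (1 : H →L[ℂ] H) - ((‖T‖ : ℝ) : ℂ) • 1 = (1 - ‖T‖) • (1 : H →L[ℂ] H) := by
    rw [sub_smul, one_smul]; rfl
  rw [e]; exact this

end ch
end CDP
end

noncomputable section
open scoped Classical

namespace CDP
open CD Filter Topology

section ch
variable {H : Type} [NormedAddCommGroup H] [InnerProductSpace ℂ H] [CompleteSpace H]
variable {Λ : Type} [Group Λ] {Y : CrossedProduct Λ H} {Γ : Type} [Group Γ]
variable {g : Γ → H →L[ℂ] H} {w : H →L[ℂ] H} (S : Setup Y g w)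

lemma Setup.chart_exists [Countable Λ] {r : H →L[ℂ] H} (hr : Pj Y.A r) {ε : ℝ} (hε : 0 < ε) :
    ∃ q ω, Ch S q ω ε ∧ q * r = q := by
  obtain ⟨f, hf⟩ := exists_surjective_nat Λ
  set F : ℕ → Finset Λ := fun n => (Finset.range n).image f with hF
  have hFm : Monotone F := fun a b h => Finset.image_subset_image (Finset.range_mono h)
  have hFt : Tendsto F atTop atTop := tendsto_atTop_finset_of_monotone hFm fun s => by
    obtain ⟨n, rfl⟩ := hf s
    exact ⟨n + 1, Finset.mem_image_of_mem _ (by simp)⟩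
  set a : Λ → H →L[ℂ] H := fun s => S.G (hat Y (u_Lg Y s)) with ha
  have haA : ∀ s, a s ∈ Y.A := fun s => S.G_mem _
  have hpos : ∀ s, 0 ≤ a s * star (a s) := fun s => mul_star_self_nonneg _
  obtain ⟨q, hq, hqr, n, hn⟩ := lemCut S.hab (fun n => ∑ s ∈ F n, a s * star (a s))
    (fun n => sum_mem fun s _ => mul_mem (haA s) (star_mem (haA s)))
    (fun n m h => Finset.sum_le_sum_of_subset_of_nonneg (hFm h) fun s _ _ => hpos s)
    (fun n => Finset.sum_nonneg fun s _ => hpos s) (fun n => S.w_bessel (F n)) hr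
    (ε := (ε / 2) ^ 2) (by positivity)
  obtain ⟨q', hq', hqq, χ, hχ⟩ := lemS2fin S.hab (F n) a haA hq
    (ε := ε / (2 * ((F n).card + 1))) (by positivity)
  set e := hat Y (one_mem Y.Lg) with he
  have hgen := Lo_gen Y S.hfac
  have hLe : ∀ s, Lo Y s e = hat Y (u_Lg Y s) := fun s => by
    rw [he, Lo_hat]; exact hat_congr Y _ _ (mul_one _)
  set b := hgen.basis (Lo_rep Y) with hb
  have hbs : ∀ s, b s = hat Y (u_Lg Y s) := fun s => by rw [hb, Gen.basis_apply, ← hLe]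
  refine ⟨q', ∑ s ∈ F n, starRingEnd ℂ (χ s) • b s, ⟨hq', fun c => ?_⟩, ?_⟩
  · have hsum := (b.hasSum_repr c)
    have hlim : Tendsto (fun m => q' * (S.G (∑ s ∈ F m, b.repr c s • b s)
        - (inner ℂ (∑ s ∈ F n, starRingEnd ℂ (χ s) • b s) c : ℂ) • 1)) atTop
        (𝓝 (q' * (S.G c - (inner ℂ (∑ s ∈ F n, starRingEnd ℂ (χ s) • b s) c : ℂ) • 1))) := by
      have h1 : Tendsto (fun m => S.G (∑ s ∈ F m, b.repr c s • b s)) atTop (𝓝 (S.G c)) :=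
        (S.G.continuous.tendsto c).comp (hsum.comp hFt)
      exact (h1.sub_const _).const_mul _
    refine le_of_tendsto hlim.norm ?_
    filter_upwards [eventually_ge_atTop n] with m hm
    have hin : (inner ℂ (∑ s ∈ F n, starRingEnd ℂ (χ s) • b s) c : ℂ) = ∑ s ∈ F n, b.repr c s * χ s := by
      rw [sum_inner]
      refine Finset.sum_congr rfl fun s _ => ?_
      rw [inner_smul_left, b.repr_apply_apply, Complex.conj_conj, mul_comm]
    have hbess : ∀ G : Finset Λ, ∑ s ∈ G, ‖b.repr c s‖ ^ 2 ≤ ‖c‖ ^ 2 := by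
      intro G
      have := b.orthonormal.sum_inner_products_le c (s := G)
      simpa only [b.repr_apply_apply] using this
    have hG : S.G (∑ s ∈ F m, b.repr c s • b s) = ∑ s ∈ F m, b.repr c s • a s := by
      rw [map_sum]
      exact Finset.sum_congr rfl fun s _ => by rw [map_smul, hbs]
    have hsplit : q' * (S.G (∑ s ∈ F m, b.repr c s • b s)
        - (inner ℂ (∑ s ∈ F n, starRingEnd ℂ (χ s) • b s) c : ℂ) • 1)
        = ∑ s ∈ F m \ F n, b.repr c s • (q' * a s) + ∑ s ∈ F n, b.repr c s • (q' * (a s - χ s • 1)) := by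
      rw [hG, hin, ← Finset.sum_sdiff (hFm hm), Finset.sum_smul, add_sub_assoc, mul_add, ← Finset.sum_sub_distrib,
        Finset.mul_sum, Finset.mul_sum]
      congr 1
      · exact Finset.sum_congr rfl fun s _ => by rw [mul_smul_comm]
      · exact Finset.sum_congr rfl fun s _ => by rw [mul_smul, ← smul_sub, mul_smul_comm]
    rw [hsplit]
    refine (norm_add_le _ _).trans ?_
    have hrow : ∑ s ∈ F m \ F n, (q' * a s) * star (q' * a s) ≤ (((ε / 2) ^ 2 : ℝ) : ℂ) • 1 := by
      have h1 := conj_le (hn m hm) hq'.isP.1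
      have e1 : ∑ s ∈ F m \ F n, (q' * a s) * star (q' * a s)
          = q' * (q * (∑ s ∈ F m, a s * star (a s) - ∑ s ∈ F n, a s * star (a s)) * q) * q' := by
        rw [← Finset.sum_sdiff (hFm hm), add_sub_cancel_right]
        have hq2 : q * q' = q' := by rw [S.hab _ hq.mem _ hq'.mem, hqq]
        have : ∀ z : H →L[ℂ] H, q' * (q * z * q) * q' = q' * z * q' := fun z => by
          calc _ = (q' * q) * z * (q * q') := by simp only [mul_assoc]
            _ = _ := by rw [hqq, hq2]
        rw [this, Finset.mul_sum, Finset.sum_mul]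
        exact Finset.sum_congr rfl fun s _ => by rw [star_mul, hq'.isP.1]; simp only [mul_assoc]
      rw [e1]
      refine h1.trans ?_
      rw [mul_smul_comm, mul_one, smul_mul_assoc, hq'.isP.2]
      exact smul_proj_le (by positivity) hq'.isP
    have t1 := rowCS _ _ (fun s => b.repr c s) (by positivity) hrow
    have t1' : ‖∑ s ∈ F m \ F n, b.repr c s • (q' * a s)‖ ≤ ε / 2 * ‖c‖ := by
      refine t1.trans ?_
      rw [Real.sqrt_sq (by positivity)]
      gcongr
      exact Real.sqrt_le_iff.2 ⟨norm_nonneg _, hbess _⟩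
    have hc1 : ∀ s, ‖b.repr c s‖ ≤ ‖c‖ := fun s => by
      have := hbess {s}
      rw [Finset.sum_singleton] at this
      exact le_of_sq_le_sq this (norm_nonneg _)
    have t2 : ‖∑ s ∈ F n, b.repr c s • (q' * (a s - χ s • 1))‖ ≤ ε / 2 * ‖c‖ := by
      calc _ ≤ ∑ s ∈ F n, ‖c‖ * (ε / (2 * ((F n).card + 1))) := by
            refine (norm_sum_le _ _).trans (Finset.sum_le_sum fun s hs => ?_)
            rw [norm_smul]
            exact mul_le_mul (hc1 s) (hχ s hs) (norm_nonneg _) (norm_nonneg _)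
        _ = (F n).card / ((F n).card + 1) * (ε / 2 * ‖c‖) := by
            rw [Finset.sum_const, nsmul_eq_mul]; field_simp
        _ ≤ 1 * (ε / 2 * ‖c‖) := by
            gcongr
            rw [div_le_one (by positivity)]; linarith
        _ = _ := one_mul _
    linarith
  · rw [← hqq, mul_assoc, hqr]

lemma co_star {k : H →L[ℂ] H} (hk : Nrm Y k) (hab : IsAbelianSet (Y.A : Set (H →L[ℂ] H)))
    (hfree : IsFree Y) (s : Λ) : co Y k s * star (co Y k s) = cj k (pc Y k s) := by
  have hP := pc_isP Y hab hfree hk s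
  have h1 : pc Y k s = pc Y k s * star (pc Y k s) := by rw [hP.1, hP.2]
  have h2 : cj k (pc Y k s * star (pc Y k s)) = (k * pc Y k s) * star (k * pc Y k s) := by
    simp only [cj, star_mul, mul_assoc]
  rw [h1, h2, g_pc Y hk s, star_mul, mul_assoc, ← mul_assoc (Y.u s), u_ss', one_mul]

lemma Setup.G_transport (γ : Γ) (μ : Λ) (c : KK Y) :
    S.G c * cj (g γ) (pc Y (g γ) μ)
      = cj (Y.u μ) (S.G (Lo Y μ⁻¹ (S.Ro γ⁻¹ c))) * star (co Y (g γ) μ) := by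
  induction c using KK.ind with
  | hp => exact isClosed_eq (by unfold cj; fun_prop) (by unfold cj; fun_prop)
  | h x hx =>
    have hk := S.gN γ
    have hxw : x * star w ∈ Y.M := mul_mem (LM Y hx) (star_mem S.wM)
    have hd : cj (g γ) (pc Y (g γ) μ) ∈ Y.A := hk.cj_mem (pc_mem Y S.hab S.hfree hk μ)
    rw [S.Ro_hat, Lo_hat, S.G_hat, S.G_hat, inv_inv, ← E_right Y.tr Y.EA hd hxw]
    have hm : Y.u μ⁻¹ * (x * (star w * g γ * w)) * star w ∈ Y.M :=
      mul_mem (mul_mem (Y.u_mem _) (mul_mem (LM Y hx) (LM Y (S.yL γ)))) (star_mem S.wM)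
    have hcj : cj (Y.u μ) (Y.EA.E (Y.u μ⁻¹ * (x * (star w * g γ * w)) * star w))
        = Y.EA.E (Y.u μ * (Y.u μ⁻¹ * (x * (star w * g γ * w)) * star w) * star (Y.u μ)) :=
      ((u_nrm Y μ).E_conj Y hm).symm
    rw [hcj, ← E_right Y.tr Y.EA (star_mem (co_mem Y hk.mem μ))
      (mul_mem (mul_mem (Y.u_mem _) hm) (star_mem (Y.u_mem _)))]
    congr 1
    have hdsa : cj (g γ) (pc Y (g γ) μ) = g γ * star (Y.u μ) * star (co Y (g γ) μ) := by
      have h1 : star (cj (g γ) (pc Y (g γ) μ)) = cj (g γ) (pc Y (g γ) μ) := by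
        rw [cj_star, (pc_isP Y S.hab S.hfree hk μ).1]
      rw [← h1, cj, g_pc Y hk]
      simp only [star_mul, star_star, mul_assoc]
    rw [hdsa]
    calc _ = x * star w * g γ * star (Y.u μ) * star (co Y (g γ) μ) := by simp only [mul_assoc]
      _ = (Y.u μ * Y.u μ⁻¹) * x * star w * g γ * (w * star w) * star (Y.u μ) * star (co Y (g γ) μ) := by
        rw [Y.u_mul, mul_inv_cancel, Y.u_one, one_mul, S.ws', mul_one]
      _ = _ := by simp only [mul_assoc]

lemma Ch.transport {q r : H →L[ℂ] H} {ω : KK Y} {ε ε1 : ℝ} {S : Setup Y g w} (h : Ch S q ω ε) (hε1 : 0 < ε1)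
    (hr : Pj Y.A r) (γ : Γ) (hle : r * cj (g γ) q = r) :
    ∃ q', q' * r = q' ∧ ∃ μ, ∃ χ : ℂ, ‖χ‖ = 1 ∧ Ch S q' (χ • Lo Y μ (S.Ro γ ω)) (ε + ε1) := by
  have hk := S.gN γ
  have hab := S.hab
  have hε0 : 0 ≤ ε := by
    have := (norm_nonneg _).trans (h.bd (hat Y (one_mem Y.Lg)))
    rwa [(Lo_gen Y S.hfac).nrm, mul_one] at this
  -- choose a piece
  obtain ⟨μ, hμ⟩ : ∃ μ, r * cj (g γ) (pc Y (g γ) μ) ≠ 0 := by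
    by_contra hcon
    push Not at hcon
    have : cj (star (g γ)) r = 0 := by
      refine pc_full Y hk (hk.star.cj_mem hr.mem) fun s => ?_
      have hd := pc_mem Y hab S.hfree hk s
      have h1 := congrArg (cj (star (g γ))) (hcon s)
      rw [← cj_mul (by rw [star_star]; exact hk.ss'), cj_inv hk.ss] at h1
      rw [hab _ hd _ (hk.star.cj_mem hr.mem), h1]; simp [cj]
    exact hr.ne (by rw [← cj_inv' hk.ss' r, this]; simp [cj])
  set b := co Y (g γ) μ with hb
  have hbA : b ∈ Y.A := co_mem Y hk.mem μ
  set d := cj (g γ) (pc Y (g γ) μ) with hd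
  have hdA : d ∈ Y.A := hk.cj_mem (pc_mem Y hab S.hfree hk μ)
  have hbb : b * star b = d := co_star hk hab S.hfree μ
  have hdP : IsP d := by
    have hP := pc_isP Y hab S.hfree hk μ
    exact ⟨by rw [hd, cj_star, hP.1], by rw [hd, cj_mul hk.ss, hP.2]⟩
  have hr1 : Pj Y.A (r * d) := by
    refine ⟨mul_mem hr.mem hdA, ⟨?_, ?_⟩, hμ⟩
    · rw [star_mul, hdP.1, hr.isP.1, hab _ hdA _ hr.mem]
    · calc r * d * (r * d) = r * (d * r) * d := by simp only [mul_assoc]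
        _ = r * (r * d) * d := by rw [hab _ hdA _ hr.mem]
        _ = (r * r) * (d * d) := by simp only [mul_assoc]
        _ = _ := by rw [hr.isP.2, hdP.2]
  set ε' := min (1 / 2) (ε1 / (2 * (‖ω‖ + 1))) with hε'
  have hε'0 : 0 < ε' := lt_min (by norm_num) (by positivity)
  obtain ⟨q', hq', hqr, χ, hχ⟩ := lemS2 hab (star_mem hbA) hr1 hε'0
  have hq'd : q' * d = q' := by rw [← hqr, mul_assoc, mul_assoc, hdP.2]
  have hq'r : q' * r = q' := by
    rw [← hqr, hab _ hr.mem _ hdA, mul_assoc, mul_assoc, hr.isP.2]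
  have hq'g : q' * cj (g γ) q = q' := by rw [← hq'r, mul_assoc, hle]
  have hqb : ‖q' * star b‖ = 1 := by
    have h1 : ‖(q' * star b) * star (q' * star b)‖ = ‖q' * star b‖ * ‖q' * star b‖ := CStarRing.norm_self_mul_star
    have h2 : (q' * star b) * star (q' * star b) = q' := by
      rw [star_mul, star_star, hq'.isP.1]
      calc q' * star b * (b * q') = q' * (star b * b) * q' := by simp only [mul_assoc]
        _ = q' * d * q' := by rw [hab _ (star_mem hbA) _ hbA, hbb]
        _ = q' := by rw [hq'd, hq'.isP.2]
    rw [h2, hq'.norm] at h1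
    nlinarith [norm_nonneg (q' * star b)]
  have hbn : ‖star b‖ ≤ 1 := by
    rw [norm_star]
    have h1 : ‖b * star b‖ = ‖b‖ * ‖b‖ := CStarRing.norm_self_mul_star
    rw [hbb] at h1
    have h2 := hdP.norm_le
    nlinarith [norm_nonneg b]
  have hχn : |‖χ‖ - 1| ≤ ε' := by
    have h1 := abs_norm_sub_norm_le (q' * (χ • 1)) (q' * star b)
    have h2 : ‖q' * (χ • (1 : H →L[ℂ] H))‖ = ‖χ‖ := by
      rw [mul_smul_comm, mul_one, norm_smul, hq'.norm, mul_one]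
    rw [hqb, h2, norm_sub_rev, ← mul_sub] at h1
    exact h1.trans hχ
  have hχ0 : 0 < ‖χ‖ := by
    have := (abs_le.1 hχn).1
    have h2 : ε' ≤ 1 / 2 := min_le_left _ _
    linarith
  set χ' : ℂ := χ / ‖χ‖ with hχ'
  have hχ'1 : ‖χ'‖ = 1 := by
    rw [hχ', norm_div, Complex.norm_real, norm_norm, div_self hχ0.ne']
  have hχd : ‖χ - χ'‖ ≤ ε' := by
    have : χ - χ' = ((‖χ‖ - 1 : ℝ) : ℂ) * χ' := by
      have hne : (‖χ‖ : ℂ) ≠ 0 := by exact_mod_cast hχ0.ne'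
      rw [hχ']; push_cast; field_simp
    rw [this, norm_mul, hχ'1, mul_one, Complex.norm_real]
    exact hχn
  have hq'b : ‖q' * (star b - χ' • 1)‖ ≤ 2 * ε' := by
    have : q' * (star b - χ' • 1) = q' * (star b - χ • 1) + (χ - χ') • q' := by
      rw [sub_smul, mul_sub, mul_sub, mul_smul_comm, mul_smul_comm, mul_one]; abel
    rw [this]
    refine (norm_add_le _ _).trans ?_
    rw [norm_smul, hq'.norm, mul_one]
    linarith
  refine ⟨q', hq'r, μ, starRingEnd ℂ χ', by rw [RCLike.norm_conj, hχ'1], hq', fun c => ?_⟩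
  set c' := Lo Y μ⁻¹ (S.Ro γ⁻¹ c) with hc'
  have hc'n : ‖c'‖ = ‖c‖ := by rw [hc', (Lo_rep Y).nrm, S.Ro_rep.nrm]
  have hin : (inner ℂ (starRingEnd ℂ χ' • Lo Y μ (S.Ro γ ω)) c : ℂ) = χ' * inner ℂ ω c' := by
    rw [inner_smul_left, Complex.conj_conj, (Lo_rep Y).adj, S.Ro_rep.adj, hc', S.comm]
  have hGc := S.G_mem c'
  have hun := u_nrm Y μ
  -- the key identity
  have hσq : q' * cj (Y.u μ) q * star b = q' * star b := by
    have h1 := congrArg star (co_rel Y hk μ h.pj.mem)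
    rw [star_mul, star_mul (g γ * q * star (g γ))] at h1
    have h2 : star (Y.u μ * q * star (Y.u μ)) = cj (Y.u μ) q := by
      change star (cj _ _) = _; rw [cj_star, h.pj.isP.1]
    have h3 : star (g γ * q * star (g γ)) = cj (g γ) q := by
      change star (cj _ _) = _; rw [cj_star, h.pj.isP.1]
    rw [h2, h3, ← hb] at h1
    rw [mul_assoc, h1, hab _ (star_mem hbA) _ (hk.cj_mem h.pj.mem), ← mul_assoc, hq'g]
  have e0 : q' * S.G c = q' * cj (Y.u μ) (S.G c') * star b := by
    have := S.G_transport γ μ c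
    rw [← hd, ← hb, ← hc'] at this
    rw [mul_assoc, ← this, hab _ (S.G_mem c) _ hdA, ← mul_assoc, hq'd]
  have e1 : q' * (S.G c - (χ' * inner ℂ ω c') • 1)
      = q' * cj (Y.u μ) (q * (S.G c' - (inner ℂ ω c' : ℂ) • 1)) * star b
        + (inner ℂ ω c' : ℂ) • (q' * (star b - χ' • 1)) := by
    have e2 : q' * cj (Y.u μ) (q * (S.G c' - (inner ℂ ω c' : ℂ) • 1)) * star b
        = q' * S.G c - (inner ℂ ω c' : ℂ) • (q' * star b) := by
      rw [mul_sub, cj_sub, mul_sub, sub_mul, mul_smul_comm, mul_one, cj_smul, mul_smul_comm, smul_mul_assoc, hσq]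
      congr 1
      rw [← cj_mul hun.ss, hab _ (hun.cj_mem h.pj.mem) _ (hun.cj_mem hGc), ← mul_assoc, e0]
      rw [hab _ hq'.mem _ (hun.cj_mem hGc)]
      calc _ = cj (Y.u μ) (S.G c') * (q' * cj (Y.u μ) q * star b) := by simp only [mul_assoc]
        _ = _ := by rw [hσq]; simp only [mul_assoc]
    rw [e2, mul_sub, mul_sub, smul_sub, mul_smul_comm, mul_smul_comm, mul_one, mul_comm χ', mul_smul]
    abel
  rw [hin, e1]
  refine (norm_add_le _ _).trans ?_
  rw [add_mul]
  have hqn := hq'.norm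
  refine add_le_add ?_ ?_
  · calc _ ≤ ‖q'‖ * ‖cj (Y.u μ) (q * (S.G c' - (inner ℂ ω c' : ℂ) • 1))‖ * ‖star b‖ :=
          (norm_mul_le _ _).trans (by gcongr; exact norm_mul_le _ _)
      _ ≤ 1 * (ε * ‖c‖) * 1 := by
          have h5 := h.bd c'
          rw [hc'n] at h5
          rw [cj_norm hun.ss, hqn]
          gcongr
      _ = _ := by ring
  · rw [norm_smul]
    calc _ ≤ (‖ω‖ * ‖c'‖) * (2 * ε') :=
          mul_le_mul (norm_inner_le_norm _ _) hq'b (norm_nonneg _) (by positivity)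
      _ ≤ (‖ω‖ * ‖c‖) * (2 * (ε1 / (2 * (‖ω‖ + 1)))) := by
          rw [hc'n]; gcongr; exact min_le_right _ _
      _ = ‖ω‖ / (‖ω‖ + 1) * (ε1 * ‖c‖) := by field_simp
      _ ≤ 1 * (ε1 * ‖c‖) := by
          gcongr
          rw [div_le_one (by positivity)]; linarith
      _ = _ := one_mul _

end ch
end CDP
end

noncomputable section
open scoped Classical

namespace CDP
open CD Filter Topology

section gc
variable {H : Type} [NormedAddCommGroup H] [InnerProductSpace ℂ H] [CompleteSpace H]
variable {Λ : Type} [Group Λ] {Y : CrossedProduct Λ H} {Γ : Type} [Group Γ]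
variable {g : Γ → H →L[ℂ] H} {w : H →L[ℂ] H} (S : Setup Y g w)

lemma Pj.mul {p q : H →L[ℂ] H} (hab : IsAbelianSet (Y.A : Set (H →L[ℂ] H)))
    (hp : Pj Y.A p) (hq : Pj Y.A q) (h0 : p * q ≠ 0) :
    Pj Y.A (p * q) ∧ p * q * p = p * q ∧ p * q * q = p * q := by
  have hc := hab _ hp.mem _ hq.mem
  have e1 : p * q * p = p * q := by rw [hc, mul_assoc, hp.isP.2]
  have e2 : p * q * q = p * q := by rw [mul_assoc, hq.isP.2]
  refine ⟨⟨mul_mem hp.mem hq.mem, ⟨?_, ?_⟩, h0⟩, e1, e2⟩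
  · rw [star_mul, hq.isP.1, hp.isP.1, hc]
  · rw [← mul_assoc, e1, e2]

lemma Setup.G_ne : ∃ s, S.G (hat Y (u_Lg Y s)) ≠ 0 := by
  by_contra hcon
  push Not at hcon
  have : w = 0 := by
    refine Y.fourier_sep w S.wM fun γ => ?_
    have h1 := hcon γ
    rw [S.G_hat] at h1
    have h2 := Y.EA.star_map _ (mul_mem (Y.u_mem γ) (star_mem S.wM))
    rw [h1, star_mul, star_star, star_zero] at h2
    exact h2
  have h3 := S.ws
  rw [this, mul_zero] at h3
  exact one_ne Y h3.symm

lemma Setup.base [Countable Λ] : ∃ ω0 : KK Y, ω0 ≠ 0 ∧ ∀ ε : ℝ, 0 < ε → ∃ q, Ch S q ω0 ε := by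
  obtain ⟨s, hs⟩ := S.G_ne
  set c0 := hat Y (u_Lg Y s) with hc0
  obtain ⟨r0, hr0, ε0, hε0, hbig⟩ : ∃ r0, Pj Y.A r0 ∧ ∃ ε0 : ℝ, 0 < ε0 ∧
      ∀ q, Pj Y.A q → q * r0 = q → ε0 < ‖q * S.G c0‖ := by
    by_contra hcon
    push Not at hcon
    refine hs (lemS S.hab (S.G_mem c0) fun r hr ε hε => ?_)
    obtain ⟨q, h1, h2, h3⟩ := hcon r hr ε hε
    exact ⟨q, h1, h2, h3⟩
  have hex : ∀ (r : {r // Pj Y.A r}) (n : ℕ), ∃ q ω, Ch S q ω ((1 / 2 : ℝ) ^ n) ∧ q * r.1 = q :=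
    fun r n => S.chart_exists r.2 (by positivity)
  choose Q Wv hQ hQr using hex
  let sq : ℕ → {r // Pj Y.A r} := fun n =>
    Nat.rec ⟨r0, hr0⟩ (fun n r => ⟨Q r n, (hQ r n).pj⟩) n
  have hsq1 : ∀ n, (sq (n + 1)).1 = Q (sq n) n := fun n => rfl
  set ω : ℕ → KK Y := fun n => Wv (sq n) n with hω
  have hCh : ∀ n, Ch S (sq (n + 1)).1 (ω n) ((1 / 2 : ℝ) ^ n) := fun n => hQ (sq n) n
  have hle : ∀ n, (sq (n + 1)).1 * (sq n).1 = (sq (n + 1)).1 := fun n => hQr (sq n) n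
  have hr : ∀ n, (sq n).1 * r0 = (sq n).1 := by
    intro n
    induction n with
    | zero => exact hr0.isP.2
    | succ n ih => rw [← hle n, mul_assoc, ih]
  have hd : ∀ n, dist (ω n) (ω (n + 1)) ≤ 2 * (1 / 2 : ℝ) ^ n := by
    intro n
    rw [dist_eq_norm]
    refine (((hCh n).restrict (sq (n + 2)).2 (hle (n + 1))).dist (hCh (n + 1))).trans ?_
    have : (0 : ℝ) < (1 / 2) ^ n := by positivity
    rw [pow_succ]; linarith
  obtain ⟨ω0, hω0⟩ := cauchySeq_tendsto_of_complete
    (cauchySeq_of_le_geometric (1 / 2 : ℝ) 2 (by norm_num) hd)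
  have hlim : ∀ n, ‖ω n - ω0‖ ≤ 4 * (1 / 2 : ℝ) ^ n := by
    intro n
    have := dist_le_of_le_geometric_of_tendsto (1 / 2 : ℝ) 2 (by norm_num) hd hω0 n
    rw [dist_eq_norm] at this
    refine this.trans (le_of_eq ?_)
    ring
  have hCh0 : ∀ n, Ch S (sq (n + 1)).1 ω0 (5 * (1 / 2 : ℝ) ^ n) := fun n =>
    ((hCh n).move (hlim n)).mono (by linarith)
  have hsmall : ∀ ε : ℝ, 0 < ε → ∃ n : ℕ, 5 * (1 / 2 : ℝ) ^ n ≤ ε := by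
    intro ε hε
    obtain ⟨n, hn⟩ := exists_pow_lt_of_lt_one (show 0 < ε / 5 by positivity) (show (1 / 2 : ℝ) < 1 by norm_num)
    exact ⟨n, by linarith⟩
  refine ⟨ω0, ?_, fun ε hε => ?_⟩
  · rintro rfl
    obtain ⟨n, hn⟩ := hsmall (ε0 / (‖c0‖ + 1)) (by positivity)
    have h1 := (hCh0 n).bd c0
    rw [inner_zero_left, zero_smul, sub_zero] at h1
    have h2 := hbig _ (sq (n + 1)).2 (hr (n + 1))
    have h3 : 5 * (1 / 2 : ℝ) ^ n * ‖c0‖ ≤ ε0 / (‖c0‖ + 1) * ‖c0‖ := by gcongr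
    have h4 : ε0 / (‖c0‖ + 1) * ‖c0‖ ≤ ε0 := by
      rw [div_mul_eq_mul_div, div_le_iff₀ (by positivity)]
      nlinarith [norm_nonneg c0]
    linarith
  · obtain ⟨n, hn⟩ := hsmall ε hε
    exact ⟨_, (hCh0 n).mono hn⟩

lemma Setup.propP {ω0 : KK Y} (h0 : ω0 ≠ 0) (hC : ∀ ε : ℝ, 0 < ε → ∃ q, Ch S q ω0 ε) :
    PropP (Lo Y) S.Ro (((‖ω0‖ : ℝ) : ℂ)⁻¹ • ω0) := by
  intro ε hε
  have hκ : 0 < ‖ω0‖ := norm_pos_iff.2 h0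
  obtain ⟨q, hq⟩ := hC (ε * ‖ω0‖ / 8) (by positivity)
  set κ := ‖ω0‖ with hκd
  obtain ⟨T, hT⟩ := S.fin hq.pj
  refine ⟨(fun i => S.Ro i ((κ : ℂ)⁻¹ • ω0)) '' T, T.finite_toSet.image _, fun γ => ?_⟩
  obtain ⟨i, hi, hne⟩ := hT γ
  obtain ⟨hr, hr1, hr2⟩ := Pj.mul S.hab ((S.gN γ).pj hq.pj) ((S.gN i).pj hq.pj) hne
  have hη : 0 < ε * κ / 8 := by positivity
  obtain ⟨q', hq'r, μ, χ, hχ, hq'⟩ := hq.transport hη hr γ hr1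
  obtain ⟨q'', hq''q, ν, χ', hχ', hq''⟩ := hq.transport hη hq'.pj i (by rw [← hq'r, mul_assoc, hr2])
  have hd := (hq'.restrict hq''.pj hq''q).dist hq''
  refine ⟨_, ⟨i, hi, rfl⟩, starRingEnd ℂ χ * χ', μ⁻¹ * ν, by simp [hχ, hχ'], ?_⟩
  have hχχ : starRingEnd ℂ χ * χ = 1 := by
    rw [mul_comm, Complex.mul_conj, Complex.normSq_eq_norm_sq, hχ]; simp
  have e : S.Ro γ ((κ : ℂ)⁻¹ • ω0) - (starRingEnd ℂ χ * χ') • Lo Y (μ⁻¹ * ν) (S.Ro i ((κ : ℂ)⁻¹ • ω0))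
      = ((κ : ℂ)⁻¹ * starRingEnd ℂ χ) • Lo Y μ⁻¹ (χ • Lo Y μ (S.Ro γ ω0) - χ' • Lo Y ν (S.Ro i ω0)) := by
    simp only [map_sub, map_smul, (Lo_rep Y).mul, inv_mul_cancel, (Lo_rep Y).one,
      smul_sub, smul_smul]
    rw [mul_assoc (κ : ℂ)⁻¹ _ χ, hχχ, mul_one]
    congr 2
    ring
  rw [e, norm_smul, (Lo_rep Y).nrm, norm_mul, norm_inv, Complex.norm_real, RCLike.norm_conj, hχ, mul_one,
    Real.norm_of_nonneg hκ.le, inv_mul_le_iff₀ hκ]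
  nlinarith

/-- the output of the analytic part -/
lemma Setup.global [Countable Λ] (hicc : IsICC Γ) : ∃ (ω : KK Y) (κ : ℝ), 0 < κ ∧ Gen S.Ro ω ∧ Gen (Lo Y) ω ∧
    ∀ r, Pj Y.A r → ∀ ε : ℝ, 0 < ε → ∃ q, q * r = q ∧ ∃ s, ∃ χ : ℂ, ‖χ‖ = 1 ∧
      Ch S q ((χ * κ) • Lo Y s ω) ε := by
  obtain ⟨ω0, h0, hC⟩ := S.base
  have hκ : 0 < ‖ω0‖ := norm_pos_iff.2 h0
  have hκ' : (‖ω0‖ : ℂ) ≠ 0 := by exact_mod_cast hκ.ne'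
  obtain ⟨h1, h2, h3⟩ := lemmaA hicc (Lo_rep Y) S.Ro_rep S.comm (Lo_gen Y S.hfac) S.Ro_gen
    (ω := ((‖ω0‖ : ℝ) : ℂ)⁻¹ • ω0) (by
      rw [norm_smul, norm_inv, Complex.norm_real, norm_norm, inv_mul_cancel₀ hκ.ne']) (S.propP h0 hC)
  refine ⟨_, ‖ω0‖, hκ, h1, h2, fun r hr ε hε => ?_⟩
  obtain ⟨q, hq⟩ := hC (ε / 2) (by positivity)
  obtain ⟨γ, hγ⟩ := S.erg hq.pj hr
  obtain ⟨hr', hr1, hr2⟩ := Pj.mul S.hab ((S.gN γ).pj hq.pj) hr hγ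
  obtain ⟨q', hq'r, μ, χ, hχ, hq'⟩ := hq.transport (half_pos hε) hr' γ hr1
  obtain ⟨s, χ', hχ', hs⟩ := h3 γ
  refine ⟨q', by rw [← hq'r, mul_assoc, hr2], μ * s, χ * χ', by simp [hχ, hχ'], ?_⟩
  have e : χ • Lo Y μ (S.Ro γ ω0)
      = (χ * χ' * (‖ω0‖ : ℝ)) • Lo Y (μ * s) (((‖ω0‖ : ℝ) : ℂ)⁻¹ • ω0) := by
    have : ω0 = ((‖ω0‖ : ℝ) : ℂ) • (((‖ω0‖ : ℝ) : ℂ)⁻¹ • ω0) := by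
      rw [smul_smul, mul_inv_cancel₀ hκ', one_smul]
    conv_lhs => rw [this]
    rw [map_smul, hs, map_smul, map_smul, (Lo_rep Y).mul, smul_smul, smul_smul]
    congr 1
    ring
  rw [← e]
  convert hq' using 1
  ring

end gc
end CDP
end

noncomputable section
open scoped Classical

namespace CDP
open CD Filter Topology

section fin
variable {H : Type} [NormedAddCommGroup H] [InnerProductSpace ℂ H] [CompleteSpace H]
variable {Λ : Type} [Group Λ] {Y : CrossedProduct Λ H} {Γ : Type} [Group Γ]
variable {g : Γ → H →L[ℂ] H} {w : H →L[ℂ] H} (S : Setup Y g w)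

structure Glob (S : Setup Y g w) (ω : KK Y) (κ : ℝ) : Prop where
  pos : 0 < κ
  nrm : ‖ω‖ = 1
  oL : ∀ s t, s ≠ t → (inner ℂ (Lo Y s ω) (Lo Y t ω) : ℂ) = 0
  oR : ∀ γ, γ ≠ 1 → (inner ℂ (S.Ro γ ω) ω : ℂ) = 0
  ch : ∀ r, Pj Y.A r → ∀ ε : ℝ, 0 < ε → ∃ q, q * r = q ∧ ∃ s, ∃ χ : ℂ, ‖χ‖ = 1 ∧
      Ch S q ((χ * κ) • Lo Y s ω) ε

lemma Setup.glob [Countable Λ] (hicc : IsICC Γ) : ∃ (ω : KK Y) (κ : ℝ), Glob S ω κ := by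
  obtain ⟨ω, κ, h1, h2, h3, h4⟩ := S.global hicc
  exact ⟨ω, κ, h1, h2.nrm, fun s t hst => (Gen.ortho (Lo_rep Y) h3.nrm h3.orth).2 hst, h2.orth, h4⟩

variable {S} {ω : KK Y} {κ : ℝ}

lemma Glob.shift (h : Glob S ω κ) (s : Λ) : Glob S (Lo Y s ω) κ where
  pos := h.pos
  nrm := by rw [(Lo_rep Y).nrm, h.nrm]
  oL a b hab := by
    rw [(Lo_rep Y).mul, (Lo_rep Y).mul]
    exact h.oL _ _ fun he => hab (mul_right_cancel he)
  oR γ hγ := by rw [← S.comm, (Lo_rep Y).inn, h.oR γ hγ]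
  ch r hr ε hε := by
    obtain ⟨q, hq, t, χ, hχ, hc⟩ := h.ch r hr ε hε
    refine ⟨q, hq, t * s⁻¹, χ, hχ, ?_⟩
    rw [(Lo_rep Y).mul, inv_mul_cancel_right]
    exact hc

lemma comm_norm {q a : H →L[ℂ] H} (hab : IsAbelianSet (Y.A : Set (H →L[ℂ] H))) (hq : Pj Y.A q) (ha : a ∈ Y.A) :
    ‖q * star a‖ = ‖q * a‖ := by
  rw [← norm_star (q * a), star_mul, hq.isP.1, hab _ hq.mem _ (star_mem ha)]

/-- evaluation of the coefficient on a chart -/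
lemma Glob.eval (h : Glob S ω κ) {q : H →L[ℂ] H} {s t : Λ} {χ : ℂ} {ε : ℝ}
    (hc : Ch S q ((χ * κ) • Lo Y s ω) ε) (c : KK Y) :
    ‖q * (S.G c - (starRingEnd ℂ (χ * κ) * inner ℂ (Lo Y s ω) c : ℂ) • 1)‖ ≤ ε * ‖c‖ := by
  have := hc.bd c
  rwa [inner_smul_left] at this

lemma Glob.eval_orth (h : Glob S ω κ) {q : H →L[ℂ] H} {s : Λ} {χ : ℂ} {ε : ℝ}
    (hc : Ch S q ((χ * κ) • Lo Y s ω) ε) {c : KK Y} (h0 : (inner ℂ (Lo Y s ω) c : ℂ) = 0) :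
    ‖q * S.G c‖ ≤ ε * ‖c‖ := by
  have := h.eval (t := s) hc c
  rwa [h0, mul_zero, zero_smul, sub_zero] at this

lemma Glob.eval_self (h : Glob S ω κ) {q : H →L[ℂ] H} {s : Λ} {χ : ℂ} {ε : ℝ}
    (hc : Ch S q ((χ * κ) • Lo Y s ω) ε) :
    ‖q * (S.G (Lo Y s ω) - (starRingEnd ℂ (χ * κ)) • 1)‖ ≤ ε := by
  have := h.eval (t := s) hc (Lo Y s ω)
  rwa [inner_self_eq_norm_sq_to_K, (Lo_rep Y).nrm, h.nrm, mul_one, RCLike.ofReal_one, one_pow, mul_one] at this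

lemma Glob.ii (h : Glob S ω κ) (s : Λ) {c : KK Y} (h0 : (inner ℂ (Lo Y s ω) c : ℂ) = 0) :
    S.G c * S.G (Lo Y s ω) = 0 := by
  have hcA := S.G_mem c
  have hsA := S.G_mem (Lo Y s ω)
  refine lemS S.hab (mul_mem hcA hsA) fun r hr ε hε => ?_
  set C := ‖S.G c‖ + ‖c‖ * ‖S.G (Lo Y s ω)‖ + 1 with hC
  have hC0 : 0 < C := by positivity
  obtain ⟨q, hqr, t, χ, hχ, hc⟩ := h.ch r hr (ε / C) (by positivity)
  refine ⟨q, hc.pj, hqr, ?_⟩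
  have hle : ε / C * C = ε := by field_simp
  by_cases hts : t = s
  · subst hts
    rw [← mul_assoc]
    refine (norm_mul_le _ _).trans ?_
    have h1 := h.eval_orth hc h0
    calc _ ≤ (ε / C * ‖c‖) * ‖S.G (Lo Y t ω)‖ := by gcongr
      _ = ε / C * (‖c‖ * ‖S.G (Lo Y t ω)‖) := by ring
      _ ≤ ε / C * C := by
        gcongr; rw [hC]; linarith [norm_nonneg (S.G c)]
      _ = ε := hle
  · rw [S.hab _ hcA _ hsA, ← mul_assoc]
    refine (norm_mul_le _ _).trans ?_
    have h1 := h.eval_orth hc (h.oL t s hts)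
    rw [(Lo_rep Y).nrm, h.nrm, mul_one] at h1
    calc _ ≤ (ε / C) * ‖S.G c‖ := by gcongr
      _ ≤ ε / C * C := by
        gcongr; rw [hC]; nlinarith [norm_nonneg c, norm_nonneg (S.G (Lo Y s ω))]
      _ = ε := hle

lemma Glob.iii (h : Glob S ω κ) (s : Λ) :
    S.G (Lo Y s ω) * (star (S.G (Lo Y s ω)) * S.G (Lo Y s ω)) = ((κ ^ 2 : ℝ) : ℂ) • S.G (Lo Y s ω) := by
  rw [← sub_eq_zero]
  have hsA := S.G_mem (Lo Y s ω)
  set f := S.G (Lo Y s ω) with hf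
  have hab := S.hab
  set d := star f * f - ((κ ^ 2 : ℝ) : ℂ) • 1 with hd
  have hdA : d ∈ Y.A := sub_mem (mul_mem (star_mem hsA) hsA) (smul_mem_vN _ _ (one_mem _))
  have e0 : f * (star f * f) - ((κ ^ 2 : ℝ) : ℂ) • f = f * d := by
    rw [hd, mul_sub, mul_smul_comm, mul_one]
  rw [e0]
  refine lemS hab (mul_mem hsA hdA) fun r hr ε hε => ?_
  set C := ‖d‖ + (‖f‖ + κ) * ‖f‖ + 1 with hC
  have hκ := h.pos
  have hC0 : 0 < C := by positivity
  obtain ⟨q, hqr, t, χ, hχ, hc⟩ := h.ch r hr (ε / C) (by positivity)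
  refine ⟨q, hc.pj, hqr, ?_⟩
  have hle : ε / C * C = ε := by field_simp
  by_cases hts : t = s
  · subst hts
    have h1 := h.eval_self hc
    rw [← hf] at h1
    set m : ℂ := starRingEnd ℂ (χ * κ) with hm
    have hmn : ‖m‖ = κ := by
      rw [hm, RCLike.norm_conj, norm_mul, hχ, one_mul, Complex.norm_real, Real.norm_of_nonneg hκ.le]
    have hmm : starRingEnd ℂ m * m = ((κ ^ 2 : ℝ) : ℂ) := by
      rw [mul_comm, Complex.mul_conj, Complex.normSq_eq_norm_sq, hmn]
    have h1A : f - m • 1 ∈ Y.A := sub_mem hsA (smul_mem_vN _ _ (one_mem _))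
    have h2 : ‖q * (star f - starRingEnd ℂ m • 1)‖ ≤ ε / C := by
      have : star f - starRingEnd ℂ m • (1 : H →L[ℂ] H) = star (f - m • 1) := by
        rw [star_sub, star_smul, star_one]; rfl
      rw [this, comm_norm hab hc.pj h1A]
      exact h1
    have e1 : q * (d * f) = (star f * (q * (f - m • 1)) + m • (q * (star f - starRingEnd ℂ m • 1))) * f := by
      rw [← mul_assoc]
      congr 1
      rw [← mul_assoc (star f), hab _ (star_mem hsA) _ hc.pj.mem, hd, ← hmm]
      simp only [mul_sub, mul_smul_comm, mul_one, smul_sub, smul_smul, mul_assoc]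
      rw [mul_comm m]
      abel
    rw [hab _ hsA _ hdA, e1]
    refine (norm_mul_le _ _).trans ?_
    calc _ ≤ (‖f‖ * (ε / C) + κ * (ε / C)) * ‖f‖ := by
          gcongr
          refine (norm_add_le _ _).trans (add_le_add ?_ ?_)
          · refine (norm_mul_le _ _).trans ?_
            rw [norm_star]; gcongr
          · rw [norm_smul, hmn]; gcongr
      _ = ε / C * ((‖f‖ + κ) * ‖f‖) := by ring
      _ ≤ ε / C * C := by
        gcongr; rw [hC]; linarith [norm_nonneg d]
      _ = ε := hle
  · rw [← mul_assoc]
    refine (norm_mul_le _ _).trans ?_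
    have h1 := h.eval_orth hc (h.oL t s hts)
    rw [(Lo_rep Y).nrm, h.nrm, mul_one] at h1
    calc _ ≤ (ε / C) * ‖d‖ := by gcongr
      _ ≤ ε / C * C := by
        gcongr; rw [hC]; nlinarith [norm_nonneg d, norm_nonneg f]
      _ = ε := hle

lemma Glob.iv (h : Glob S ω κ) {a : H →L[ℂ] H} (ha : a ∈ Y.A) (h0 : ∀ s, S.G (Lo Y s ω) * a = 0) : a = 0 := by
  have hκ := h.pos
  refine lemS S.hab ha fun r hr ε hε => ?_
  obtain ⟨q, hqr, t, χ, hχ, hc⟩ := h.ch r hr (ε * κ / (‖a‖ + 1)) (by positivity)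
  refine ⟨q, hc.pj, hqr, ?_⟩
  have h1 := h.eval_self hc
  set m : ℂ := starRingEnd ℂ (χ * κ) with hm
  have hmn : ‖m‖ = κ := by
    rw [hm, RCLike.norm_conj, norm_mul, hχ, one_mul, Complex.norm_real, Real.norm_of_nonneg hκ.le]
  have e : q * (S.G (Lo Y t ω) - m • 1) * a = (-m) • (q * a) := by
    rw [mul_assoc, sub_mul, h0 t, zero_sub, smul_mul_assoc, one_mul, mul_neg, mul_smul_comm, neg_smul]
  have h2 := norm_mul_le (q * (S.G (Lo Y t ω) - m • 1)) a
  rw [e, norm_smul, norm_neg, hmn] at h2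
  have h3 : κ * ‖q * a‖ ≤ κ * ε := by
    refine h2.trans ?_
    calc _ ≤ ε * κ / (‖a‖ + 1) * ‖a‖ := by gcongr
      _ ≤ κ * ε := by
        rw [div_mul_eq_mul_div, div_le_iff₀ (by positivity)]
        nlinarith [norm_nonneg a, mul_pos hκ hε]
  exact le_of_mul_le_mul_left h3 hκ

lemma Glob.ii' (h : Glob S ω κ) (s : Λ) (c : KK Y) :
    S.G c * star (S.G (Lo Y s ω)) = (inner ℂ (Lo Y s ω) c : ℂ) • (S.G (Lo Y s ω) * star (S.G (Lo Y s ω))) := by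
  set m : ℂ := inner ℂ (Lo Y s ω) c with hm
  have h0 : (inner ℂ (Lo Y s ω) (c - m • Lo Y s ω) : ℂ) = 0 := by
    rw [inner_sub_right, inner_smul_right, inner_self_eq_norm_sq_to_K, (Lo_rep Y).nrm, h.nrm, ← hm]
    simp
  have h1 := h.ii s h0
  have hcA := S.G_mem (c - m • Lo Y s ω)
  have hfA := S.G_mem (Lo Y s ω)
  have h2 : S.G (c - m • Lo Y s ω) * star (S.G (Lo Y s ω)) = 0 := by
    rw [← CStarRing.mul_star_self_eq_zero_iff, star_mul, star_star]
    rw [mul_assoc, ← mul_assoc (star _), S.hab _ (star_mem hfA) _ hfA, mul_assoc, ← mul_assoc, h1, zero_mul]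
  rw [map_sub, map_smul, sub_mul, smul_mul_assoc, sub_eq_zero] at h2
  exact h2

lemma Glob.exists_ne (h : Glob S ω κ) : ∃ s, S.G (Lo Y s ω) ≠ 0 := by
  by_contra hcon
  push Not at hcon
  exact one_ne Y (h.iv (one_mem _) fun s => by rw [hcon s, zero_mul])

/-- The vector is given by a bounded element. -/
lemma Glob.bdd (h : Glob S ω κ) (hne : S.G ω ≠ 0) : ∃ z, ∃ hz : z ∈ Y.Lg, hat Y hz = ω := by
  have h1 := fun c => h.ii' 1 c
  simp only [(Lo_rep Y).one] at h1
  set f := S.G ω with hf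
  have hfA : f ∈ Y.A := S.G_mem ω
  have hfM := AM Y hfA
  set n : ℂ := Y.tr.τ (f * star f) with hn
  have hn0 : n ≠ 0 := by
    intro h0
    refine hne ?_
    have := Y.tr.faithful (star f) (star_mem hfM) (by rw [star_star]; exact h0)
    rwa [star_eq_zero] at this
  have hwf : star w * star f ∈ Y.M := mul_mem (star_mem S.wM) (star_mem hfM)
  set e := Y.EL.E (star w * star f) with he
  have heL : e ∈ Y.Lg := Y.EL.mem _ hwf
  refine ⟨star (n⁻¹ • e), star_mem (smul_mem_vN _ _ heL), ?_⟩
  rw [← sub_eq_zero]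
  refine KK.orth_zero Y fun x hx => ?_
  rw [← inner_conj_symm, map_eq_zero, inner_sub_left, inner_hat, star_star, sub_eq_zero]
  have h2 := congrArg Y.tr.τ (h1 (hat Y hx))
  rw [S.G_hat, ← E_right Y.tr Y.EA (star_mem hfA) (mul_mem (LM Y hx) (star_mem S.wM)),
    Y.EA.trace_eq _ (mul_mem (mul_mem (LM Y hx) (star_mem S.wM)) (star_mem hfM)), mul_assoc,
    ← Y.EL.trace_eq _ (mul_mem (LM Y hx) hwf), E_left Y.tr Y.EL hx hwf, ← he,
    Y.tr.tracial _ (LM Y hx) _ (LM Y heL), map_smul, ← hn, smul_eq_mul] at h2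
  rw [smul_mul_assoc, map_smul, h2, smul_eq_mul]
  field_simp

end fin
end CDP
end

noncomputable section
open scoped Classical

namespace CDP
open CD Filter Topology

section fin2
variable {H : Type} [NormedAddCommGroup H] [InnerProductSpace ℂ H] [CompleteSpace H]
variable {Λ : Type} [Group Λ] {Y : CrossedProduct Λ H} {Γ : Type} [Group Γ]
variable {g : Γ → H →L[ℂ] H} {w : H →L[ℂ] H} {S : Setup Y g w}

/-- totality of the `y` -/
lemma Setup.y_tot (S : Setup Y g w) {d : H →L[ℂ] H} (hd : d ∈ Y.Lg)
    (h : ∀ γ, Y.tr.τ (star w * g γ * w * d) = 0) : d = 0 := by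
  have : hat Y hd = 0 := by
    refine S.Ro_gen.tot _ fun γ => ?_
    rw [S.Ro_hat, inner_hat, one_mul, S.y_star, inv_inv]
    exact h γ
  have h0 : hat Y hd = hat Y (zero_mem Y.Lg) := by
    have h1 := (hat_congr Y (zero_mem _) (sub_mem hd hd) (sub_self d).symm).trans (hat_sub Y hd hd)
    rw [this, h1, sub_self]
  exact hat_inj Y _ _ h0

lemma Glob.unitary {κ : ℝ} {z : H →L[ℂ] H} {hz : z ∈ Y.Lg} (h : Glob S (hat Y hz) κ) :
    star z * z = 1 ∧ z * star z = 1 := by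
  have hzM := LM Y hz
  have h1 : star z * z = 1 := by
    rw [← sub_eq_zero]
    refine S.y_tot (sub_mem (mul_mem (star_mem hz) hz) (one_mem _)) fun γ => ?_
    rw [mul_sub, mul_one, map_sub]
    by_cases hγ : γ = 1
    · subst hγ
      rw [S.y_one, one_mul, Y.tr.unital, ← inner_hat Y hz hz, inner_self_eq_norm_sq_to_K, h.nrm]
      simp
    · rw [S.y_tau hγ, sub_zero]
      have h2 := h.oR γ hγ
      rw [S.Ro_hat, inner_hat, star_mul, S.y_star, inv_inv, mul_assoc] at h2
      exact h2
  refine ⟨h1, ?_⟩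
  have hP : IsP (1 - z * star z) := by
    refine IsP.one_sub ⟨by rw [star_mul, star_star], ?_⟩
    rw [mul_assoc, ← mul_assoc (star z), h1, one_mul]
  have hm : 1 - z * star z ∈ Y.M := sub_mem (one_mem _) (mul_mem hzM (star_mem hzM))
  have := Y.tr.faithful _ hm (by
    rw [hP.1, hP.2, map_sub, Y.tr.tracial _ hzM _ (star_mem hzM), h1, sub_self])
  exact (sub_eq_zero.1 this).symm

lemma Glob.normalizes {κ : ℝ} {z : H →L[ℂ] H} {hz : z ∈ Y.Lg} (h : Glob S (hat Y hz) κ) :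
    Nrm Y (z * star w) := by
  obtain ⟨hz1, hz2⟩ := h.unitary
  have hab := S.hab
  have hzM := LM Y hz
  set x := z * star w with hx
  have hxM : x ∈ Y.M := mul_mem hzM (star_mem S.wM)
  have hxx : star x * x = 1 := by
    rw [hx, star_mul, star_star]
    calc _ = w * (star z * z) * star w := by simp only [mul_assoc]
      _ = 1 := by rw [hz1, mul_one, S.ws']
  have hxx' : x * star x = 1 := by
    rw [hx, star_mul, star_star]
    calc _ = z * (star w * w) * star z := by simp only [mul_assoc]
      _ = 1 := by rw [S.ws, mul_one, hz2]
  -- coefficients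
  set F : Λ → H →L[ℂ] H := fun s => S.G (Lo Y s (hat Y hz)) with hF
  have hFA : ∀ s, F s ∈ Y.A := fun s => S.G_mem _
  have hFM : ∀ s, F s ∈ Y.M := fun s => AM Y (hFA s)
  have hFE : ∀ s, F s = Y.EA.E (Y.u s * x) := fun s => by
    simp only [hF]; rw [Lo_hat, S.G_hat, hx, mul_assoc]
  have hFE' : ∀ s, Y.EA.E (star x * star (Y.u s)) = star (F s) := fun s => by
    rw [hFE, ← Y.EA.star_map _ (mul_mem (Y.u_mem s) hxM), star_mul (Y.u s) x]
  have iii : ∀ s, F s * (star (F s) * F s) = ((κ ^ 2 : ℝ) : ℂ) • F s := h.iii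
  have i : ∀ s t, s ≠ t → F s * star (F t) = 0 := fun s t hst => by
    have := h.ii' t (Lo Y s (hat Y hz))
    rwa [h.oL t s hst.symm, zero_smul] at this
  have iv : ∀ a ∈ Y.A, (∀ s, F s * a = 0) → a = 0 := fun a ha => h.iv ha
  have ivM : ∀ a ∈ Y.M, (∀ s, F s * a = 0) → a = 0 := by
    intro a ha h0
    refine Y.fourier_sep a ha fun t => iv _ (Y.EA.mem _ (mul_mem ha (star_mem (Y.u_mem t)))) fun s => ?_
    rw [← E_left Y.tr Y.EA (hFA s) (mul_mem ha (star_mem (Y.u_mem t))), ← mul_assoc, h0, zero_mul, map_zero]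
  -- the key identity
  have key : ∀ s, F s * star (F s) * star x = star (F s) * Y.u s * ((κ ^ 2 : ℝ) : ℂ) • 1 := by
    intro s
    have hm1 : F s * star (F s) * star x ∈ Y.M :=
      mul_mem (mul_mem (hFM s) (star_mem (hFM s))) (star_mem hxM)
    have hm2 : star (F s) * Y.u s ∈ Y.M := mul_mem (star_mem (hFM s)) (Y.u_mem s)
    rw [← sub_eq_zero]
    refine Y.fourier_sep _ (sub_mem hm1 (mul_mem hm2 (smul_mem_vN _ _ (one_mem _)))) fun t => ?_
    have e1 : Y.EA.E (F s * star (F s) * star x * star (Y.u t)) = F s * star (F s) * star (F t) := by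
      rw [mul_assoc (F s * star (F s)), E_left Y.tr Y.EA (mul_mem (hFA s) (star_mem (hFA s)))
        (mul_mem (star_mem hxM) (star_mem (Y.u_mem t))), hFE']
    have e2 : Y.EA.E (star (F s) * Y.u s * star (Y.u t)) = star (F s) * Y.EA.E (Y.u (s * t⁻¹)) := by
      rw [mul_assoc, Y.u_star, Y.u_mul, E_left Y.tr Y.EA (star_mem (hFA s)) (Y.u_mem _)]
    rw [sub_mul, map_sub, e1, mul_smul_comm, mul_one, smul_mul_assoc, map_smul, e2, E_u]
    by_cases hst : s = t
    · subst hst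
      rw [mul_inv_cancel, if_pos rfl, mul_one]
      have h5 := congrArg star (iii s)
      rw [star_mul, star_mul, star_star, star_smul] at h5
      rw [hab _ (hFA s) _ (star_mem (hFA s)), mul_assoc, hab _ (hFA s) _ (star_mem (hFA s)),
        hab _ (star_mem (hFA s)) _ (mul_mem (star_mem (hFA s)) (hFA s)), h5]
      simp
    · rw [if_neg (by rwa [mul_inv_eq_one]), mul_zero, smul_zero, sub_zero,
        hab _ (hFA s) _ (star_mem (hFA s)), mul_assoc, i s t hst, mul_zero]
  have hκ2 : ((κ ^ 2 : ℝ) : ℂ) ≠ 0 := by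
    have := h.pos
    exact_mod_cast (by positivity : κ ^ 2 ≠ 0)
  -- `F s x* = p s v s`
  have key2 : ∀ s, F s * star x = F s * star (F s) * Y.u s := by
    intro s
    have h1 := congrArg (F s * ·) (key s)
    have h2 : F s * (F s * star (F s) * star x) = ((κ ^ 2 : ℝ) : ℂ) • (F s * star x) := by
      rw [← mul_assoc, hab _ (hFA s) _ (star_mem (hFA s)), iii s, smul_mul_assoc]
    rw [h2, mul_smul_comm, mul_one, mul_smul_comm, ← mul_assoc] at h1
    exact smul_right_injective _ hκ2 h1
  have key3 : ∀ s, x * star (F s) = star (Y.u s) * (F s * star (F s)) := by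
    intro s
    have := congrArg star (key2 s)
    simpa only [star_mul, star_star] using this
  have hnm' : ∀ b ∈ Y.A, star x * b * x ∈ Y.A := by
    intro b hb
    have hm : star x * b * x ∈ Y.M := mul_mem (mul_mem (star_mem hxM) (AM Y hb)) hxM
    refine rel_comm Y hab S.hfree hm fun b' hb' => ?_
    have hb'M := AM Y hb'
    rw [← sub_eq_zero]
    set d := star x * b * x * b' - b' * (star x * b * x) with hd
    have hdM : d ∈ Y.M := sub_mem (mul_mem hm hb'M) (mul_mem hb'M hm)
    -- the corner
    have corner : ∀ s t, F s * (star x * b * x) * star (F t) ∈ Y.A := by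
      intro s t
      have hσ := Y.conj_mem s b hb
      have e : F s * (star x * b * x) * star (F t)
          = (Y.u s * b * star (Y.u s)) * ((F s * star (F s) * Y.u s) * (star (Y.u t) * (F t * star (F t)))) := by
        have hc := hab _ hσ _ (mul_mem (hFA s) (star_mem (hFA s)))
        calc _ = (F s * star x) * b * (x * star (F t)) := by simp only [mul_assoc]
          _ = (F s * star (F s)) * (Y.u s * b * (star (Y.u s) * Y.u s)) * (star (Y.u t) * (F t * star (F t))) := by
            rw [key2, key3, u_ss, mul_one]; simp only [mul_assoc]
          _ = ((F s * star (F s)) * (Y.u s * b * star (Y.u s))) * (Y.u s * (star (Y.u t) * (F t * star (F t)))) := by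
            simp only [mul_assoc]
          _ = _ := by rw [← hc]; simp only [mul_assoc]
      have e2 : (F s * star (F s) * Y.u s) * (star (Y.u t) * (F t * star (F t))) = F s * star (F t) := by
        rw [← key2, ← key3, mul_assoc, ← mul_assoc (star x), hxx, one_mul]
      rw [e, e2]
      exact mul_mem hσ (mul_mem (hFA s) (star_mem (hFA t)))
    have hcor : ∀ s t, F s * (d * star (F t)) = 0 := by
      intro s t
      have hc := corner s t
      calc F s * (d * star (F t))
          = F s * (star x * b * x) * (b' * star (F t)) - (F s * b') * (star x * b * x) * star (F t) := by
            rw [hd]; simp only [sub_mul, mul_sub, mul_assoc]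
        _ = (F s * (star x * b * x) * star (F t)) * b' - b' * (F s * (star x * b * x) * star (F t)) := by
            rw [hab _ hb' _ (star_mem (hFA t)), hab _ (hFA s) _ hb']; simp only [mul_assoc]
        _ = 0 := by rw [hab _ hc _ hb', sub_self]
    have h1 : ∀ t, d * star (F t) = 0 := fun t =>
      ivM _ (mul_mem hdM (star_mem (hFM t))) fun s => hcor s t
    have h2 : star d = 0 := ivM _ (star_mem hdM) fun t => by
      have := congrArg star (h1 t)
      rwa [star_mul, star_star, star_zero] at this
    exact star_eq_zero.1 h2
  refine ⟨hxM, hxx, hxx', fun b hb => ?_, hnm'⟩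
  refine rel_comm Y hab S.hfree (mul_mem (mul_mem hxM (AM Y hb)) (star_mem hxM)) fun b' hb' => ?_
  have hc := hab _ hb _ (hnm' b' hb')
  calc x * b * star x * b' = x * b * star x * b' * (x * star x) := by rw [hxx', mul_one]
    _ = x * (b * (star x * b' * x)) * star x := by simp only [mul_assoc]
    _ = x * ((star x * b' * x) * b) * star x := by rw [hc]
    _ = (x * star x) * b' * (x * b * star x) := by simp only [mul_assoc]
    _ = _ := by rw [hxx', one_mul]

/-- normalizers inside the group algebra -/
lemma nrm_Lg (hab : IsAbelianSet (Y.A : Set (H →L[ℂ] H))) (hfree : IsFree Y)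
    (hfac : IsFactorSet (Y.M : Set (H →L[ℂ] H))) {h : H →L[ℂ] H} (hh : Nrm Y h) (hL : h ∈ Y.Lg) :
    ∃ s, ∃ c : ℂ, ‖c‖ = 1 ∧ h = c • Y.u s := by
  obtain ⟨s, hs⟩ : ∃ s, pc Y h s ≠ 0 := by
    by_contra hcon
    push Not at hcon
    exact one_ne Y (pc_full Y hh (one_mem _) fun s => by rw [hcon s, zero_mul])
  have hP := pc_isP Y hab hfree hh s
  set c := Y.tr.τ (h * star (Y.u s)) with hc
  have hco : co Y h s = c • 1 := E_Lg Y hfac (mul_mem hL (star_mem (u_Lg Y s)))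
  have hpc : pc Y h s = c • (star h * Y.u s) := by
    rw [pc, hco, mul_smul_comm, mul_one, smul_mul_assoc]
  have hc0 : c ≠ 0 := by
    intro h0; rw [h0, zero_smul] at hpc; exact hs hpc
  have hinv : pc Y h s * (c⁻¹ • (star (Y.u s) * h)) = 1 := by
    rw [hpc, smul_mul_assoc, mul_smul_comm, smul_smul, mul_inv_cancel₀ hc0, one_smul]
    calc star h * Y.u s * (star (Y.u s) * h) = star h * (Y.u s * star (Y.u s)) * h := by simp only [mul_assoc]
      _ = 1 := by rw [u_ss', mul_one, hh.ss]
  have h1 : pc Y h s = 1 := by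
    calc pc Y h s = pc Y h s * (pc Y h s * (c⁻¹ • (star (Y.u s) * h))) := by rw [hinv, mul_one]
      _ = 1 := by rw [← mul_assoc, hP.2, hinv]
  have h2 : h = c • Y.u s := by
    have := g_pc Y hh s
    rwa [h1, mul_one, hco, smul_mul_assoc, one_mul] at this
  refine ⟨s, c, ?_, h2⟩
  have h3 := hh.ss
  rw [h2, star_smul, smul_mul_assoc, mul_smul_comm, smul_smul, u_ss] at h3
  have h4 := congrArg Y.tr.τ h3
  rw [map_smul, Y.tr.unital, smul_eq_mul, mul_one] at h4
  have h5 := congrArg norm h4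
  rw [norm_mul, norm_star, norm_one] at h5
  nlinarith [norm_nonneg c]

lemma u_unique {s t : Λ} {c d : ℂ} (hc : ‖c‖ = 1) (h : c • Y.u s = d • Y.u t) : s = t ∧ c = d := by
  have hc0 : c ≠ 0 := by rintro rfl; simp at hc
  have h1 := congrArg (fun a => Y.tr.τ (a * Y.u t⁻¹)) h
  simp only [smul_mul_assoc, Y.u_mul, map_smul, mul_inv_cancel, Y.u_one, Y.tr.unital, tau_u, smul_eq_mul,
    mul_one] at h1
  by_cases hst : s = t
  · refine ⟨hst, ?_⟩
    simpa [hst] using h1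
  · have h2 := congrArg (fun a => Y.tr.τ (a * Y.u s⁻¹)) h
    simp only [smul_mul_assoc, Y.u_mul, map_smul, mul_inv_cancel, Y.u_one, Y.tr.unital, tau_u, smul_eq_mul,
      mul_one] at h2
    rw [if_neg (by rw [mul_inv_eq_one]; exact fun h => hst h.symm), mul_zero] at h2
    exact absurd h2 hc0

theorem Setup.main [Countable Λ] (S : Setup Y g w) (hicc : IsICC Γ) :
    ∃ (x : H →L[ℂ] H) (η : Γ →* ℂ) (δ : Γ ≃* Λ), Nrm Y x ∧ x * w ∈ Y.Lg ∧ star (x * w) * (x * w) = 1 ∧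
      (x * w) * star (x * w) = 1 ∧ (∀ γ, ‖η γ‖ = 1) ∧ ∀ γ, x * g γ * star x = η γ • Y.u (δ γ) := by
  obtain ⟨ω', κ, hg'⟩ := S.glob hicc
  obtain ⟨s0, hs0⟩ := hg'.exists_ne
  obtain ⟨z, hz, hzω⟩ := (hg'.shift s0).bdd hs0
  have hg := hg'.shift s0
  rw [← hzω] at hg
  have hx := hg.normalizes
  obtain ⟨hz1, hz2⟩ := hg.unitary
  set x := z * star w with hxd
  have hxw : x * w = z := by rw [hxd, mul_assoc, S.ws, mul_one]
  have hxg : ∀ γ, x * g γ * star x = z * (star w * g γ * w) * star z := fun γ => by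
    rw [hxd, star_mul, star_star]; simp only [mul_assoc]
  have hex : ∀ γ, ∃ s, ∃ c : ℂ, ‖c‖ = 1 ∧ x * g γ * star x = c • Y.u s := fun γ =>
    nrm_Lg S.hab S.hfree S.hfac ((hx.mul Y (S.gN γ)).mul Y hx.star) (by
      rw [hxg]; exact mul_mem (mul_mem hz (S.yL γ)) (star_mem hz))
  choose δ η hη hδ using hex
  have hmul : ∀ γ γ', δ (γ * γ') = δ γ * δ γ' ∧ η (γ * γ') = η γ * η γ' := by
    intro γ γ'
    refine u_unique (Y := Y) (hη _) ?_
    rw [← hδ, ← Y.u_mul, ← S.g_mul]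
    calc x * (g γ * g γ') * star x = x * g γ * (star x * x) * g γ' * star x := by
          rw [hx.ss, mul_one]; simp only [mul_assoc]
      _ = (x * g γ * star x) * (x * g γ' * star x) := by simp only [mul_assoc]
      _ = _ := by rw [hδ, hδ, smul_mul_assoc, mul_smul_comm, smul_smul]
  have hone : δ 1 = 1 ∧ η 1 = 1 := by
    refine u_unique (Y := Y) (hη _) ?_
    rw [← hδ, S.g_one, mul_one, hx.ss', Y.u_one, one_smul]
  let η' : Γ →* ℂ := ⟨⟨η, hone.2⟩, fun a b => (hmul a b).2⟩
  let δ' : Γ →* Λ := ⟨⟨δ, hone.1⟩, fun a b => (hmul a b).1⟩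
  have hinj : Function.Injective δ' := by
    rw [injective_iff_map_eq_one]
    intro γ hγ
    by_contra hne
    have h1 : x * g γ * star x = η γ • 1 := by
      rw [hδ, show δ γ = 1 from hγ, Y.u_one]
    have h2 := congrArg Y.tr.τ h1
    rw [Y.tr.tracial _ (mul_mem hx.mem (S.gN γ).mem) _ (star_mem hx.mem), ← mul_assoc, hx.ss, one_mul, S.tau_g hne,
      map_smul, Y.tr.unital, smul_eq_mul, mul_one] at h2
    have h3 := hη γ
    rw [← h2, norm_zero] at h3
    exact zero_ne_one h3
  have hsurj : Function.Surjective δ' := by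
    intro s
    by_contra hcon
    push Not at hcon
    have hm : star z * Y.u s⁻¹ * z ∈ Y.Lg := mul_mem (mul_mem (star_mem hz) (u_Lg Y _)) hz
    have h0 := S.y_tot hm fun γ => by
      have e : star w * g γ * w * (star z * Y.u s⁻¹ * z) = (star w * g γ * w * star z * Y.u s⁻¹) * z := by
        simp only [mul_assoc]
      rw [e, Y.tr.tracial _ (LM Y (mul_mem (mul_mem (S.yL γ) (star_mem hz)) (u_Lg Y _))) _ (LM Y hz)]
      have e2 : z * (star w * g γ * w * star z * Y.u s⁻¹) = (z * (star w * g γ * w) * star z) * Y.u s⁻¹ := by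
        simp only [mul_assoc]
      rw [e2, ← hxg, hδ, smul_mul_assoc, map_smul, Y.u_mul, tau_u, if_neg, smul_zero]
      rw [mul_inv_eq_one]
      exact hcon γ
    have h1 : Y.u s⁻¹ = 0 := by
      calc Y.u s⁻¹ = (z * star z) * Y.u s⁻¹ * (z * star z) := by rw [hz2, one_mul, mul_one]
        _ = z * (star z * Y.u s⁻¹ * z) * star z := by simp only [mul_assoc]
        _ = 0 := by rw [h0, mul_zero, zero_mul]
    have h2 := u_ss Y s⁻¹
    rw [h1, mul_zero] at h2
    exact one_ne Y h2.symm
  refine ⟨x, η', MulEquiv.ofBijective δ' ⟨hinj, hsurj⟩, hx, ?_, ?_, ?_, hη, hδ⟩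
  · rw [hxw]; exact hz
  · rw [hxw, hz1]
  · rw [hxw, hz2]

end fin2
end CDP
end

noncomputable section
open scoped Classical

namespace CDP
open CD Filter Topology

section last
variable {Γ : Type} [Group Γ] {Λ : Type} [Group Λ]
variable {H₁ : Type} [NormedAddCommGroup H₁] [InnerProductSpace ℂ H₁] [CompleteSpace H₁]
variable {H₂ : Type} [NormedAddCommGroup H₂] [InnerProductSpace ℂ H₂] [CompleteSpace H₂]
variable {X : CrossedProduct Γ H₁} {Y : CrossedProduct Λ H₂}
variable (Θ : StarIsoOn (X.M : Set (H₁ →L[ℂ] H₁)) (Y.M : Set (H₂ →L[ℂ] H₂)))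

lemma theta_zero : Θ.Θ 0 = 0 := by
  have := Θ.map_smul 0 0 (zero_mem X.M)
  simpa using this

lemma theta_sub {a b : H₁ →L[ℂ] H₁} (ha : a ∈ X.M) (hb : b ∈ X.M) : Θ.Θ (a - b) = Θ.Θ a - Θ.Θ b := by
  have h1 := Θ.map_add a ha ((-1 : ℂ) • b) (smul_mem_vN _ _ hb)
  rw [Θ.map_smul _ b hb] at h1
  simpa [sub_eq_add_neg] using h1

lemma pull_trace : ∃ tr : TraceOn H₁ (X.M : Set (H₁ →L[ℂ] H₁)), ∀ a ∈ X.M, tr.τ a = Y.tr.τ (Θ.Θ a) := by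
  let p : Submodule ℂ (H₁ →L[ℂ] H₁) := X.M.toStarSubalgebra.toSubalgebra.toSubmodule
  let f : p →ₗ[ℂ] ℂ :=
    { toFun := fun a => Y.tr.τ (Θ.Θ a.1)
      map_add' := fun a b => by
        rw [Submodule.coe_add, Θ.map_add _ a.2 _ b.2, map_add]
      map_smul' := fun c a => by
        rw [Submodule.coe_smul, Θ.map_smul _ _ a.2, map_smul]; rfl }
  obtain ⟨T, hT⟩ := LinearMap.exists_extend f
  have hT' : ∀ a ∈ X.M, T a = Y.tr.τ (Θ.Θ a) := fun a ha => by
    have := LinearMap.congr_fun hT ⟨a, ha⟩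
    exact this
  have hsm : ∀ x ∈ X.M, T (star x * x) = Y.tr.τ (star (Θ.Θ x) * Θ.Θ x) := fun x hx => by
    rw [hT' _ (mul_mem (star_mem hx) hx), Θ.map_mul _ (star_mem hx) _ hx, Θ.map_star _ hx]
  refine ⟨⟨T, ?_, fun x hx y hy => ?_, fun x hx => ?_, fun x hx => ?_, fun x hx h => ?_⟩, hT'⟩
  · rw [hT' 1 (one_mem _), Θ.map_one, Y.tr.unital]
  · rw [hT' _ (mul_mem hx hy), hT' _ (mul_mem hy hx), Θ.map_mul _ hx _ hy, Θ.map_mul _ hy _ hx,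
      Y.tr.tracial _ (Θ.mem _ hx) _ (Θ.mem _ hy)]
  · rw [hT' _ (star_mem hx), hT' _ hx, Θ.map_star _ hx, Y.tr.star_eq _ (Θ.mem _ hx)]
  · rw [hsm x hx]; exact Y.tr.nonneg _ (Θ.mem _ hx)
  · rw [hsm x hx] at h
    have := Y.tr.faithful _ (Θ.mem _ hx) h
    exact Θ.inj _ hx _ (zero_mem X.M) (by rw [this, theta_zero])

lemma build (habelX : IsAbelianSet (X.A : Set (H₁ →L[ℂ] H₁)))
    (habelY : IsAbelianSet (Y.A : Set (H₂ →L[ℂ] H₂)))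
    (hfreeX : IsFree X) (hergX : IsErgodic X)
    (hfreeY : IsFree Y) (hergY : IsErgodic Y)
    (hΘA : Θ.Θ '' (X.A : Set (H₁ →L[ℂ] H₁)) = (Y.A : Set (H₂ →L[ℂ] H₂)))
    (w : H₂ →L[ℂ] H₂) (hw : IsUnitaryIn (Y.M : Set (H₂ →L[ℂ] H₂)) w)
    (hΘL : Θ.Θ '' (X.Lg : Set (H₁ →L[ℂ] H₁)) = conjSet w (Y.Lg : Set (H₂ →L[ℂ] H₂))) :
    Setup Y (fun γ => Θ.Θ (X.u γ)) w := by
  obtain ⟨hwM, hws, hws'⟩ := hw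
  have hs : ∀ γ, star (Θ.Θ (X.u γ)) = Θ.Θ (X.u γ⁻¹) := fun γ => by
    rw [← Θ.map_star _ (X.u_mem γ), X.u_star]
  have hm : ∀ γ δ, Θ.Θ (X.u γ) * Θ.Θ (X.u δ) = Θ.Θ (X.u (γ * δ)) := fun γ δ => by
    rw [← Θ.map_mul _ (X.u_mem γ) _ (X.u_mem δ), X.u_mul]
  have h1 : Θ.Θ (X.u 1) = 1 := by rw [X.u_one, Θ.map_one]
  have hA : ∀ b ∈ Y.A, ∃ a ∈ X.A, Θ.Θ a = b := fun b hb => by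
    have : b ∈ (Y.A : Set (H₂ →L[ℂ] H₂)) := hb
    rw [← hΘA] at this
    exact this
  have hA' : ∀ a ∈ X.A, Θ.Θ a ∈ Y.A := fun a ha => by
    have : Θ.Θ a ∈ Θ.Θ '' (X.A : Set (H₁ →L[ℂ] H₁)) := ⟨a, ha, rfl⟩
    rw [hΘA] at this
    exact this
  have hconj : ∀ γ, ∀ a ∈ X.A, Θ.Θ (X.u γ) * Θ.Θ a * star (Θ.Θ (X.u γ)) = Θ.Θ (X.σ γ a) := fun γ a ha => by
    rw [CrossedProduct.σ, Θ.map_mul _ (mul_mem (X.u_mem γ) (AM X ha)) _ (star_mem (X.u_mem γ)),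
      Θ.map_mul _ (X.u_mem γ) _ (AM X ha), Θ.map_star _ (X.u_mem γ)]
  have hσM : ∀ γ, ∀ a ∈ X.A, X.σ γ a ∈ X.M := fun γ a ha => AM X (X.conj_mem γ a ha)
  have hnm : ∀ γ, ∀ b ∈ Y.A, Θ.Θ (X.u γ) * b * star (Θ.Θ (X.u γ)) ∈ Y.A := by
    intro γ b hb
    obtain ⟨a, ha, rfl⟩ := hA b hb
    rw [hconj γ a ha]
    exact hA' _ (X.conj_mem γ a ha)
  refine ⟨habelY, hfreeY, is_factor Y habelY hfreeY hergY, hwM, hws, hws', fun γ => ?_, h1, hm, hs, ?_, ?_, ?_, ?_⟩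
  · refine ⟨Θ.mem _ (X.u_mem γ), ?_, ?_, hnm γ, fun b hb => ?_⟩
    · rw [hs, hm, inv_mul_cancel, h1]
    · rw [hs, hm, mul_inv_cancel, h1]
    · have := hnm γ⁻¹ b hb
      rwa [hs, inv_inv, ← hs γ] at this
  · intro γ hγ a ha h
    obtain ⟨a0, ha0, rfl⟩ := hA a ha
    have : a0 = 0 := by
      refine hfreeX γ hγ a0 ha0 fun b hb => ?_
      have h2 := h _ (hA' b hb)
      rw [hconj γ b hb, ← Θ.map_mul _ (hσM γ b hb) _ (AM X ha0), ← Θ.map_mul _ (AM X ha0) _ (AM X hb)] at h2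
      exact Θ.inj _ (mul_mem (hσM γ b hb) (AM X ha0)) _ (mul_mem (AM X ha0) (AM X hb)) h2
    rw [this, theta_zero]
  · intro a ha h
    obtain ⟨a0, ha0, rfl⟩ := hA a ha
    obtain ⟨c, hc⟩ := hergX a0 ha0 fun γ => by
      have h2 := h γ
      rw [hconj γ a0 ha0] at h2
      exact Θ.inj _ (hσM γ a0 ha0) _ (AM X ha0) h2
    exact ⟨c, by rw [hc, Θ.map_smul _ _ (one_mem X.M), Θ.map_one]⟩
  · intro γ
    have : Θ.Θ (X.u γ) ∈ Θ.Θ '' (X.Lg : Set (H₁ →L[ℂ] H₁)) := ⟨_, u_Lg X γ, rfl⟩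
    rw [hΘL] at this
    obtain ⟨l, hl, he⟩ := this
    have he' : w * l * star w = Θ.Θ (X.u γ) := he
    rw [← he']
    have : star w * (w * l * star w) * w = l := by
      calc _ = (star w * w) * l * (star w * w) := by simp only [mul_assoc]
        _ = l := by rw [hws, one_mul, mul_one]
    rw [this]
    exact hl
  · intro l hl ε hε
    have hwl : w * l * star w ∈ conjSet w (Y.Lg : Set (H₂ →L[ℂ] H₂)) := ⟨l, hl, rfl⟩
    rw [← hΘL] at hwl
    obtain ⟨l', hl', he⟩ := hwl
    obtain ⟨tr, htr⟩ := pull_trace Θ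
    have hspan : ∀ a ∈ Submodule.span ℂ (Set.range X.u), star w * Θ.Θ a * w
          ∈ Submodule.span ℂ (Set.range fun γ => star w * Θ.Θ (X.u γ) * w) := by
      intro a ha
      induction ha using Submodule.span_induction with
      | mem y hy =>
        obtain ⟨γ, rfl⟩ := hy
        exact Submodule.subset_span ⟨γ, rfl⟩
      | zero => rw [theta_zero, mul_zero, zero_mul]; exact zero_mem _
      | add y z hy hz ihy ihz =>
        rw [Θ.map_add _ (span_M X hy) _ (span_M X hz), mul_add, add_mul]
        exact add_mem ihy ihz
      | smul c y hy ih =>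
        rw [Θ.map_smul _ _ (span_M X hy), mul_smul_comm, smul_mul_assoc]
        exact Submodule.smul_mem _ _ ih
    obtain ⟨a, ha, hlt⟩ := span_dense X (is_factor X habelX hfreeX hergX) tr hl' hε
    have haM := span_M X ha
    have hl'M := LM X hl'
    refine ⟨star w * Θ.Θ a * w, ?_, ?_⟩
    · exact hspan a ha
    · have hd := theta_sub Θ hl'M haM
      have hdm := Θ.mem _ (sub_mem hl'M haM)
      have e : l - star w * Θ.Θ a * w = star w * Θ.Θ (l' - a) * w := by
        rw [hd, he]
        calc _ = (star w * w) * l * (star w * w) - star w * Θ.Θ a * w := by rw [hws, one_mul, mul_one]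
          _ = _ := by simp only [mul_sub, sub_mul, mul_assoc]
      have e2 : nsq Y.tr (star w * Θ.Θ (l' - a) * w) = nsq tr (l' - a) := by
        unfold nsq
        have hM := sub_mem hl'M haM
        rw [htr _ (mul_mem (star_mem hM) hM), Θ.map_mul _ (star_mem hM) _ hM, Θ.map_star _ hM]
        set d := Θ.Θ (l' - a) with hdd
        have : star (star w * d * w) * (star w * d * w) = star w * (star d * d * w) := by
          simp only [star_mul, star_star]
          calc _ = star w * star d * (w * star w) * d * w := by simp only [mul_assoc]
            _ = _ := by rw [hws', mul_one]; simp only [mul_assoc]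
        rw [this, Y.tr.tracial _ (star_mem hwM) _ (mul_mem (mul_mem (star_mem hdm) hdm) hwM), mul_assoc, hws', mul_one]
      rw [e, e2]
      exact hlt

end last
end CDP
end


open CD in
/-- Theorem `3'`. Let `Γ ↷ X`, `Λ ↷ Y` be free ergodic pmp actions
with `Γ` icc, and `Θ : L^∞(X) ⋊ Γ → L^∞(Y) ⋊ Λ` a `*`-isomorphism with
`Θ(L^∞(X)) = L^∞(Y)` and `Θ(L(Γ)) = u L(Λ) u*` for some unitary `u`. Then there are a
unitary `x` normalizing `L^∞(Y)`, a character `η : Γ → 𝕋` and a group isomorphism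
`δ : Γ → Λ` with `x u ∈ U(L(Λ))` and `Θ(a u_γ) = η(γ) Θ(a) x* v_{δ(γ)} x`; in
particular `x Θ(σ_γ(a)) x* = α_{δ(γ)}(x Θ(a) x*)`, so the actions are conjugate. -/
theorem stmt19_conjugacy_criterion
    (Γ : Type) [Group Γ] [Countable Γ] (hicc : IsICC Γ)
    (Λ : Type) [Group Λ] [Countable Λ]
    (H₁ : Type) [NormedAddCommGroup H₁] [InnerProductSpace ℂ H₁] [CompleteSpace H₁]
    (H₂ : Type) [NormedAddCommGroup H₂] [InnerProductSpace ℂ H₂] [CompleteSpace H₂]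
    -- the group measure space algebras, with abelian coefficient algebras
    (X : CrossedProduct Γ H₁) (Y : CrossedProduct Λ H₂)
    (habelX : IsAbelianSet (X.A : Set (H₁ →L[ℂ] H₁)))
    (habelY : IsAbelianSet (Y.A : Set (H₂ →L[ℂ] H₂)))
    -- both actions are free and ergodic
    (hfreeX : IsFree X) (hergX : IsErgodic X)
    (hfreeY : IsFree Y) (hergY : IsErgodic Y)
    -- the `*`-isomorphism with `Θ(L^∞(X)) = L^∞(Y)`
    (Θ : StarIsoOn (X.M : Set (H₁ →L[ℂ] H₁)) (Y.M : Set (H₂ →L[ℂ] H₂)))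
    (hΘA : Θ.Θ '' (X.A : Set (H₁ →L[ℂ] H₁)) = (Y.A : Set (H₂ →L[ℂ] H₂)))
    -- a unitary `u ∈ L^∞(Y) ⋊ Λ` with `Θ(L(Γ)) = u L(Λ) u*`
    (w : H₂ →L[ℂ] H₂) (hw : IsUnitaryIn (Y.M : Set (H₂ →L[ℂ] H₂)) w)
    (hΘL : Θ.Θ '' (X.Lg : Set (H₁ →L[ℂ] H₁)) = conjSet w (Y.Lg : Set (H₂ →L[ℂ] H₂))) :
    ∃ (x : H₂ →L[ℂ] H₂) (η : Γ →* ℂ) (δ : Γ ≃* Λ),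
      -- `x ∈ N_{L^∞(Y) ⋊ Λ}(L^∞(Y))`
      IsUnitaryIn (Y.M : Set (H₂ →L[ℂ] H₂)) x ∧
      conjSet x (Y.A : Set (H₂ →L[ℂ] H₂)) = (Y.A : Set (H₂ →L[ℂ] H₂)) ∧
      -- `x u ∈ U(L(Λ))`
      IsUnitaryIn (Y.Lg : Set (H₂ →L[ℂ] H₂)) (x * w) ∧
      -- `η` is a character
      (∀ γ : Γ, ‖η γ‖ = 1) ∧
      -- `Θ(a u_γ) = η(γ) Θ(a) x* v_{δ(γ)} x`
      (∀ a ∈ X.A, ∀ γ : Γ,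
        Θ.Θ (a * X.u γ) = η γ • (Θ.Θ a * (star x * Y.u (δ γ) * x))) ∧
      -- conjugacy of the actions: `x Θ(σ_γ(a)) x* = α_{δ(γ)}(x Θ(a) x*)`
      (∀ a ∈ X.A, ∀ γ : Γ,
        x * Θ.Θ (X.σ γ a) * star x = Y.σ (δ γ) (x * Θ.Θ a * star x)) := by
  obtain ⟨x, η, δ, hx, hL, hu1, hu2, hη, hδ⟩ :=
    (CDP.build Θ habelX habelY hfreeX hergX hfreeY hergY hΘA w hw hΘL).main hicc
  have hA' : ∀ a ∈ X.A, Θ.Θ a ∈ Y.A := fun a ha => by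
    have : Θ.Θ a ∈ Θ.Θ '' (X.A : Set (H₁ →L[ℂ] H₁)) := ⟨a, ha, rfl⟩
    rw [hΘA] at this
    exact this
  have hg : ∀ γ, Θ.Θ (X.u γ) = η γ • (star x * Y.u (δ γ) * x) := fun γ => by
    calc Θ.Θ (X.u γ) = (star x * x) * Θ.Θ (X.u γ) * (star x * x) := by rw [hx.ss, one_mul, mul_one]
      _ = star x * (x * Θ.Θ (X.u γ) * star x) * x := by simp only [mul_assoc]
      _ = _ := by rw [hδ γ, mul_smul_comm, smul_mul_assoc]
  refine ⟨x, η, δ, ⟨hx.mem, hx.ss, hx.ss'⟩, ?_, ⟨hL, hu1, hu2⟩, hη, fun a ha γ => ?_, fun a ha γ => ?_⟩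
  · ext b
    constructor
    · rintro ⟨a, ha, rfl⟩
      exact hx.nm a ha
    · intro hb
      refine ⟨star x * b * x, hx.nm' b hb, ?_⟩
      change x * (star x * b * x) * star x = b
      calc _ = (x * star x) * b * (x * star x) := by simp only [mul_assoc]
        _ = b := by rw [hx.ss', one_mul, mul_one]
  · rw [Θ.map_mul _ (CDP.AM X ha) _ (X.u_mem γ), hg γ, mul_smul_comm]
  · have haM := CDP.AM X ha
    have hηη : η γ * starRingEnd ℂ (η γ) = 1 := by
      rw [Complex.mul_conj, Complex.normSq_eq_norm_sq, hη γ]; simp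
    rw [CrossedProduct.σ, CrossedProduct.σ, Θ.map_mul _ (mul_mem (X.u_mem γ) haM) _ (star_mem (X.u_mem γ)),
      Θ.map_mul _ (X.u_mem γ) _ haM, Θ.map_star _ (X.u_mem γ)]
    have hδ' : x * Θ.Θ (X.u γ) * star x = η γ • Y.u (δ γ) := hδ γ
    have hδs : x * star (Θ.Θ (X.u γ)) * star x = starRingEnd ℂ (η γ) • star (Y.u (δ γ)) := by
      have := congrArg star hδ'
      rw [star_mul, star_mul, star_star, star_smul] at this
      rw [mul_assoc]
      exact this
    calc x * (Θ.Θ (X.u γ) * Θ.Θ a * star (Θ.Θ (X.u γ))) * star x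
        = x * Θ.Θ (X.u γ) * (star x * x) * Θ.Θ a * (star x * x) * star (Θ.Θ (X.u γ)) * star x := by
          rw [hx.ss, mul_one, mul_one]; simp only [mul_assoc]
      _ = (x * Θ.Θ (X.u γ) * star x) * (x * Θ.Θ a * star x) * (x * star (Θ.Θ (X.u γ)) * star x) := by
          simp only [mul_assoc]
      _ = (η γ * starRingEnd ℂ (η γ)) • (Y.u (δ γ) * (x * Θ.Θ a * star x) * star (Y.u (δ γ))) := by
          rw [hδ', hδs, smul_mul_assoc, smul_mul_assoc, mul_smul_comm, smul_smul]
      _ = _ := by rw [hηη, one_smul]
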